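/- There exist at least 18 imaginary triquadratic fields K (realized as subfields of ℂ; since such fields are Galois over ℚ, subfields of ℂ correspond bijectively to isomorphism classes) with Cl(K) ≅ C₅, at least 26 with Cl(K) ≅ C₅², at least 6 with Cl(K) ≅ C₅³, and at least 1 with Cl(K) ≅ C₅⁴. -/

import Mathlib

open NumberField

/-- An `n`-quadratic field realized as a subfield of `ℂ`: a finite Galois extension of `ℚ`
with Galois group isomorphic to the elementary abelian 2-group of rank `n`. -/
def IsNQuadratic (n : ℕ) (K : IntermediateField ℚ ℂ) : Prop :=
  FiniteDimensional ℚ K ∧ IsGalois ℚ K ∧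
    Nonempty ((K ≃ₐ[ℚ] K) ≃* (Fin n → Multiplicative (ZMod 2)))

/-- A subfield of `ℂ` is imaginary if it is not contained in `ℝ`; for fields that are Galois
over `ℚ` this is equivalent to not being totally real. -/
def IsImaginary (K : IntermediateField ℚ ℂ) : Prop :=
  ∃ x : K, (x : ℂ).im ≠ 0

open scoped Pointwise

namespace Quin

section A
variable {K : Type*} [Field K] [NumberField K]

/-- The Galois action on integers is compatible with the field. -/
lemma coe_smul (g : K ≃ₐ[ℚ] K) (x : 𝓞 K) : ((g • x : 𝓞 K) : K) = g (x : K) := rfl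

lemma absNorm_smul (g : K ≃ₐ[ℚ] K) (I : Ideal (𝓞 K)) :
    Ideal.absNorm (g • I) = Ideal.absNorm I := by
  rw [← Ideal.absNorm_relNorm ℤ, Ideal.relNorm_smul, Ideal.absNorm_relNorm]

lemma galF (H : Subgroup (K ≃ₐ[ℚ] K)) : IsGalois (IntermediateField.fixedField H) K :=
  IsGalois.of_fixed_field K H

lemma finrank_ints (k : IntermediateField ℚ K) : Module.finrank (𝓞 k) (𝓞 K) = Module.finrank k K :=
  (IsFractionRing.finrank_eq (𝓞 k) k (𝓞 K) K).symm

lemma eq_of_le_of_absNorm {I J : Ideal (𝓞 K)} (h : I ≤ J) (hI : I ≠ ⊥)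
    (hn : Ideal.absNorm I = Ideal.absNorm J) : I = J := by
  obtain ⟨Q, rfl⟩ := Ideal.dvd_iff_le.mpr h
  rw [map_mul] at hn
  have hJ : Ideal.absNorm J ≠ 0 := by
    rw [Ne, Ideal.absNorm_eq_zero_iff]
    rintro rfl
    simp at hI
  have : Ideal.absNorm Q = 1 := by
    exact Nat.eq_of_mul_eq_mul_left (Nat.pos_of_ne_zero hJ) (by rw [hn, mul_one])
  rw [Ideal.absNorm_eq_one_iff] at this
  subst this
  simp

lemma map_relNorm_eq (H : Subgroup (K ≃ₐ[ℚ] K)) [Fintype H] (I : Ideal (𝓞 K)) :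
    (Ideal.relNorm (𝓞 (IntermediateField.fixedField H)) I).map
      (algebraMap (𝓞 (IntermediateField.fixedField H)) (𝓞 K)) = ∏ g : H, (g : K ≃ₐ[ℚ] K) • I := by
  classical
  by_cases hI : I = ⊥
  · subst hI
    simp
  have hle : (Ideal.relNorm (𝓞 (IntermediateField.fixedField H)) I).map
      (algebraMap (𝓞 (IntermediateField.fixedField H)) (𝓞 K)) ≤ ∏ g : H, (g : K ≃ₐ[ℚ] K) • I := by
    rw [Ideal.map_relNorm, Ideal.span_le]
    rintro _ ⟨x, hx, rfl⟩
    have : (algebraMap (𝓞 (IntermediateField.fixedField H)) (𝓞 K)) 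
       (Algebra.intNorm (𝓞 (IntermediateField.fixedField H)) (𝓞 K) x) = ∏ g : H, (g : K ≃ₐ[ℚ] K) • x := by
      have := galF H
      apply RingOfIntegers.ext
      have h0 : ((∏ g : H, (g : K ≃ₐ[ℚ] K) • x : 𝓞 K) : K) = ∏ g : H, (g : K ≃ₐ[ℚ] K) (x : K) :=
        map_prod (algebraMap (𝓞 K) K) _ _
      rw [h0]
      have h1 := Algebra.algebraMap_intNorm (K := IntermediateField.fixedField H) (L := K)
        (A := 𝓞 (IntermediateField.fixedField H)) (B := 𝓞 K) x
      have h2 := Algebra.norm_eq_prod_automorphisms (IntermediateField.fixedField H) (x : K)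
      rw [← h1] at h2
      refine Eq.trans h2 ?_
      symm
      refine Fintype.prod_equiv (IntermediateField.subgroupEquivAlgEquiv H).toEquiv _ _ ?_
      intro g
      rfl
    simp only [Function.comp_apply, SetLike.mem_coe]
    rw [this]
    exact Ideal.prod_mem_prod fun g _ => Ideal.smul_mem_pointwise_smul _ _ _ hx
  have hJ : (∏ g : H, (g : K ≃ₐ[ℚ] K) • I) ≠ ⊥ := by
    rw [Ne, ← Ideal.zero_eq_bot, Finset.prod_eq_zero_iff]
    rintro ⟨g, _, hg⟩
    apply hI
    rw [← Ideal.absNorm_eq_zero_iff, ← absNorm_smul g.1, hg]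
    simp
  have hne : (Ideal.relNorm (𝓞 (IntermediateField.fixedField H)) I).map
      (algebraMap (𝓞 (IntermediateField.fixedField H)) (𝓞 K)) ≠ ⊥ := by
    rw [Ne, Ideal.map_eq_bot_iff_of_injective (RingOfIntegers.algebraMap.injective _ _),
      Ideal.relNorm_eq_bot_iff]
    exact hI
  apply eq_of_le_of_absNorm hle hne
  rw [Ideal.absNorm_algebraMap, Ideal.absNorm_relNorm, finrank_ints,
    IntermediateField.finrank_fixedField_eq_card, map_prod]
  simp [absNorm_smul]

open nonZeroDivisors in
/-- The ideal class of an ideal (trivial for the zero ideal). -/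
noncomputable def cl (I : Ideal (𝓞 K)) : ClassGroup (𝓞 K) :=
  open Classical in
  if h : I = ⊥ then 1 else ClassGroup.mk0 ⟨I, mem_nonZeroDivisors_of_ne_zero h⟩

lemma cl_mul {I J : Ideal (𝓞 K)} (hI : I ≠ ⊥) (hJ : J ≠ ⊥) : cl (I * J) = cl I * cl J := by
  have h : I * J ≠ ⊥ := mul_ne_zero hI hJ
  rw [cl, cl, cl, dif_neg hI, dif_neg hJ, dif_neg h, ← map_mul]
  rfl

lemma cl_top : cl (⊤ : Ideal (𝓞 K)) = 1 := by
  by_cases h : (⊤ : Ideal (𝓞 K)) = ⊥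
  · rw [cl, dif_pos h]
  · rw [cl, dif_neg h, ClassGroup.mk0_eq_one_iff]
    exact ⟨1, by simp⟩

lemma cl_pow {I : Ideal (𝓞 K)} (hI : I ≠ ⊥) (n : ℕ) : cl (I ^ n) = cl I ^ n := by
  induction n with
  | zero => simp [Ideal.one_eq_top, cl_top]
  | succ n ih => rw [pow_succ, pow_succ, cl_mul (pow_ne_zero n hI) hI, ih]

lemma cl_prod {ι : Type*} (s : Finset ι) (f : ι → Ideal (𝓞 K)) (hf : ∀ i ∈ s, f i ≠ ⊥) :
    cl (∏ i ∈ s, f i) = ∏ i ∈ s, cl (f i) := by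
  classical
  induction s using Finset.induction_on with
  | empty => simp [Ideal.one_eq_top, cl_top]
  | insert a s ha ih =>
    rw [Finset.prod_insert ha, Finset.prod_insert ha, cl_mul (hf a (by simp)), ih]
    · intro i hi
      exact hf i (by simp [hi])
    · exact Finset.prod_ne_zero_iff.mpr fun i hi => hf i (by simp [hi])

lemma cl_eq_one_iff {I : Ideal (𝓞 K)} : cl I = 1 ↔ I.IsPrincipal := by
  by_cases h : I = ⊥
  · subst h
    rw [cl, dif_pos rfl]
    exact ⟨fun _ => inferInstance, fun _ => rfl⟩
  · rw [cl, dif_neg h, ClassGroup.mk0_eq_one_iff]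

lemma cl_span (x : 𝓞 K) : cl (Ideal.span {x}) = 1 := cl_eq_one_iff.mpr ⟨x, rfl⟩

lemma cl_eq_iff {I J : Ideal (𝓞 K)} (hI : I ≠ ⊥) (hJ : J ≠ ⊥) :
    cl I = cl J ↔ ∃ x y : 𝓞 K, x ≠ 0 ∧ y ≠ 0 ∧ Ideal.span {x} * I = Ideal.span {y} * J := by
  rw [cl, cl, dif_neg hI, dif_neg hJ, ClassGroup.mk0_eq_mk0_iff]
  simp only [exists_prop]

lemma cl_surj (c : ClassGroup (𝓞 K)) : ∃ I : Ideal (𝓞 K), I ≠ ⊥ ∧ cl I = c := by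
  obtain ⟨⟨I, hI⟩, rfl⟩ := ClassGroup.mk0_surjective c
  have : I ≠ ⊥ := nonZeroDivisors.ne_zero hI
  exact ⟨I, this, by rw [cl, dif_neg this]⟩

lemma smul_ne_bot (g : K ≃ₐ[ℚ] K) {I : Ideal (𝓞 K)} (hI : I ≠ ⊥) : g • I ≠ ⊥ := by
  rwa [Ne, ← Ideal.absNorm_eq_zero_iff, absNorm_smul, Ideal.absNorm_eq_zero_iff]

lemma smul_span (g : K ≃ₐ[ℚ] K) (x : 𝓞 K) :
    g • (Ideal.span {x} : Ideal (𝓞 K)) = Ideal.span {g • x} := by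
  rw [Ideal.smul_closure, Set.smul_set_singleton]

/-- odd order class -/
def OddI (I : Ideal (𝓞 K)) : Prop := ∃ n, Odd n ∧ cl I ^ n = 1

variable (K) in
/-- odd class number -/
def OddClass : Prop := ∀ I : Ideal (𝓞 K), OddI I

lemma OddI.mul {I J : Ideal (𝓞 K)} (h1 : OddI I) (h2 : OddI J) : OddI (I * J) := by
  by_cases hI : I = ⊥
  · subst hI; simpa using h1
  by_cases hJ : J = ⊥
  · subst hJ; simpa using h2
  obtain ⟨n, hn, h1⟩ := h1
  obtain ⟨m, hm, h2⟩ := h2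
  refine ⟨n * m, hn.mul hm, ?_⟩
  rw [cl_mul hI hJ, mul_pow, pow_mul, h1, mul_comm n, pow_mul, h2]
  simp

lemma oddI_span (x : 𝓞 K) : OddI (Ideal.span {x}) := ⟨1, by decide, by rw [cl_span, one_pow]⟩

lemma oddI_map {k : IntermediateField ℚ K} (hk : OddClass k) (I : Ideal (𝓞 k)) :
    OddI (I.map (algebraMap (𝓞 k) (𝓞 K))) := by
  obtain ⟨n, hn, h⟩ := hk I
  refine ⟨n, hn, ?_⟩
  by_cases hI : I = ⊥
  · subst hI
    simp [cl]
  have hI' : I.map (algebraMap (𝓞 k) (𝓞 K)) ≠ ⊥ := by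
    rwa [Ne, Ideal.map_eq_bot_iff_of_injective (RingOfIntegers.algebraMap.injective _ _)]
  rw [← cl_pow hI, cl_eq_one_iff] at h
  rw [← cl_pow hI', cl_eq_one_iff, ← Ideal.map_pow]
  exact h.map_ringHom _

lemma cl_smul_eq {g : K ≃ₐ[ℚ] K} {I : Ideal (𝓞 K)} (h : cl I = 1) : cl (g • I) = 1 := by
  rw [cl_eq_one_iff] at h ⊢
  obtain ⟨x, hx⟩ := h
  refine ⟨g • x, ?_⟩
  change I = Ideal.span {x} at hx
  rw [hx, smul_span]
end A
end Quin

namespace Quin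
section B
variable {K : Type*} [Field K] [NumberField K]

lemma odd_of_two_torsion (h : ∀ I : Ideal (𝓞 K), I ≠ ⊥ → cl I ^ 2 = 1 → OddI I) : OddClass K := by
  have h2 : ∀ c : ClassGroup (𝓞 K), c ^ 2 = 1 → c = 1 := by
    intro c hc
    obtain ⟨I, hI, rfl⟩ := cl_surj c
    obtain ⟨n, ⟨m, rfl⟩, hn⟩ := h I hI hc
    rwa [pow_succ, pow_mul, hc, one_pow, one_mul] at hn
  intro I
  refine ⟨orderOf (cl I), ?_, pow_orderOf_eq_one _⟩
  rw [← Nat.not_even_iff_odd]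
  rintro ⟨m, hm⟩
  have h3 := h2 (cl I ^ m) (by rw [← pow_mul, mul_two, ← hm, pow_orderOf_eq_one])
  have hpos : 0 < orderOf (cl I) := orderOf_pos _
  have := orderOf_le_of_pow_eq_one (by omega) h3
  omega

lemma inv_odd (σ : K ≃ₐ[ℚ] K) (hσ : ∀ x, σ (σ x) = x)
    (hN : ∀ I : Ideal (𝓞 K), I ≠ ⊥ → OddI (I * σ • I))
    (hP : ∀ P : Ideal (𝓞 K), P.IsPrime → P ≠ ⊥ → σ • P = P → OddI P) :
    ∀ n : ℕ, ∀ J : Ideal (𝓞 K), J ≠ ⊥ → Ideal.absNorm J ≤ n → σ • J = J → OddI J := by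
  have hσσ : σ * σ = 1 := by ext x; simp [hσ]
  have hσI : ∀ I : Ideal (𝓞 K), σ • σ • I = I := fun I => by rw [smul_smul, hσσ, one_smul]
  have key : ∀ Q J : Ideal (𝓞 K), J ≠ ⊥ → Q ∣ J → Q ≠ ⊤ → σ • Q = Q → σ • J = J → OddI Q → 
    (∀ J' : Ideal (𝓞 K), J' ≠ ⊥ → Ideal.absNorm J' < Ideal.absNorm J → σ • J' = J' → OddI J') → OddI J := by
    rintro Q _ hJ ⟨J', rfl⟩ hQt hQ hσJ hoQ ih
    have hQ0 : Q ≠ ⊥ := by rintro rfl; simp at hJ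
    have hJ0 : J' ≠ ⊥ := by rintro rfl; simp at hJ
    refine hoQ.mul (ih J' hJ0 ?_ ?_)
    · rw [map_mul]
      have h1 : Ideal.absNorm Q ≠ 1 := by rwa [Ne, Ideal.absNorm_eq_one_iff]
      have h2 : Ideal.absNorm Q ≠ 0 := by rwa [Ne, Ideal.absNorm_eq_zero_iff]
      have h3 : Ideal.absNorm J' ≠ 0 := by rwa [Ne, Ideal.absNorm_eq_zero_iff]
      have : 2 ≤ Ideal.absNorm Q := by omega
      nlinarith [Nat.pos_of_ne_zero h3]
    · rw [smul_mul', hQ] at hσJ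
      exact mul_left_cancel₀ hQ0 hσJ
  intro n
  induction n with
  | zero =>
    intro J hJ h0
    exact absurd (Ideal.absNorm_eq_zero_iff.mp (Nat.le_zero.mp h0)) hJ
  | succ n ih =>
    intro J hJ hn hσJ
    by_cases hJt : J = ⊤
    · subst hJt
      exact ⟨1, by decide, by rw [cl_top, one_pow]⟩
    obtain ⟨P, hPm, hle⟩ := Ideal.exists_le_maximal J hJt
    have hP0 : P ≠ ⊥ := by rintro rfl; exact hJ (le_bot_iff.mp hle)
    have hPd : P ∣ J := Ideal.dvd_iff_le.mpr hle
    have ih' : ∀ J' : Ideal (𝓞 K), J' ≠ ⊥ → Ideal.absNorm J' < Ideal.absNorm J → σ • J' = J' → OddI J' :=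
      fun J' h1 h2 h3 => ih J' h1 (by omega) h3
    by_cases hPσ : σ • P = P
    · exact key P J hJ hPd hPm.ne_top hPσ hσJ (hP P hPm.isPrime hP0 hPσ) ih'
    · have hPp : Prime P := (Ideal.prime_iff_isPrime hP0).mpr hPm.isPrime
      have hPp' : Prime (σ • P) := (Ideal.prime_iff_isPrime (smul_ne_bot σ hP0)).mpr inferInstance
      have hd : P * σ • P ∣ J := by
        obtain ⟨J', rfl⟩ := hPd
        apply mul_dvd_mul_left
        have : σ • P ∣ P * J' := by
          rw [← hσJ, smul_mul']; exact dvd_mul_right _ _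
        rcases hPp'.dvd_or_dvd this with h | h
        · exfalso
          apply hPσ
          have hle2 := Ideal.dvd_iff_le.mp h
          exact (hPm.eq_of_le (Ideal.IsPrime.ne_top inferInstance) hle2).symm
        · exact h
      refine key _ J hJ hd ?_ ?_ hσJ (hN P hP0) ih'
      · intro h
        apply hPm.ne_top
        rw [eq_top_iff, ← h]
        exact (Ideal.mul_le_left : P * σ • P ≤ P)
      · rw [smul_mul', hσI, mul_comm]

lemma exists_int_mul (x : K) : ∃ m : ℕ, m ≠ 0 ∧ ∃ y : 𝓞 K, (y : K) = m * x := by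
  obtain ⟨y, hy0, hy⟩ := ((IsFractionRing.isAlgebraic_iff ℤ ℚ K).mpr
    (Algebra.IsAlgebraic.isAlgebraic x)).exists_integral_multiple
  have h2 : IsIntegral ℤ ((y.natAbs : K) * x) := by
    rcases Int.natAbs_eq y with h | h
    · rw [h] at hy; simpa using hy
    · rw [h] at hy; simpa using hy
  refine ⟨y.natAbs, by simpa using hy0, ⟨⟨_, h2⟩, rfl⟩⟩

/-- Ambiguous class argument. -/
lemma lemma1 (σ : K ≃ₐ[ℚ] K) (hσ : ∀ x, σ (σ x) = x) (r : K) (hr : r ≠ 0) (hrσ : σ r = -r)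
    (hN : ∀ I : Ideal (𝓞 K), I ≠ ⊥ → OddI (I * σ • I))
    (hU : ∀ (a : K) (v : (𝓞 K)ˣ), a * σ a = ((v : 𝓞 K) : K) →
      ∃ e : (𝓞 K)ˣ, ((e : 𝓞 K) : K) * σ ((e : 𝓞 K) : K) = ((v : 𝓞 K) : K))
    (hP : ∀ P : Ideal (𝓞 K), P.IsPrime → P ≠ ⊥ → σ • P = P → OddI P) : OddClass K := by
  apply odd_of_two_torsion
  intro I hI h2
  have hσσ : σ * σ = 1 := by ext x; simp [hσ]
  have hσI : ∀ I : Ideal (𝓞 K), σ • σ • I = I := fun I => by rw [smul_smul, hσσ, one_smul]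
  have hs2 : cl (σ • I) ^ 2 = 1 := by
    rw [← cl_pow (smul_ne_bot σ hI), ← smul_pow']
    apply cl_smul_eq
    rw [cl_pow hI, h2]
  obtain ⟨n, ⟨m, rfl⟩, hn⟩ := hN I hI
  rw [cl_mul hI (smul_ne_bot σ hI), pow_succ, pow_mul, mul_pow, h2, hs2] at hn
  have hcl : cl (σ • I) = cl I := by
    have h3 : cl I * cl (σ • I) = 1 := by simpa using hn
    rw [sq] at h2
    exact mul_left_cancel (h3.trans h2.symm)
  obtain ⟨x, y, hx, hy, hxy⟩ := (cl_eq_iff (smul_ne_bot σ hI) hI).mp hcl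
  have hxy2 : Ideal.span {σ • x} * I = Ideal.span {σ • y} * σ • I := by
    have := congrArg (σ • ·) hxy
    simpa only [smul_mul', smul_span, hσI] using this
  have hass : Associated (x * σ • x) (y * σ • y) := by
    rw [← Ideal.span_singleton_eq_span_singleton]
    apply mul_right_cancel₀ hI
    rw [← Ideal.span_singleton_mul_span_singleton, ← Ideal.span_singleton_mul_span_singleton,
      mul_assoc, hxy2, mul_left_comm, hxy, ← mul_assoc, mul_comm (Ideal.span {σ • y})]
  obtain ⟨v, hv⟩ := hass
  have hx' : (x : K) ≠ 0 := by simpa using hx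
  have hσx' : σ (x : K) ≠ 0 := by simpa using hx
  have hy' : (y : K) ≠ 0 := by simpa using hy
  have hvK : (x : K) * σ x * ((v : 𝓞 K) : K) = y * σ y := by
    have := congrArg (fun z : 𝓞 K => (z : K)) hv
    simpa [coe_smul] using this
  obtain ⟨e, he⟩ := hU ((y : K) / x) v (by rw [map_div₀]; field_simp; linear_combination -hvK)
  have he0 : ((e : 𝓞 K) : K) ≠ 0 := by simp
  obtain ⟨b, hb⟩ : ∃ b : K, b = (y : K) / x / ((e : 𝓞 K) : K) := ⟨_, rfl⟩
  have hbb : b * σ b = 1 := by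
    have hse0 : σ ((e : 𝓞 K) : K) ≠ 0 := by simp
    rw [hb, map_div₀, map_div₀]
    field_simp
    linear_combination -hvK - (x : K) * σ x * he
  have hz : ∃ z : K, z ≠ 0 ∧ σ z * b = z := by
    by_cases h1 : 1 + b = 0
    · refine ⟨r, hr, ?_⟩
      have : b = -1 := by linear_combination h1
      rw [this, hrσ]; ring
    · refine ⟨1 + b, h1, ?_⟩
      rw [map_add, map_one]; linear_combination hbb
  obtain ⟨z0, hz00, hz0⟩ := hz
  obtain ⟨m', hm', z, hz⟩ := exists_int_mul z0
  have hzne : (z : K) ≠ 0 := by rw [hz]; exact mul_ne_zero (by exact_mod_cast hm') hz00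
  have hzσ : σ z * b = z := by rw [hz, map_mul, map_natCast, mul_assoc, hz0]
  have hzi : z ≠ 0 := by rintro rfl; simp at hzne
  have hel : σ • z * y = z * e * x := by
    apply RingOfIntegers.ext
    change σ (z : K) * y = z * e * x
    have h4 : (y : K) = b * ((e : 𝓞 K) : K) * x := by rw [hb]; field_simp
    rw [h4]
    linear_combination ((e : 𝓞 K) : K) * x * hzσ
  have hJ : Ideal.span {z} * I ≠ ⊥ := mul_ne_zero (by simpa using hzi) hI
  have hinv : σ • (Ideal.span {z} * I) = Ideal.span {z} * I := by
    have hx0 : (Ideal.span {x} : Ideal (𝓞 K)) ≠ 0 := by simpa using hx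
    apply mul_left_cancel₀ hx0
    rw [smul_mul', smul_span, mul_left_comm, hxy, ← mul_assoc, ← mul_assoc,
      Ideal.span_singleton_mul_span_singleton, hel, Ideal.span_singleton_mul_span_singleton]
    congr 1
    rw [Ideal.span_singleton_eq_span_singleton]
    exact ⟨e⁻¹, by rw [mul_right_comm z, mul_assoc _ (e : 𝓞 K), Units.mul_inv, mul_one, mul_comm]⟩
  obtain ⟨n, hn, h⟩ := inv_odd σ hσ hN hP _ _ hJ le_rfl hinv
  refine ⟨n, hn, ?_⟩
  rwa [cl_mul (by simpa using hzi) hI, cl_span, one_mul] at h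

lemma zpowers_two (σ : K ≃ₐ[ℚ] K) (hσ : ∀ x, σ (σ x) = x) (h1 : σ ≠ 1) :
    orderOf σ = 2 := by
  apply orderOf_eq_prime _ h1
  ext x; simp [sq, hσ]

/-- fixed field of an involution -/
abbrev FF (σ : K ≃ₐ[ℚ] K) : IntermediateField ℚ K :=
  IntermediateField.fixedField (Subgroup.zpowers σ)

lemma mem_FF {σ : K ≃ₐ[ℚ] K} {x : K} : x ∈ FF σ ↔ σ x = x := by
  rw [IntermediateField.mem_fixedField_iff]
  refine ⟨fun h => h σ (Subgroup.mem_zpowers σ), fun h f hf => ?_⟩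
  have : Subgroup.zpowers σ ≤ MulAction.stabilizer (K ≃ₐ[ℚ] K) x := by
    rw [Subgroup.zpowers_le]; exact h
  exact this hf

lemma map_relNorm_inv (σ : K ≃ₐ[ℚ] K) (hσ : ∀ x, σ (σ x) = x) (h1 : σ ≠ 1) (I : Ideal (𝓞 K)) :
    (Ideal.relNorm (𝓞 (FF σ)) I).map (algebraMap (𝓞 (FF σ)) (𝓞 K)) = I * σ • I := by
  classical
  have : Fintype (Subgroup.zpowers σ) := Fintype.ofFinite _
  rw [map_relNorm_eq]
  have hne : (1 : Subgroup.zpowers σ) ≠ ⟨σ, Subgroup.mem_zpowers σ⟩ := by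
    intro h
    exact h1 (congrArg Subtype.val h).symm
  have hu : ({1, ⟨σ, Subgroup.mem_zpowers σ⟩} : Finset (Subgroup.zpowers σ)) = Finset.univ := by
    apply Finset.eq_univ_of_card
    rw [Finset.card_pair hne, ← Nat.card_eq_fintype_card, Nat.card_zpowers, zpowers_two σ hσ h1]
  rw [← hu, Finset.prod_pair hne]
  simp

lemma hN_of_odd (σ : K ≃ₐ[ℚ] K) (hσ : ∀ x, σ (σ x) = x) (h1 : σ ≠ 1) (hk : OddClass (FF σ))
    (I : Ideal (𝓞 K)) : OddI (I * σ • I) := by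
  rw [← map_relNorm_inv σ hσ h1]
  exact oddI_map hk _

lemma mem_comap_FF {σ : K ≃ₐ[ℚ] K} {P : Ideal (𝓞 K)} {x : 𝓞 K} (hx : x ∈ P) (h : σ • x = x) :
    x ∈ (P.comap (algebraMap (𝓞 (FF σ)) (𝓞 K))).map (algebraMap (𝓞 (FF σ)) (𝓞 K)) := by
  have hx' : (x : K) ∈ FF σ := mem_FF.mpr (by rw [← coe_smul, h])
  have hintg : IsIntegral ℤ (⟨x, hx'⟩ : FF σ) := by
    have := x.isIntegral_coe
    exact (isIntegral_algHom_iff (((FF σ).val).restrictScalars ℤ) (FF σ).val.injective).mp this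
  obtain ⟨y, h2⟩ : ∃ y, algebraMap (𝓞 (FF σ)) (𝓞 K) y = x :=
    ⟨⟨⟨x, hx'⟩, hintg⟩, RingOfIntegers.ext rfl⟩
  rw [← h2]
  apply Ideal.mem_map_of_mem
  rw [Ideal.mem_comap, h2]
  exact hx

lemma ext_odd (σ : K ≃ₐ[ℚ] K) (hσ : ∀ x, σ (σ x) = x) (h1 : σ ≠ 1) (hk : OddClass (FF σ))
    (P : Ideal (𝓞 K)) (hP : P.IsPrime) (hP0 : P ≠ ⊥) (hPσ : σ • P = P) (θ : 𝓞 K)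
    (hθ : θ - σ • θ ∉ P) : OddI P := by
  set J := (P.comap (algebraMap (𝓞 (FF σ)) (𝓞 K))).map (algebraMap (𝓞 (FF σ)) (𝓞 K)) with hJ
  have hσσ : ∀ x : 𝓞 K, σ • σ • x = x := fun x => RingOfIntegers.ext (hσ x)
  have hPm : ∀ x ∈ P, σ • x ∈ P := fun x hx => by
    have := Ideal.smul_mem_pointwise_smul σ x P hx
    rwa [hPσ] at this
  have hJP : J ≤ P := Ideal.map_comap_le
  have h3 : Ideal.span {θ - σ • θ} * P ≤ J := by
    rw [Ideal.span_singleton_mul_le_iff]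
    intro x hx
    have e1 : (θ - σ • θ) * x = (x * θ + σ • (x * θ)) - σ • θ * (x + σ • x) := by
      rw [smul_mul']; ring
    rw [e1]
    apply Ideal.sub_mem
    · apply mem_comap_FF
      · exact P.add_mem (P.mul_mem_right _ hx) (hPm _ (P.mul_mem_right _ hx))
      · rw [smul_add, hσσ, add_comm]
    · apply Ideal.mul_mem_left
      apply mem_comap_FF
      · exact P.add_mem hx (hPm _ hx)
      · rw [smul_add, hσσ, add_comm]
  have h4 : P * P ≤ J := by
    have := map_relNorm_inv σ hσ h1 P
    rw [hPσ] at this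
    rw [← this]
    exact Ideal.map_mono (Ideal.relNorm_le_comap _ _)
  have h5 : (Ideal.span {θ - σ • θ} ⊔ P) * P ≤ J := by
    rw [Ideal.sup_mul]; exact sup_le h3 h4
  have hmax : P.IsMaximal := hP.isMaximal hP0
  have h6 : Ideal.span {θ - σ • θ} ⊔ P = ⊤ := by
    exact hmax.1.2 _ (lt_of_le_of_ne le_sup_right fun h => hθ (by
      rw [h]; exact Ideal.mem_sup_left (Ideal.mem_span_singleton_self _)))
  rw [h6, Ideal.top_mul] at h5
  rw [le_antisymm h5 hJP]
  exact oddI_map hk _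
end B
end Quin

namespace Quin

/-- a multiquadratic field with chosen square roots and chosen automorphisms. -/
structure MQ (n : ℕ) (F : Type*) [Field F] [NumberField F] (d : Fin n → ℤ) where
  x : Fin n → F
  hd : ∀ i, d i ≠ 0
  hx : ∀ i, x i ^ 2 = d i
  g : Fin n → (F ≃ₐ[ℚ] F)
  hg : ∀ i, g i (x i) = - x i
  hg' : ∀ i j, i ≠ j → g i (x j) = x j
  hF : Module.finrank ℚ F = 2 ^ n

namespace MQ
variable {n : ℕ} {F : Type*} [Field F] [NumberField F] {d : Fin n → ℤ} (m : MQ n F d)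
include m

lemma x_ne (i : Fin n) : m.x i ≠ 0 := by
  intro h
  have := m.hx i
  rw [h] at this
  have h2 := m.hd i
  apply h2
  have : ((d i : ℤ) : F) = 0 := by rw [← this]; ring
  exact_mod_cast this

lemma pm (h : F ≃ₐ[ℚ] F) (i : Fin n) : ∃ e : ℤˣ, h (m.x i) = ((e : ℤ) : F) * m.x i := by
  have h1 : (h (m.x i)) ^ 2 = (m.x i) ^ 2 := by
    rw [← map_pow, m.hx, map_intCast]
  rcases sq_eq_sq_iff_eq_or_eq_neg.mp h1 with h | h
  · exact ⟨1, by simp [h]⟩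
  · exact ⟨-1, by simp [h]⟩

/-- sign of an automorphism -/
noncomputable def sg (h : F ≃ₐ[ℚ] F) (i : Fin n) : ℤˣ := (m.pm h i).choose

lemma sg_spec (h : F ≃ₐ[ℚ] F) (i : Fin n) : h (m.x i) = ((m.sg h i : ℤ) : F) * m.x i :=
  (m.pm h i).choose_spec

lemma sg_unique (h : F ≃ₐ[ℚ] F) (i : Fin n) (e : ℤˣ) (he : h (m.x i) = ((e : ℤ) : F) * m.x i) :
    m.sg h i = e := by
  rw [m.sg_spec] at he
  have := mul_right_cancel₀ (m.x_ne i) he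
  ext
  exact_mod_cast this

/-- sign homomorphism -/
noncomputable def sgHom : (F ≃ₐ[ℚ] F) →* (Fin n → ℤˣ) where
  toFun := m.sg
  map_one' := by
    ext1 i
    apply m.sg_unique
    simp
  map_mul' h k := by
    ext1 i
    apply m.sg_unique
    rw [AlgEquiv.mul_apply, m.sg_spec k, map_mul, map_intCast, m.sg_spec h]
    simp only [Pi.mul_apply, Units.val_mul, Int.cast_mul]
    ring

lemma sg_g (i : Fin n) : m.sg (m.g i) = Pi.mulSingle i (-1) := by
  ext1 j
  apply m.sg_unique
  by_cases h : j = i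
  · subst h
    simp [m.hg]
  · rw [m.hg' i j (Ne.symm h)]
    simp [h]

omit m in
lemma top_of_single (S : Subgroup (Fin n → ℤˣ)) (h : ∀ i, Pi.mulSingle i (-1) ∈ S) : S = ⊤ := by
  rw [eq_top_iff]
  intro f _
  have : f = ∏ i, Pi.mulSingle i (f i) := (Finset.univ_prod_mulSingle f).symm
  rw [this]
  apply Subgroup.prod_mem
  intro i _
  rcases Int.units_eq_one_or (f i) with h' | h'
  · rw [h']; simp
  · rw [h']; exact h i

lemma sgHom_surj : Function.Surjective m.sgHom := by
  rw [← MonoidHom.range_eq_top]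
  exact top_of_single _ fun i => ⟨m.g i, m.sg_g i⟩

lemma card_aut : Nat.card (F ≃ₐ[ℚ] F) = 2 ^ n := by
  apply le_antisymm
  · rw [← m.hF]
    rw [Nat.card_eq_fintype_card]
    exact AlgEquiv.card_le
  · have := Nat.card_le_card_of_surjective _ m.sgHom_surj
    simpa [Nat.card_eq_fintype_card] using this

lemma gal : IsGalois ℚ F := IsGalois.of_card_aut_eq_finrank _ _ (by rw [m.card_aut, m.hF])

lemma sgHom_bij : Function.Bijective m.sgHom := by
  have h := m.sgHom_surj
  refine (Nat.bijective_iff_surjective_and_card _).mpr ⟨h, ?_⟩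
  rw [m.card_aut]
  simp [Nat.card_eq_fintype_card]

/-- Galois group -/
noncomputable def sgEquiv : (F ≃ₐ[ℚ] F) ≃* (Fin n → ℤˣ) := MulEquiv.ofBijective m.sgHom m.sgHom_bij

lemma aut_ext {h k : F ≃ₐ[ℚ] F} (hk : ∀ i, h (m.x i) = k (m.x i)) : h = k := by
  apply m.sgHom_bij.1
  ext1 i
  apply m.sg_unique
  rw [hk, m.sg_spec]; rfl

lemma aut_comm (h k : F ≃ₐ[ℚ] F) : h * k = k * h := by
  apply m.sgEquiv.injective
  rw [map_mul, map_mul, mul_comm]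

lemma aut_sq (h : F ≃ₐ[ℚ] F) : h * h = 1 := by
  apply m.sgEquiv.injective
  rw [map_mul, map_one]
  ext i
  simp

lemma aut_aut (h : F ≃ₐ[ℚ] F) (y : F) : h (h y) = y := by
  have := DFunLike.congr_fun (m.aut_sq h) y
  simpa using this

lemma aut_aut_comm (h k : F ≃ₐ[ℚ] F) (y : F) : h (k y) = k (h y) := by
  have := DFunLike.congr_fun (m.aut_comm h k) y
  simpa using this

lemma g_ne_one (i : Fin n) : m.g i ≠ 1 := by
  intro h
  have h1 := m.hg i
  rw [h, AlgEquiv.one_apply] at h1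
  exact m.x_ne i (self_eq_neg.mp h1)

lemma rat_of_fixed (y : F) (hy : ∀ i, m.g i y = y) : ∃ q : ℚ, y = q := by
  have := m.gal
  have h1 : ∀ h : F ≃ₐ[ℚ] F, h y = y := by
    intro h
    have h2 : (MulAction.stabilizer (F ≃ₐ[ℚ] F) y).map m.sgHom = ⊤ :=
      top_of_single _ fun i => ⟨m.g i, hy i, m.sg_g i⟩
    have h3 : m.sgHom h ∈ (MulAction.stabilizer (F ≃ₐ[ℚ] F) y).map m.sgHom := by
      rw [h2]; trivial
    obtain ⟨k, hk, hkh⟩ := h3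
    rw [← m.sgHom_bij.1 hkh]
    exact hk
  obtain ⟨q, hq⟩ := (IsGalois.mem_range_algebraMap_iff_fixed y).mpr h1
  exact ⟨q, by rw [← hq]; simp⟩

lemma normalFF (σ : F ≃ₐ[ℚ] F) : Normal ℚ (FF σ) := by
  have := m.gal
  have : (Subgroup.zpowers σ).Normal := ⟨fun a ha b => by
    rw [m.aut_comm b a, mul_inv_cancel_right]; exact ha⟩
  exact (IsGalois.of_fixedField_normal_subgroup (Subgroup.zpowers σ)).to_normal

lemma finrank_FF (σ : F ≃ₐ[ℚ] F) (hσ : σ ≠ 1) : Module.finrank ℚ (FF σ) * 2 = 2 ^ n := by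
  rw [← m.hF, ← Module.finrank_mul_finrank ℚ (FF σ) F, IntermediateField.finrank_fixedField_eq_card,
    Nat.card_zpowers, zpowers_two σ (m.aut_aut σ) hσ]

end MQ

/-- the fixed field of one of the generators is multiquadratic -/
noncomputable def MQ.res {n : ℕ} {F : Type*} [Field F] [NumberField F] {d : Fin (n + 1) → ℤ}
    (m : MQ (n + 1) F d) (i : Fin (n + 1)) : MQ n (FF (m.g i)) (fun j => d (i.succAbove j)) :=
  have := m.normalFF (m.g i)
  { x := fun j => ⟨m.x (i.succAbove j), mem_FF.mpr (m.hg' _ _ (Fin.succAbove_ne i j).symm)⟩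
    hd := fun j => m.hd _
    hx := fun j => Subtype.ext (by simpa using m.hx (i.succAbove j))
    g := fun j => (m.g (i.succAbove j)).restrictNormal (FF (m.g i))
    hg := fun j => by
      apply (algebraMap (FF (m.g i)) F).injective
      rw [AlgEquiv.restrictNormal_commutes]
      exact m.hg _
    hg' := fun j k hjk => by
      apply (algebraMap (FF (m.g i)) F).injective
      rw [AlgEquiv.restrictNormal_commutes]
      exact m.hg' _ _ (fun h => hjk (Fin.succAbove_right_injective h))
    hF := by
      have := m.finrank_FF (m.g i) (m.g_ne_one i)
      rw [pow_succ] at this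
      exact Nat.eq_of_mul_eq_mul_right (by norm_num) this }

lemma MQ.res_g {n : ℕ} {F : Type*} [Field F] [NumberField F] {d : Fin (n + 1) → ℤ}
    (m : MQ (n + 1) F d) (i : Fin (n + 1)) (j : Fin n) (y : FF (m.g i)) :
    (((m.res i).g j y : FF (m.g i)) : F) = m.g (i.succAbove j) (y : F) := by
  have := m.normalFF (m.g i)
  exact AlgEquiv.restrictNormal_commutes (m.g (i.succAbove j)) (FF (m.g i)) y

lemma MQ.res_x {n : ℕ} {F : Type*} [Field F] [NumberField F] {d : Fin (n + 1) → ℤ}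
    (m : MQ (n + 1) F d) (i : Fin (n + 1)) (j : Fin n) :
    (((m.res i).x j : FF (m.g i)) : F) = m.x (i.succAbove j) := rfl
end Quin

namespace Quin
section
variable {F : Type*} [Field F] [NumberField F]

/-- parity invariants of units -/
lemma unit_parity (F : Type*) [Field F] [NumberField F] : ∃ f : (𝓞 F)ˣ → (Bool × (Fin (Units.rank F) → Bool)), ∀ u v, f u = f v → ∃ e, u = v * e ^ 2 := by
  classical
  obtain ⟨z, hz⟩ := IsCyclic.exists_generator (α := Units.torsion F)
  have h : ∀ u : (𝓞 F)ˣ, ∃ p : ℤ × (Fin (Units.rank F) → ℤ),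
      u = (z : (𝓞 F)ˣ) ^ p.1 * ∏ i, Units.fundSystem F i ^ (p.2 i) := by
    intro u
    obtain ⟨⟨ζ, e⟩, he, -⟩ := Units.exist_unique_eq_mul_prod F u
    obtain ⟨k, hk⟩ := Subgroup.mem_zpowers_iff.mp (hz ζ)
    refine ⟨(k, e), ?_⟩
    rw [he, ← hk]; simp
  choose p hp using h
  refine ⟨fun u => (decide (Even (p u).1), fun i => decide (Even ((p u).2 i))), ?_⟩
  intro u v huv
  simp only [Prod.mk.injEq, decide_eq_decide, funext_iff] at huv
  obtain ⟨h1, h2⟩ := huv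
  have key : ∀ a b : ℤ, (Even a ↔ Even b) → ∃ c, a = b + 2 * c := by
    intro a b hab
    rcases Int.even_or_odd' (a - b) with ⟨c, hc | hc⟩
    · exact ⟨c, by omega⟩
    · exfalso
      have : ¬ Even (a - b) := by rw [Int.not_even_iff_odd]; exact ⟨c, hc⟩
      rw [Int.even_sub] at this
      exact this hab
  obtain ⟨c, hc⟩ := key _ _ h1
  choose c' hc' using fun i => key _ _ (h2 i)
  refine ⟨(z : (𝓞 F)ˣ) ^ c * ∏ i, Units.fundSystem F i ^ (c' i), ?_⟩
  conv_lhs => rw [hp u]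
  conv_rhs => rw [hp v]
  rw [hc]
  simp_rw [hc']
  rw [mul_pow, ← Finset.prod_pow, mul_mul_mul_comm, ← Finset.prod_mul_distrib]
  congr 1
  · rw [zpow_add, zpow_mul']; norm_cast
  · refine Finset.prod_congr rfl fun i _ => ?_
    rw [zpow_add, zpow_mul']; norm_cast

lemma lemG {r : ℕ} (hr : Units.rank F ≤ r) (u : Fin (2 ^ (r + 1) + 1) → (𝓞 F)ˣ) :
    ∃ i j, i ≠ j ∧ ∃ e, u i = u j * e ^ 2 := by
  obtain ⟨f, hf⟩ := unit_parity F
  obtain ⟨i, j, hij, h⟩ := Fintype.exists_ne_map_eq_of_card_lt (f ∘ u) (by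
    simp only [Fintype.card_prod, Fintype.card_bool, Fintype.card_pi, Finset.prod_const, Finset.card_univ,
      Fintype.card_fin]
    have : 2 ^ Units.rank F ≤ 2 ^ r := Nat.pow_le_pow_right (by norm_num) hr
    rw [pow_succ]; omega)
  exact ⟨i, j, hij, hf _ _ h⟩

/-- unit of the fixed field -/
lemma unit_FF {σ : F ≃ₐ[ℚ] F} (v : (𝓞 F)ˣ) (hv : σ ((v : 𝓞 F) : F) = ((v : 𝓞 F) : F)) :
    ∃ v' : (𝓞 (FF σ))ˣ, (((v' : 𝓞 (FF σ)) : FF σ) : F) = ((v : 𝓞 F) : F) := by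
  have hm : ∀ x : 𝓞 F, σ (x : F) = x → ∃ y : 𝓞 (FF σ), ((y : FF σ) : F) = x := by
    intro x hx
    have hx' : (x : F) ∈ FF σ := mem_FF.mpr hx
    have hintg : IsIntegral ℤ (⟨x, hx'⟩ : FF σ) := by
      have := x.isIntegral_coe
      exact (isIntegral_algHom_iff (((FF σ).val).restrictScalars ℤ) (FF σ).val.injective).mp this
    exact ⟨⟨⟨x, hx'⟩, hintg⟩, rfl⟩
  have hinv : ((v : 𝓞 F) : F) * (((v⁻¹ : (𝓞 F)ˣ) : 𝓞 F) : F) = 1 := by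
    rw [← map_mul, Units.mul_inv, map_one]
  obtain ⟨y, hy⟩ := hm v hv
  obtain ⟨z, hz⟩ := hm (v⁻¹ : (𝓞 F)ˣ) (by
    have h1 := congrArg σ hinv
    rw [map_mul, map_one, hv] at h1
    exact mul_left_cancel₀ (by simp) (h1.trans hinv.symm))
  have hyz : y * z = 1 := by
    apply RingOfIntegers.ext
    apply Subtype.ext
    change ((y : FF σ) : F) * ((z : FF σ) : F) = 1
    rw [hy, hz, hinv]
  exact ⟨Units.mkOfMulEqOne y z hyz, hy⟩

lemma unit_FF_coe {σ : F ≃ₐ[ℚ] F} (v' : (𝓞 (FF σ))ˣ) :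
   ∃ v : (𝓞 F)ˣ, ((v : 𝓞 F) : F) = (((v' : 𝓞 (FF σ)) : FF σ) : F) ∧ σ ((v : 𝓞 F) : F) = ((v : 𝓞 F) : F) := by
  refine ⟨Units.map (algebraMap (𝓞 (FF σ)) (𝓞 F) : _ →* _) v', rfl, ?_⟩
  exact mem_FF.mp (((v' : 𝓞 (FF σ)) : FF σ)).2

/-- pigeonhole for units of F fixed by σ -/
lemma lemG' {σ : F ≃ₐ[ℚ] F} {r : ℕ} (hr : Units.rank (FF σ) ≤ r) (u : Fin (2 ^ (r + 1) + 1) → (𝓞 F)ˣ)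
    (hu : ∀ i, σ ((u i : 𝓞 F) : F) = ((u i : 𝓞 F) : F)) :
    ∃ i j, i ≠ j ∧ ∃ e : (𝓞 F)ˣ, σ ((e : 𝓞 F) : F) = ((e : 𝓞 F) : F) ∧ ((u i : 𝓞 F) : F) = ((u j : 𝓞 F) : F) * ((e : 𝓞 F) : F) ^ 2 := by
  choose u' hu' using fun i => unit_FF (u i) (hu i)
  obtain ⟨i, j, hij, e', he'⟩ := lemG hr u'
  obtain ⟨e, he, hes⟩ := unit_FF_coe e'
  refine ⟨i, j, hij, e, hes, ?_⟩
  rw [← hu' i, ← hu' j, he, he']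
  simp

/-- x is a norm -/
def IsN (σ : F ≃ₐ[ℚ] F) (x : F) : Prop := ∃ a, a * σ a = x
/-- x is a norm of a unit -/
def IsNU (σ : F ≃ₐ[ℚ] F) (x : F) : Prop := ∃ a : (𝓞 F)ˣ, ((a : 𝓞 F) : F) * σ ((a : 𝓞 F) : F) = x

lemma IsN.mul {σ : F ≃ₐ[ℚ] F} {x y : F} : IsN σ x → IsN σ y → IsN σ (x * y) := by
  rintro ⟨a, ha⟩ ⟨b, hb⟩
  exact ⟨a * b, by rw [map_mul, ← ha, ← hb]; ring⟩
lemma IsNU.mul {σ : F ≃ₐ[ℚ] F} {x y : F} : IsNU σ x → IsNU σ y → IsNU σ (x * y) := by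
  rintro ⟨a, ha⟩ ⟨b, hb⟩
  refine ⟨a * b, ?_⟩
  rw [← ha, ← hb]; push_cast; rw [map_mul]; ring
lemma IsNU.isN {σ : F ≃ₐ[ℚ] F} {x : F} : IsNU σ x → IsN σ x := fun ⟨a, ha⟩ => ⟨_, ha⟩
lemma IsN.inv {σ : F ≃ₐ[ℚ] F} {x : F} : IsN σ x → IsN σ x⁻¹ := by
  rintro ⟨a, rfl⟩
  exact ⟨a⁻¹, by rw [map_inv₀, mul_inv]⟩
lemma IsNU.inv {σ : F ≃ₐ[ℚ] F} {x : F} : IsNU σ x → IsNU σ x⁻¹ := by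
  rintro ⟨a, rfl⟩
  refine ⟨a⁻¹, ?_⟩
  have : ((((a⁻¹ : (𝓞 F)ˣ)) : 𝓞 F) : F) = ((a : 𝓞 F) : F)⁻¹ := by
    apply eq_inv_of_mul_eq_one_left
    rw [← map_mul, Units.inv_mul, map_one]
  rw [this, map_inv₀, mul_inv]
lemma isNU_sq {σ : F ≃ₐ[ℚ] F} {e : (𝓞 F)ˣ} (he : σ ((e : 𝓞 F) : F) = ((e : 𝓞 F) : F)) : IsNU σ (((e : 𝓞 F) : F) ^ 2) :=
  ⟨e, by rw [he, sq]⟩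

lemma U0 (σ : F ≃ₐ[ℚ] F) (hσ : ∀ x, σ (σ x) = x) (hr : Units.rank (FF σ) ≤ 0) (u : (𝓞 F)ˣ)
    (hg : ∀ z, σ z = z → z ^ 2 ≠ ((u : 𝓞 F) : F) * σ ((u : 𝓞 F) : F)) (v : (𝓞 F)ˣ) (hv : IsN σ ((v : 𝓞 F) : F)) :
    IsNU σ ((v : 𝓞 F) : F) := by
  have hvf : σ ((v : 𝓞 F) : F) = ((v : 𝓞 F) : F) := by
    obtain ⟨a, ha⟩ := hv
    rw [← ha, map_mul, hσ, mul_comm]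
  obtain ⟨g, hgg⟩ : ∃ g : (𝓞 F)ˣ, ((g : 𝓞 F) : F) = ((u : 𝓞 F) : F) * σ ((u : 𝓞 F) : F) :=
    ⟨u * Units.map (MulSemiringAction.toRingHom (F ≃ₐ[ℚ] F) (𝓞 F) σ : _ →* _) u, by push_cast; rfl⟩
  have hgf : σ ((g : 𝓞 F) : F) = ((g : 𝓞 F) : F) := by rw [hgg, map_mul, hσ, mul_comm]
  have hgn : IsNU σ ((g : 𝓞 F) : F) := ⟨u, hgg.symm⟩
  rw [← hgg] at hg
  obtain ⟨i, j, hij, e, he, h⟩ := lemG' hr ![1, g, v] (by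
    intro i; fin_cases i
    · simp
    · exact hgf
    · exact hvf)
  have he0 : ((e : 𝓞 F) : F) ≠ 0 := by simp
  have heN := isNU_sq he
  have hes : σ (((e : 𝓞 F) : F)⁻¹) = ((e : 𝓞 F) : F)⁻¹ := by rw [map_inv₀, he]
  have hv0 : ((v : 𝓞 F) : F) ≠ 0 := by simp
  have hg0 : ((g : 𝓞 F) : F) ≠ 0 := by simp
  fin_cases i <;> fin_cases j <;> simp at h hij
  · exact absurd (show (((e : 𝓞 F) : F)⁻¹) ^ 2 = ((g : 𝓞 F) : F) by field_simp; linear_combination h) (hg _ hes)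
  · rw [show ((v : 𝓞 F) : F) = (((e : 𝓞 F) : F) ^ 2)⁻¹ by field_simp; linear_combination -h]; exact heN.inv
  · exact absurd (show ((e : 𝓞 F) : F) ^ 2 = ((g : 𝓞 F) : F) by rw [h]) (hg _ he)
  · rw [show ((v : 𝓞 F) : F) = ((g : 𝓞 F) : F) * (((e : 𝓞 F) : F) ^ 2)⁻¹ by field_simp; linear_combination -h]; exact hgn.mul heN.inv
  · rw [h]; exact heN
  · rw [h]; exact hgn.mul heN

lemma U1 (σ : F ≃ₐ[ℚ] F) (hσ : ∀ x, σ (σ x) = x) (hr : Units.rank (FF σ) ≤ 1) (u : (𝓞 F)ˣ)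
    (hg : ∀ z, σ z = z → z ^ 2 ≠ ((u : 𝓞 F) : F) * σ ((u : 𝓞 F) : F)) (η : (𝓞 F)ˣ) (hηf : σ ((η : 𝓞 F) : F) = ((η : 𝓞 F) : F))
    (hη : ¬ IsN σ ((η : 𝓞 F) : F)) (v : (𝓞 F)ˣ) (hv : IsN σ ((v : 𝓞 F) : F)) :
    IsNU σ ((v : 𝓞 F) : F) := by
  have hvf : σ ((v : 𝓞 F) : F) = ((v : 𝓞 F) : F) := by
    obtain ⟨a, ha⟩ := hv
    rw [← ha, map_mul, hσ, mul_comm]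
  obtain ⟨g, hgg⟩ : ∃ g : (𝓞 F)ˣ, ((g : 𝓞 F) : F) = ((u : 𝓞 F) : F) * σ ((u : 𝓞 F) : F) :=
    ⟨u * Units.map (MulSemiringAction.toRingHom (F ≃ₐ[ℚ] F) (𝓞 F) σ : _ →* _) u, by push_cast; rfl⟩
  have hgf : σ ((g : 𝓞 F) : F) = ((g : 𝓞 F) : F) := by rw [hgg, map_mul, hσ, mul_comm]
  have hgn : IsNU σ ((g : 𝓞 F) : F) := ⟨u, hgg.symm⟩
  rw [← hgg] at hg
  have hvgf : σ (((g * v : (𝓞 F)ˣ) : 𝓞 F) : F) = (((g * v : (𝓞 F)ˣ) : 𝓞 F) : F) := by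
    push_cast; rw [map_mul, hgf, hvf]
  obtain ⟨i, j, hij, e, he, h⟩ := lemG' hr ![1, g, v, g * v, η] (by
    intro i; fin_cases i
    · simp
    · exact hgf
    · exact hvf
    · exact hvgf
    · exact hηf)
  have hw : ∀ i, ((((![1, g, v, g * v, η] : Fin 5 → (𝓞 F)ˣ) i : (𝓞 F)ˣ) : 𝓞 F) : F) =
      (![1, ((g : 𝓞 F) : F), ((v : 𝓞 F) : F), ((g : 𝓞 F) : F) * ((v : 𝓞 F) : F), ((η : 𝓞 F) : F)] : Fin 5 → F) i := by
    intro i; fin_cases i <;> simp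
  replace h := (hw i).symm.trans (h.trans (congrArg (· * ((e : 𝓞 F) : F) ^ 2) (hw j)))
  have he0 : ((e : 𝓞 F) : F) ≠ 0 := by simp
  have hv0 : ((v : 𝓞 F) : F) ≠ 0 := by simp
  have hg0 : ((g : 𝓞 F) : F) ≠ 0 := by simp
  have hη0 : ((η : 𝓞 F) : F) ≠ 0 := by simp
  have heN := isNU_sq he
  have hes : σ (((e : 𝓞 F) : F)⁻¹) = ((e : 𝓞 F) : F)⁻¹ := by rw [map_inv₀, he]
  generalize ((e : 𝓞 F) : F) = e' at *
  generalize ((v : 𝓞 F) : F) = v' at *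
  generalize ((g : 𝓞 F) : F) = g' at *
  generalize ((η : 𝓞 F) : F) = η' at *
  have n1 := heN.isN
  have n2 := n1.inv
  have n3 := heN.inv
  have g1 := hgn.isN
  have bad1 : g' ≠ e' ^ 2 := fun h => hg _ he h.symm
  have bad2 : g' * e' ^ 2 ≠ 1 := fun h => hg _ hes (by field_simp; linear_combination -h)
  have b1 : ∀ x, IsN σ x → x ≠ η' * e' ^ 2 := fun x hx h => hη (by
    rw [show η' = x * (e' ^ 2)⁻¹ by field_simp; linear_combination -h]; exact hx.mul n2)
  have b2 : ∀ x, IsN σ x → η' ≠ x * e' ^ 2 := fun x hx h => hη (by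
    rw [h]; exact hx.mul n1)
  have i1 : IsN σ (1 : F) := ⟨1, by simp⟩
  fin_cases i <;> fin_cases j <;> simp at h hij
  · exact absurd h.symm bad2
  · rw [show v' = (e' ^ 2)⁻¹ by field_simp; linear_combination -h]; exact n3
  · rw [show v' = (g' * e' ^ 2)⁻¹ by field_simp; linear_combination -h]; exact (hgn.mul heN).inv
  · exact absurd h (b1 _ i1)
  · exact absurd h bad1
  · rw [show v' = g' * (e' ^ 2)⁻¹ by field_simp; linear_combination -h]; exact hgn.mul n3
  · rw [show v' = (e' ^ 2)⁻¹ by field_simp; apply mul_left_cancel₀ hg0; linear_combination -h]; exact n3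
  · exact absurd h (b1 _ g1)
  · rw [h]; exact heN
  · rw [h]; exact hgn.mul heN
  · exact absurd (by apply mul_left_cancel₀ hv0; linear_combination -h) bad2
  · exact absurd h (b1 _ hv)
  · rw [show v' = g'⁻¹ * e' ^ 2 by field_simp; linear_combination h]; exact hgn.inv.mul heN
  · rcases h with h | h
    · rw [h]; exact heN
    · exact absurd h hg0
  · exact absurd (by apply mul_left_cancel₀ hv0; linear_combination h) bad1
  · exact absurd h (b1 _ (g1.mul hv))
  · exact absurd (by simpa using h) (b2 _ i1)
  · exact absurd h (b2 _ g1)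
  · exact absurd h (b2 _ hv)
  · exact absurd h (b2 _ (g1.mul hv))
end
end Quin

namespace Quin
section
variable {F : Type*} [Field F] [NumberField F]

lemma rank_two (h : Module.finrank ℚ F = 2) : Units.rank F ≤ 1 := by
  have h1 := InfinitePlace.card_add_two_mul_card_eq_rank F
  have h2 := InfinitePlace.card_eq_nrRealPlaces_add_nrComplexPlaces F
  rw [Units.rank, h2]
  omega

lemma rank_im {d : ℚ} (hd : d < 0) (x : F) (hx : x ^ 2 = d) {n : ℕ} (h : Module.finrank ℚ F = 2 * (n + 1)) :
    Units.rank F ≤ n := by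
  have h1 := InfinitePlace.card_add_two_mul_card_eq_rank F
  have h2 := InfinitePlace.card_eq_nrRealPlaces_add_nrComplexPlaces F
  have h3 : InfinitePlace.nrRealPlaces F = 0 := by
    rw [nrRealPlaces_eq_zero_iff, isTotallyComplex_iff]
    intro w
    rw [← InfinitePlace.not_isReal_iff_isComplex]
    intro hw
    have := congrArg (InfinitePlace.embedding_of_isReal hw) hx
    rw [map_pow, map_ratCast] at this
    have h5 : ((d : ℚ) : ℝ) < 0 := by exact_mod_cast hd
    nlinarith [sq_nonneg ((InfinitePlace.embedding_of_isReal hw) x)]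
  rw [Units.rank, h2]
  omega

/-- construction of units -/
lemma mk_unit (σ : F ≃ₐ[ℚ] F) (z g : F) (T : 𝓞 F) (hT : z + σ z = T) (hg : z * σ z = g)
    (hgi : IsIntegral ℤ g) (hgi' : IsIntegral ℤ g⁻¹) (hg0 : g ≠ 0) :
    ∃ u : (𝓞 F)ˣ, ((u : 𝓞 F) : F) = z := by
  obtain ⟨g', hg'⟩ : ∃ g' : 𝓞 F, (g' : F) = g := ⟨⟨g, hgi⟩, rfl⟩
  have hz : IsIntegral ℤ z := by
    have h1 : IsIntegral (𝓞 F) z := by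
      refine ⟨Polynomial.X ^ 2 - Polynomial.C T * Polynomial.X + Polynomial.C g', ?_, ?_⟩
      · monicity!
      · simp only [Polynomial.eval₂_add, Polynomial.eval₂_sub, Polynomial.eval₂_mul, Polynomial.eval₂_pow,
          Polynomial.eval₂_X, Polynomial.eval₂_C]
        change z ^ 2 - (T : F) * z + g' = 0
        rw [hg', ← hT, ← hg]; ring
    exact isIntegral_trans z h1
  have hσz : IsIntegral ℤ (σ z) := by
    have : σ z = T - z := by rw [← hT]; ring
    rw [this]; exact T.isIntegral_coe.sub hz
  refine ⟨Units.mkOfMulEqOne (⟨z, hz⟩ : 𝓞 F) (⟨σ z * g⁻¹, hσz.mul hgi'⟩ : 𝓞 F) ?_, rfl⟩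
  apply RingOfIntegers.ext
  change z * (σ z * g⁻¹) = 1
  rw [← mul_assoc, hg, mul_inv_cancel₀ hg0]

/-- units in the real case -/
lemma UR (σ τ : F ≃ₐ[ℚ] F) (hσ : ∀ x, σ (σ x) = x)
    (hr : Units.rank (FF σ) ≤ 1)
    (hreal : ∀ φ : F →+* ℂ, ∀ x, σ x = x → (φ x).im = 0)
    (hpos : ∀ φ : F →+* ℂ, ∀ x, 0 ≤ (φ (x * σ x)).re)
    (ε : (𝓞 F)ˣ) (hεf : σ ((ε : 𝓞 F) : F) = ((ε : 𝓞 F) : F))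
    (hε : ((ε : 𝓞 F) : F) * τ ((ε : 𝓞 F) : F) = -1) (v : (𝓞 F)ˣ) (hv : IsN σ ((v : 𝓞 F) : F)) :
    IsNU σ ((v : 𝓞 F) : F) := by
  have hvf : σ ((v : 𝓞 F) : F) = ((v : 𝓞 F) : F) := by
    obtain ⟨a, ha⟩ := hv
    rw [← ha, map_mul, hσ, mul_comm]
  obtain ⟨(i : Fin 5), (j : Fin 5), hij, e, he, h⟩ := lemG' hr (![1, -1, ε, -ε, v] : Fin 5 → (𝓞 F)ˣ) (by
    intro i; fin_cases i
    · simp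
    · simp
    · exact hεf
    · simpa using hεf
    · exact hvf)
  have hw : ∀ i, ((((![1, -1, ε, -ε, v] : Fin 5 → (𝓞 F)ˣ) i : (𝓞 F)ˣ) : 𝓞 F) : F) =
      (![1, -1, ((ε : 𝓞 F) : F), -((ε : 𝓞 F) : F), ((v : 𝓞 F) : F)] : Fin 5 → F) i := by
    intro i; fin_cases i <;> simp
  replace h := (hw i).symm.trans (h.trans (congrArg (· * ((e : 𝓞 F) : F) ^ 2) (hw j)))
  have he0 : ((e : 𝓞 F) : F) ≠ 0 := by simp
  have hv0 : ((v : 𝓞 F) : F) ≠ 0 := by simp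
  have heN := isNU_sq he
  generalize ((e : 𝓞 F) : F) = e' at *
  generalize ((v : 𝓞 F) : F) = v' at *
  generalize ((ε : 𝓞 F) : F) = ε' at *
  obtain ⟨φ⟩ : Nonempty (F →+* ℂ) := inferInstance
  have R : ∀ ψ : F →+* ℂ, ∀ x, σ x = x → ψ x = ((ψ x).re : ℂ) := fun ψ x hx => by
    apply Complex.ext <;> simp [hreal ψ x hx]
  have E2 : ∀ ψ : F →+* ℂ, 0 < (ψ (e' ^ 2)).re := fun ψ => by
    rw [map_pow, R ψ e' he, ← Complex.ofReal_pow, Complex.ofReal_re]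
    have : (ψ e').re ≠ 0 := fun h0 => he0 (by
      have := R ψ e' he; rw [h0] at this; simpa using this)
    positivity
  have V : ∀ ψ : F →+* ℂ, 0 < (ψ v').re := fun ψ => by
    obtain ⟨a, ha⟩ := hv
    refine lt_of_le_of_ne (ha ▸ hpos ψ a) (fun h0 => hv0 ?_)
    have := R ψ v' hvf; rw [← h0] at this; simpa using this
  have M : ∀ ψ : F →+* ℂ, ∀ x, σ x = x → (ψ (x * e' ^ 2)).re = (ψ x).re * (ψ (e' ^ 2)).re := fun ψ x hx => by
    rw [map_mul, R ψ x hx, ← Complex.re_ofReal_mul]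
    simp
  let φ' : F →+* ℂ := φ.comp (τ : F →+* F)
  have hN : (φ ε').re * (φ' ε').re = -1 := by
    have h1 : φ ε' * φ' ε' = -1 := by
      change φ ε' * φ (τ ε') = -1
      rw [← map_mul, hε]; simp
    rw [R φ _ hεf, R φ' _ hεf] at h1
    exact_mod_cast h1
  have S : ∀ x y : F, σ y = y → x = y * e' ^ 2 → ∀ ψ : F →+* ℂ, (ψ x).re = (ψ y).re * (ψ (e' ^ 2)).re := 
    fun x y hy hxy ψ => by rw [hxy]; exact M ψ y hy
  have p1 := E2 φ
  have p2 := E2 φ'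
  have v1 := V φ
  have v2 := V φ'
  have hm1 : σ (-1 : F) = -1 := by simp
  have h1' : σ (1 : F) = 1 := by simp
  have hme : σ (-ε') = -ε' := by rw [map_neg, hεf]
  have n1 : ∀ ψ : F →+* ℂ, (ψ (-1)).re = -1 := fun ψ => by simp
  have n2 : ∀ ψ : F →+* ℂ, (ψ 1).re = 1 := fun ψ => by simp
  have n3 : ∀ ψ : F →+* ℂ, (ψ (-ε')).re = -(ψ ε').re := fun ψ => by simp
  have main : ∀ x y : F, σ y = y → x = y * e' ^ 2 → 0 < (φ x).re * (φ y).re ∧ 0 < (φ' x).re * (φ' y).re ∨ (φ y).re = 0 ∨ (φ' y).re = 0 := by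
    intro x y hy hxy
    rw [S x y hy hxy φ, S x y hy hxy φ']
    by_cases h1 : (φ y).re = 0
    · simp [h1]
    by_cases h2 : (φ' y).re = 0
    · simp [h2]
    left
    refine ⟨?_, ?_⟩
    · have : 0 < (φ y).re * (φ y).re := mul_self_pos.mpr h1
      nlinarith
    · have : 0 < (φ' y).re * (φ' y).re := mul_self_pos.mpr h2
      nlinarith
  have z1 : (φ ε').re ≠ 0 := fun h => by rw [h] at hN; simp at hN
  have z2 : (φ' ε').re ≠ 0 := fun h => by rw [h] at hN; simp at hN
  have z3 := v1.ne'
  have z4 := v2.ne'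
  have done1 : 1 = v' * e' ^ 2 → IsNU σ v' := fun h => by
    rw [show v' = (e' ^ 2)⁻¹ by field_simp; linear_combination -h]; exact heN.inv
  have done2 : v' = 1 * e' ^ 2 → IsNU σ v' := fun h => by
    rw [h, one_mul]; exact heN
  have sg : (0 < (φ ε').re ∧ (φ' ε').re < 0) ∨ ((φ ε').re < 0 ∧ 0 < (φ' ε').re) := by
    rcases lt_or_gt_of_ne z1 with h1 | h1
    · right; exact ⟨h1, by by_contra h2; push Not at h2; nlinarith⟩
    · left; exact ⟨h1, by by_contra h2; push Not at h2; nlinarith⟩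
  generalize hA : (φ ε').re = A at *
  generalize hB : (φ' ε').re = B at *
  generalize hv1 : (φ v').re = V1 at *
  generalize hv2 : (φ' v').re = V2 at *
  have pr1 : ∀ x y : ℝ, 0 < x → y < 0 → ¬ 0 < x * y := fun x y h1 h2 h3 => by nlinarith
  have pr2 : ∀ x y : ℝ, 0 < x → y < 0 → ¬ 0 < y * x := fun x y h1 h2 h3 => by nlinarith
  fin_cases i <;> fin_cases j <;> first | exact done1 h | exact done2 h | (exact absurd rfl hij) | skip
  all_goals
    exfalso
    change _ = _ * _ at h
    dsimp at h
    have k := main _ _ (by first | exact hm1 | exact h1' | exact hεf | exact hme | exact hvf) h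
    simp only [n1, n2, n3, neg_eq_zero, one_ne_zero, hA, hB, hv1, hv2, z1, z2, z3, z4, or_false] at k
    obtain ⟨k1, k2⟩ := k
    rcases sg with ⟨s1, s2⟩ | ⟨s1, s2⟩ <;>
    first
    | linarith
    | nlinarith
end
end Quin

namespace Quin
section
variable {F : Type*} [Field F] [NumberField F]

lemma absNorm_int (n : ℤ) : Ideal.absNorm (Ideal.span {(n : 𝓞 F)}) = n.natAbs ^ Module.finrank ℚ F := by
  rw [Ideal.absNorm_span_singleton, show (n : 𝓞 F) = algebraMap ℤ (𝓞 F) n by simp, Algebra.norm_algebraMap,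
    Int.natAbs_pow, RingOfIntegers.rank]

lemma absNorm_of_sq {ℓ j : ℕ} {c : ℤ} (hc : c.natAbs = ℓ) (hf : Module.finrank ℚ F = 2 * j) (lam : 𝓞 F) (u : 𝓞 F) (hu : IsUnit u)
    (h : lam * lam = u * c) : Ideal.absNorm (Ideal.span {lam}) = ℓ ^ j := by
  have h1 : Ideal.span {lam} * Ideal.span {lam} = Ideal.span {(c : 𝓞 F)} := by
    rw [Ideal.span_singleton_mul_span_singleton, h, mul_comm, Ideal.span_singleton_mul_right_unit hu]
  have h2 := congrArg Ideal.absNorm h1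
  rw [map_mul, absNorm_int, hf, hc, pow_mul', sq] at h2
  exact Nat.mul_self_inj.mp h2

/-- residue degree one -/
lemma residue {P : Ideal (𝓞 F)} {ℓ : ℕ} (hℓ : ℓ.Prime) (h : Ideal.absNorm P = ℓ) (x : 𝓞 F) : ∃ n : ℤ, x - n ∈ P := by
  have hc : Nat.card (𝓞 F ⧸ P) = ℓ := by rw [← h, Ideal.absNorm_apply, Submodule.cardQuot_apply]
  have : Fact ℓ.Prime := ⟨hℓ⟩
  have hne : (1 : 𝓞 F ⧸ P) ≠ 0 := by
    intro h0
    have : P = ⊤ := by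
      rw [Ideal.eq_top_iff_one]
      exact Ideal.Quotient.eq_zero_iff_mem.mp h0
    rw [this, Ideal.absNorm_top] at h
    exact hℓ.one_lt.ne h
  have := mem_zmultiples_of_prime_card hc hne (g' := Ideal.Quotient.mk P x)
  obtain ⟨n, hn⟩ := AddSubgroup.mem_zmultiples_iff.mp this
  refine ⟨n, ?_⟩
  rw [← Ideal.Quotient.eq_zero_iff_mem, map_sub, ← hn]
  simp

lemma int_mem {P : Ideal (𝓞 F)} (hP : P ≠ ⊤) {ℓ : ℕ} (hℓ : ℓ.Prime) (h : (ℓ : 𝓞 F) ∈ P) {n : ℤ} (hn : (n : 𝓞 F) ∈ P) :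
    (ℓ : ℤ) ∣ n := by
  by_contra h1
  have : IsCoprime (ℓ : ℤ) n := (Nat.prime_iff_prime_int.mp hℓ).coprime_iff_not_dvd.mpr h1
  obtain ⟨a, b, hab⟩ := this
  apply hP
  rw [Ideal.eq_top_iff_one]
  have h2 : (1 : 𝓞 F) = a * ℓ + b * n := by exact_mod_cast congrArg (Int.cast : ℤ → 𝓞 F) hab.symm
  rw [h2]
  exact P.add_mem (P.mul_mem_left _ h) (P.mul_mem_left _ hn)

lemma absNorm_ne {P : Ideal (𝓞 F)} {ℓ : ℕ} (hℓ : ℓ.Prime) {T N : ℤ} (θ : 𝓞 F) (hθ : θ ^ 2 - T * θ + N = 0)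
    (hf : ∀ n : ℤ, ¬ (ℓ : ℤ) ∣ n ^ 2 - T * n + N) : Ideal.absNorm P ≠ ℓ := by
  intro h
  obtain ⟨n, hn⟩ := residue hℓ h θ
  have hm : (ℓ : 𝓞 F) ∈ P := h ▸ Ideal.absNorm_mem P
  have hP : P ≠ ⊤ := by
    intro hT; rw [hT, Ideal.absNorm_top] at h; exact hℓ.one_lt.ne h
  apply hf n
  apply int_mem hP hℓ hm
  have : ((n ^ 2 - T * n + N : ℤ) : 𝓞 F) = (θ - n) * (T - θ - n) := by
    push_cast; linear_combination hθ
  rw [this]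
  exact P.mul_mem_right _ hn

lemma span_ne_bot {x : 𝓞 F} {ℓ j : ℕ} (hℓ : ℓ.Prime) (h : Ideal.absNorm (Ideal.span {x}) = ℓ ^ j) :
    Ideal.span {x} ≠ ⊥ := by
  intro h0
  rw [h0, Ideal.absNorm_bot] at h
  exact (pow_pos hℓ.pos j).ne h

lemma T1 {P : Ideal (𝓞 F)} (hP : P ≠ ⊤) {ℓ : ℕ} (hℓ : ℓ.Prime) {lam : 𝓞 F} (hlam : lam ∈ P)
    (hn : Ideal.absNorm (Ideal.span {lam}) = ℓ ^ 2) {T N : ℤ} (θ : 𝓞 F) (hθ : θ ^ 2 - T * θ + N = 0)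
    (hf : ∀ n : ℤ, ¬ (ℓ : ℤ) ∣ n ^ 2 - T * n + N) : P = Ideal.span {lam} := by
  have hle : Ideal.span {lam} ≤ P := (Ideal.span_singleton_le_iff_mem _).mpr hlam
  have hd := Ideal.absNorm_dvd_absNorm_of_le hle
  rw [hn, Nat.dvd_prime_pow hℓ] at hd
  obtain ⟨j, hj, hj'⟩ := hd
  symm
  apply eq_of_le_of_absNorm hle (span_ne_bot hℓ hn)
  interval_cases j
  · rw [pow_zero, Ideal.absNorm_eq_one_iff] at hj'; exact absurd hj' hP
  · rw [pow_one] at hj'; exact absurd hj' (absNorm_ne hℓ θ hθ hf)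
  · rw [hn, hj']

lemma T1' {P : Ideal (𝓞 F)} (hP : P ≠ ⊤) {ℓ : ℕ} (hℓ : ℓ.Prime) {lam : 𝓞 F} (hlam : lam ∈ P)
    (hn : Ideal.absNorm (Ideal.span {lam}) = ℓ) : P = Ideal.span {lam} := by
  have hle : Ideal.span {lam} ≤ P := (Ideal.span_singleton_le_iff_mem _).mpr hlam
  have hd := Ideal.absNorm_dvd_absNorm_of_le hle
  rw [hn, Nat.dvd_prime hℓ] at hd
  symm
  apply eq_of_le_of_absNorm hle (span_ne_bot (j := 1) hℓ (by rw [hn, pow_one]))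
  rcases hd with h | h
  · rw [Ideal.absNorm_eq_one_iff] at h; exact absurd h hP
  · rw [hn, h]

lemma finrank_over_FF (σ : F ≃ₐ[ℚ] F) (hσ : ∀ x, σ (σ x) = x) (h1 : σ ≠ 1) : Module.finrank (FF σ) F = 2 := by
  rw [IntermediateField.finrank_fixedField_eq_card, Nat.card_zpowers, zpowers_two σ hσ h1]

lemma T2 (τ : F ≃ₐ[ℚ] F) (hτ : ∀ x, τ (τ x) = x) (h1 : τ ≠ 1) (hM : OddClass (FF τ))
    (hF : Module.finrank ℚ (FF τ) = 4) {ℓ : ℕ} (hℓ : ℓ.Prime) {c : ℤ} (hc : c.natAbs = ℓ)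
    (w : 𝓞 (FF τ)) (hw : w * w = c) (ρ : FF τ ≃ₐ[ℚ] FF τ) (hρ : ∀ x, ρ (ρ x) = x) (hρw : ρ • w = w)
    {T N : ℤ} (θ : 𝓞 (FF τ)) (hT : θ + ρ • θ = T) (hN : θ * ρ • θ = N) (hTℓ : ¬ (ℓ : ℤ) ∣ T) (hNℓ : (ℓ : ℤ) ∣ N)
    {T' N' : ℤ} (θ' : 𝓞 F) (hθ' : θ' ^ 2 - T' * θ' + N' = 0) (hf : ∀ n : ℤ, ¬ (ℓ : ℤ) ∣ n ^ 2 - T' * n + N')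
    (P : Ideal (𝓞 F)) (hP : P.IsPrime) (hPw : algebraMap (𝓞 (FF τ)) (𝓞 F) w ∈ P) : OddI P := by
  set p := P.comap (algebraMap (𝓞 (FF τ)) (𝓞 F)) with hp
  have hpp : p.IsPrime := Ideal.comap_isPrime _ _
  have hwp : w ∈ p := hPw
  have hwn : Ideal.absNorm (Ideal.span {w}) = ℓ ^ 2 :=
    absNorm_of_sq hc (by rw [hF]) w 1 isUnit_one (by rw [hw, one_mul])
  have hle : Ideal.span {w} ≤ p := (Ideal.span_singleton_le_iff_mem _).mpr hwp
  have hℓp : (ℓ : 𝓞 (FF τ)) ∈ p := by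
    have : (c : 𝓞 (FF τ)) ∈ p := by rw [← hw]; exact p.mul_mem_left _ hwp
    rcases Int.natAbs_eq c with h | h
    · rw [h, hc] at this; exact_mod_cast this
    · rw [h, hc] at this
      have := p.neg_mem this
      simpa using this
  have hpn : Ideal.absNorm p = ℓ := by
    have hd := Ideal.absNorm_dvd_absNorm_of_le hle
    rw [hwn, Nat.dvd_prime_pow hℓ] at hd
    obtain ⟨j, hj, hj'⟩ := hd
    interval_cases j
    · rw [pow_zero, Ideal.absNorm_eq_one_iff] at hj'; exact absurd hj' hpp.ne_top
    · rw [hj', pow_one]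
    · exfalso
      have heq : Ideal.span {w} = p := eq_of_le_of_absNorm hle (span_ne_bot hℓ hwn) (by rw [hwn, hj'])
      have hinv : ∀ x ∈ p, ρ • x ∈ p := by
        intro x hx
        rw [← heq, Ideal.mem_span_singleton] at hx ⊢
        obtain ⟨y, rfl⟩ := hx
        rw [smul_mul', hρw]; exact dvd_mul_right _ _
      have hNp : θ * ρ • θ ∈ p := by
        rw [hN]
        obtain ⟨m, rfl⟩ := hNℓ
        push_cast
        exact p.mul_mem_right _ hℓp
      have hρρ : ρ • ρ • θ = θ := RingOfIntegers.ext (hρ θ)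
      have hb : θ + ρ • θ ∈ p := by
        rcases hpp.mem_or_mem hNp with h | h
        · exact p.add_mem h (hinv _ h)
        · exact p.add_mem (hρρ ▸ hinv _ h) h
      rw [hT] at hb
      exact hTℓ (int_mem hpp.ne_top hℓ hℓp hb)
  have hgal : IsGalois (FF τ) F := galF _
  have hmn : Ideal.absNorm (p.map (algebraMap (𝓞 (FF τ)) (𝓞 F))) = ℓ ^ 2 := by
    rw [Ideal.absNorm_algebraMap, hpn, finrank_ints, finrank_over_FF τ hτ h1]
  have hle2 : p.map (algebraMap (𝓞 (FF τ)) (𝓞 F)) ≤ P := Ideal.map_comap_le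
  have heq : p.map (algebraMap (𝓞 (FF τ)) (𝓞 F)) = P := by
    have hd := Ideal.absNorm_dvd_absNorm_of_le hle2
    rw [hmn, Nat.dvd_prime_pow hℓ] at hd
    obtain ⟨j, hj, hj'⟩ := hd
    apply eq_of_le_of_absNorm hle2
    · intro h0
      rw [h0, Ideal.absNorm_bot] at hmn
      exact (pow_pos hℓ.pos 2).ne hmn
    interval_cases j
    · rw [pow_zero, Ideal.absNorm_eq_one_iff] at hj'; exact absurd hj' hP.ne_top
    · rw [pow_one] at hj'; exact absurd hj' (absNorm_ne hℓ θ' hθ' hf)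
    · rw [hmn, hj']
  rw [← heq]
  exact oddI_map hM _

/-- one step in the tower -/
lemma step (σ : F ≃ₐ[ℚ] F) (hσ : ∀ x, σ (σ x) = x) (r : F) (hr : r ≠ 0) (hrσ : σ r = -r) (hk : OddClass (FF σ))
    (hU : ∀ v : (𝓞 F)ˣ, IsN σ ((v : 𝓞 F) : F) → IsNU σ ((v : 𝓞 F) : F))
    (θ : 𝓞 F) (hP : ∀ P : Ideal (𝓞 F), P.IsPrime → P ≠ ⊥ → θ - σ • θ ∈ P → OddI P) : OddClass F := by
  have h1 : σ ≠ 1 := by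
    rintro rfl
    apply hr
    have h2 : r = -r := hrσ
    linear_combination h2 / 2
  apply lemma1 σ hσ r hr hrσ (fun I _ => hN_of_odd σ hσ h1 hk I) (fun a v hv => hU v ⟨a, hv⟩)
  intro P hPp hP0 hPσ
  by_cases h : θ - σ • θ ∈ P
  · exact hP P hPp hP0 h
  · exact ext_odd σ hσ h1 hk P hPp hP0 hPσ θ h
end
end Quin

namespace Quin

/-- trace and norm of the standard generator -/
def tr (d : ℤ) : ℤ := if d % 4 = 1 then 1 else 0
def nm (d : ℤ) : ℤ := if d % 4 = 1 then (1 - d) / 4 else -d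
/-- the prime dividing the prime discriminant -/
def ell (d : ℤ) : ℕ := if d = -1 then 2 else d.natAbs
def PD (d : ℤ) : Prop := d = -1 ∨ d = 2 ∨ d = -2 ∨ (d.natAbs.Prime ∧ d % 4 = 1)
def inertb (ℓ : ℕ) (d : ℤ) : Bool := (List.range ℓ).all fun n => ((n : ℤ) ^ 2 - tr d * n + nm d) % ℓ != 0
def splitb (ℓ : ℕ) (d : ℤ) : Bool := (List.range ℓ).any fun n =>
  ((n : ℤ) ^ 2 + tr d * n + nm d) % ℓ == 0 && (2 * (n : ℤ) + tr d) % ℓ != 0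

lemma inert_of {ℓ : ℕ} (hℓ : 0 < ℓ) {d : ℤ} (h : inertb ℓ d = true) (n : ℤ) : ¬ (ℓ : ℤ) ∣ n ^ 2 - tr d * n + nm d := by
  intro hd
  rw [inertb, List.all_eq_true] at h
  have hl : (0 : ℤ) < ℓ := by exact_mod_cast hℓ
  obtain ⟨k, hk⟩ := Int.eq_ofNat_of_zero_le (Int.emod_nonneg n hl.ne')
  have hlt : k < ℓ := by
    have := Int.emod_lt_of_pos n hl
    omega
  have h1 := h k (List.mem_range.mpr hlt)
  rw [bne_iff_ne] at h1
  apply h1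
  apply Int.emod_eq_zero_of_dvd
  rw [← hk]
  have h2 : (ℓ : ℤ) ∣ n - n % ℓ := Int.dvd_self_sub_emod
  have : (n % ℓ) ^ 2 - tr d * (n % ℓ) + nm d = (n ^ 2 - tr d * n + nm d) - (n - n % ℓ) * (n + n % ℓ - tr d) := by ring
  rw [this]
  exact dvd_sub hd (Dvd.dvd.mul_right h2 _)

lemma split_of {ℓ : ℕ} {d : ℤ} (h : splitb ℓ d = true) : ∃ n : ℤ, (ℓ : ℤ) ∣ n ^ 2 + tr d * n + nm d ∧ ¬ (ℓ : ℤ) ∣ 2 * n + tr d := by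
  rw [splitb, List.any_eq_true] at h
  obtain ⟨n, -, hn⟩ := h
  simp only [Bool.and_eq_true, beq_iff_eq, bne_iff_ne] at hn
  exact ⟨n, Int.dvd_of_emod_eq_zero hn.1, fun h => hn.2 (Int.emod_eq_zero_of_dvd h)⟩

lemma PD.ell_prime {d : ℤ} (h : PD d) : (ell d).Prime := by
  rcases h with rfl | rfl | rfl | ⟨h1, h2⟩
  · simpa [ell] using Nat.prime_two
  · simpa [ell] using Nat.prime_two
  · simpa [ell] using Nat.prime_two
  · rw [ell, if_neg (by rintro rfl; norm_num at h1)]; exact h1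

lemma oext {F : Type*} [Field F] [NumberField F] {a b : 𝓞 F} (h : algebraMap (𝓞 F) F a = algebraMap (𝓞 F) F b) : a = b :=
  RingOfIntegers.ext h

lemma am_smul {F : Type*} [Field F] [NumberField F] (g : F ≃ₐ[ℚ] F) (x : 𝓞 F) :
    algebraMap (𝓞 F) F (g • x) = g (algebraMap (𝓞 F) F x) := coe_smul g x

/-- quadratic integrality -/
lemma isInt_quad {F : Type*} [Field F] {z : F} (T N : ℤ) (h : z ^ 2 - T * z + N = 0) : IsIntegral ℤ z := by
  refine ⟨Polynomial.X ^ 2 - Polynomial.C T * Polynomial.X + Polynomial.C N, by monicity!, ?_⟩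
  simp only [Polynomial.eval₂_add, Polynomial.eval₂_sub, Polynomial.eval₂_mul, Polynomial.eval₂_pow, Polynomial.eval₂_X, Polynomial.eval₂_C]
  simpa using h

namespace MQ
variable {n : ℕ} {F : Type*} [Field F] [NumberField F] {d : Fin n → ℤ} (m : MQ n F d)
include m

/-- the generator as an integer -/
lemma isInt (i : Fin n) : IsIntegral ℤ (m.x i) := by
  apply isInt_quad 0 (- d i)
  rw [m.hx]; simp

/-- integer generator -/
noncomputable def X (i : Fin n) : 𝓞 F := ⟨m.x i, m.isInt i⟩
lemma X_coe (i : Fin n) : algebraMap (𝓞 F) F (m.X i) = m.x i := rfl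
lemma X_sq (i : Fin n) : m.X i * m.X i = (d i : 𝓞 F) := by
  apply oext
  rw [map_mul, X_coe, ← sq, m.hx]; simp

lemma th (i : Fin n) : ∃ θ : 𝓞 F, (θ ^ 2 - tr (d i) * θ + nm (d i) = 0) ∧
    (∀ h : F ≃ₐ[ℚ] F, h (m.x i) = - m.x i → θ + h • θ = tr (d i) ∧ θ * h • θ = nm (d i)) ∧
    (θ - m.g i • θ = if d i % 4 = 1 then m.X i else 2 * m.X i) := by
  by_cases h4 : d i % 4 = 1
  · have hN : (4 : F) * (nm (d i) : ℤ) = 1 - d i := by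
      rw [nm, if_pos h4]
      have : 4 * ((1 - d i) / 4) = 1 - d i := by omega
      exact_mod_cast congrArg (Int.cast : ℤ → F) this
    have hT : tr (d i) = 1 := if_pos h4
    have hintg : IsIntegral ℤ ((1 + m.x i) / 2) := by
      apply isInt_quad 1 (nm (d i))
      push_cast
      linear_combination (1 / 4) * hN + m.hx i / 4
    obtain ⟨θ, hθ⟩ : ∃ θ : 𝓞 F, algebraMap (𝓞 F) F θ = (1 + m.x i) / 2 := ⟨⟨_, hintg⟩, rfl⟩
    refine ⟨θ, ?_, ?_, ?_⟩
    · apply oext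
      simp [hT, hθ]
      linear_combination (1 / 4) * hN + m.hx i / 4
    · intro h hh
      constructor
      · apply oext
        rw [map_add, am_smul]
        simp [hT, hh, hθ, map_ofNat]
        ring
      · apply oext
        rw [map_mul, am_smul]
        simp [hh, hθ, map_ofNat]
        linear_combination -(1 / 4) * hN - m.hx i / 4
    · apply oext
      rw [map_sub, am_smul, if_pos h4, X_coe]
      rw [hθ, map_div₀, map_ofNat, map_add, map_one, m.hg]
      ring
  · have hN : nm (d i) = - d i := if_neg h4
    have hT : tr (d i) = 0 := if_neg h4
    refine ⟨m.X i, ?_, ?_, ?_⟩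
    · rw [hT, hN, sq, m.X_sq]; simp
    · intro h hh
      have : h • m.X i = - m.X i := oext (by rw [am_smul, X_coe, hh]; simp [X_coe])
      rw [this, hT, hN]
      refine ⟨by simp, ?_⟩
      rw [mul_neg, m.X_sq]; simp
    · have : m.g i • m.X i = - m.X i := oext (by rw [am_smul, X_coe, m.hg]; simp [X_coe])
      rw [this, if_neg h4]; ring

/-- local parameter -/
noncomputable def lam (i : Fin n) : 𝓞 F := if d i = -1 then 1 + m.X i else m.X i

lemma lam_sq (i : Fin n) : ∃ (u : 𝓞 F) (c : ℤ), IsUnit u ∧ c.natAbs = ell (d i) ∧ m.lam i * m.lam i = u * c := by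
  by_cases h : d i = -1
  · refine ⟨m.X i, 2, ?_, ?_, ?_⟩
    · apply IsUnit.of_mul_eq_one (- m.X i)
      rw [mul_neg, m.X_sq, h]; simp
    · simp [ell, h]
    · rw [lam, if_pos h]
      have h2 := m.X_sq i
      rw [h] at h2
      push_cast at h2 ⊢
      linear_combination h2
  · exact ⟨1, d i, isUnit_one, by rw [ell, if_neg h], by rw [lam, if_neg h, m.X_sq]; simp⟩

lemma lam_mem (i : Fin n) (hd : PD (d i)) (P : Ideal (𝓞 F)) (hP : P.IsPrime)
    (h : (if d i % 4 = 1 then m.X i else 2 * m.X i) ∈ P) : m.lam i ∈ P := by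
  rcases hd with hd | hd | hd | ⟨h1, h2⟩
  · rw [if_neg (by rw [hd]; norm_num)] at h
    rw [lam, if_pos hd]
    apply hP.mem_of_pow_mem 2
    have h2 := m.X_sq i
    rw [hd] at h2
    push_cast at h2
    rw [show (1 + m.X i) ^ 2 = 2 * m.X i by linear_combination h2]
    exact h
  · rw [if_neg (by rw [hd]; norm_num)] at h
    rw [lam, if_neg (by rw [hd]; norm_num)]
    have h2 := m.X_sq i
    rw [hd] at h2
    push_cast at h2
    apply hP.mem_of_pow_mem 3
    rw [show m.X i ^ 3 = 2 * m.X i by linear_combination m.X i * h2]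
    exact h
  · rw [if_neg (by rw [hd]; norm_num)] at h
    rw [lam, if_neg (by rw [hd]; norm_num)]
    have h2 := m.X_sq i
    rw [hd] at h2
    push_cast at h2
    apply hP.mem_of_pow_mem 3
    rw [show m.X i ^ 3 = - (2 * m.X i) by linear_combination m.X i * h2]
    exact P.neg_mem h
  · rw [if_pos h2] at h
    rw [lam, if_neg (by intro h3; rw [h3] at h2; norm_num at h2)]
    exact h
end MQ

lemma odd_of_principal {F : Type*} [Field F] [NumberField F] {P : Ideal (𝓞 F)} {x : 𝓞 F} (h : P = Ideal.span {x}) : OddI P :=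
  h ▸ oddI_span x

lemma odd_one {F : Type*} [Field F] [NumberField F] (h : Module.finrank ℚ F = 1) : OddClass F := by
  have hs : Function.Surjective (algebraMap ℤ (𝓞 F)) := by
    intro y
    have h2 : Function.Surjective (algebraMap ℚ F) := by
      have := (finrank_eq_one_iff_of_nonzero' (1 : F) one_ne_zero).mp h
      intro z
      obtain ⟨c, hc⟩ := this z
      exact ⟨c, by rw [← hc, Algebra.smul_def, mul_one]⟩
    obtain ⟨q, hq⟩ := h2 (algebraMap (𝓞 F) F y)
    have hi : IsIntegral ℤ q := by
      have := y.isIntegral_coe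
      rw [← hq] at this
      exact (isIntegral_algebraMap_iff (algebraMap ℚ F).injective).mp this
    obtain ⟨k, hk⟩ := IsIntegrallyClosed.isIntegral_iff.mp hi
    refine ⟨k, oext ?_⟩
    rw [← hq, ← hk]; simp
  have : IsPrincipalIdealRing (𝓞 F) := IsPrincipalIdealRing.of_surjective _ hs
  intro I
  obtain ⟨x, hx⟩ := (IsPrincipalIdealRing.principal I).principal
  exact odd_of_principal hx

section
variable {F : Type*} [Field F] [NumberField F]

/-- rational units -/
lemma rat_unit (v : (𝓞 F)ˣ) (q : ℚ) (h : ((v : 𝓞 F) : F) = q) : ((v : 𝓞 F) : F) = 1 ∨ ((v : 𝓞 F) : F) = -1 := by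
  have key : ∀ (y : 𝓞 F) (q : ℚ), (y : F) = q → ∃ k : ℤ, y = k := by
    intro y q hq
    have hi : IsIntegral ℤ q := by
      have := y.isIntegral_coe
      rw [← RingOfIntegers.coe_eq_algebraMap, hq, show ((q : ℚ) : F) = algebraMap ℚ F q from rfl] at this
      exact (isIntegral_algebraMap_iff (algebraMap ℚ F).injective).mp this
    obtain ⟨k, hk⟩ := IsIntegrallyClosed.isIntegral_iff.mp hi
    refine ⟨k, oext ?_⟩
    rw [← RingOfIntegers.coe_eq_algebraMap, hq, ← hk]; simp
  obtain ⟨k, hk⟩ := key v q h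
  have hinv : ((v : 𝓞 F) : F) * (((v⁻¹ : (𝓞 F)ˣ) : 𝓞 F) : F) = 1 := by
    rw [← map_mul, Units.mul_inv, map_one]
  obtain ⟨l, hl⟩ := key (v⁻¹ : (𝓞 F)ˣ) q⁻¹ (by
    rw [Rat.cast_inv, ← h]; exact eq_inv_of_mul_eq_one_right hinv)
  rw [hk, hl] at hinv
  have : k * l = 1 := by
    simp only [map_intCast] at hinv; exact_mod_cast hinv
  rcases Int.eq_one_or_neg_one_of_mul_eq_one this with h | h
  · left; rw [hk, h]; simp
  · right; rw [hk, h]; simp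

lemma q_odd {d : Fin 1 → ℤ} (m : MQ 1 F d) (hd : PD (d 0))
    (hu : d 0 < 0 ∨ ∃ e : (𝓞 F)ˣ, ((e : 𝓞 F) : F) * m.g 0 ((e : 𝓞 F) : F) = -1) : OddClass F := by
  obtain ⟨θ, h1, h2, h3⟩ := m.th 0
  refine step (m.g 0) (m.aut_aut _) (m.x 0) (m.x_ne 0) (m.hg 0) ?_ ?_ θ ?_
  · apply odd_one
    have := m.finrank_FF (m.g 0) (m.g_ne_one 0)
    omega
  · rintro v ⟨a, ha⟩
    have hvf : m.g 0 ((v : 𝓞 F) : F) = ((v : 𝓞 F) : F) := by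
      rw [← ha, map_mul, m.aut_aut, mul_comm]
    obtain ⟨q, hq⟩ := m.rat_of_fixed _ (fun i => by rw [Subsingleton.elim i 0]; exact hvf)
    rcases rat_unit v q hq with h | h
    · exact ⟨1, by rw [h]; simp⟩
    · rcases hu with hu | ⟨e, he⟩
      · exfalso
        obtain ⟨x, hx⟩ := m.rat_of_fixed ((a + m.g 0 a) / 2) (fun i => by
          rw [Subsingleton.elim i 0, map_div₀, map_add, m.aut_aut, add_comm, map_ofNat])
        obtain ⟨y, hy⟩ := m.rat_of_fixed ((a - m.g 0 a) / 2 / m.x 0) (fun i => by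
          rw [Subsingleton.elim i 0, map_div₀, map_div₀, map_sub, m.aut_aut, m.hg, map_ofNat]
          have := m.x_ne 0
          field_simp; ring)
        have hx0 := m.x_ne 0
        have e1 : a = x + y * m.x 0 := by rw [← hx, ← hy]; field_simp; ring
        have e2 : m.g 0 a = x - y * m.x 0 := by rw [← hx, ← hy]; field_simp; ring
        rw [h, e2, e1] at ha
        have e3 : ((x ^ 2 - d 0 * y ^ 2 : ℚ) : F) = ((-1 : ℚ) : F) := by
          push_cast
          rw [← ha]; linear_combination y ^ 2 * m.hx 0
        have e4 : x ^ 2 - d 0 * y ^ 2 = -1 := by exact_mod_cast e3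
        have e5 : ((d 0 : ℤ) : ℚ) < 0 := by exact_mod_cast hu
        nlinarith [sq_nonneg x, mul_nonneg (neg_pos.mpr e5).le (sq_nonneg y)]
      · exact ⟨e, by rw [he, h]⟩
  · intro P hP hP0 h
    rw [h3] at h
    obtain ⟨u, c, hu, hc, hl⟩ := m.lam_sq 0
    refine odd_of_principal (T1' hP.ne_top hd.ell_prime (m.lam_mem 0 hd P hP h) ?_)
    rw [absNorm_of_sq hc (j := 1) (by rw [m.hF]; norm_num) _ u hu hl, pow_one]

lemma biq_odd {d : Fin 2 → ℤ} (m : MQ 2 F d) (i j : Fin 2) (hd : PD (d i)) (hk : OddClass (FF (m.g i)))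
    (hin : inertb (ell (d i)) (d j) = true)
    (hU : ∀ v : (𝓞 F)ˣ, IsN (m.g i) ((v : 𝓞 F) : F) → IsNU (m.g i) ((v : 𝓞 F) : F)) : OddClass F := by
  obtain ⟨θ, h1, h2, h3⟩ := m.th i
  obtain ⟨θ', h1', h2', h3'⟩ := m.th j
  refine step (m.g i) (m.aut_aut _) (m.x i) (m.x_ne i) (m.hg i) hk hU θ ?_
  intro P hP hP0 h
  rw [h3] at h
  obtain ⟨u, c, hu, hc, hl⟩ := m.lam_sq i
  refine odd_of_principal (T1 hP.ne_top hd.ell_prime (m.lam_mem i hd P hP h) ?_ θ' h1' (inert_of hd.ell_prime.pos hin))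
  rw [absNorm_of_sq hc (j := 2) (by rw [m.hF]; norm_num) _ u hu hl]

lemma tri_odd {d : Fin 3 → ℤ} (m : MQ 3 F d) (hd : PD (d 2)) (hd1 : d 2 ≠ -1) (hk : OddClass (FF (m.g 2)))
    (hM : OddClass (FF (m.g 1))) (hin : inertb (ell (d 2)) (d 1) = true) (hsp : splitb (ell (d 2)) (d 0) = true)
    (hU : ∀ v : (𝓞 F)ˣ, IsN (m.g 2) ((v : 𝓞 F) : F) → IsNU (m.g 2) ((v : 𝓞 F) : F)) : OddClass F := by
  obtain ⟨θ, h1, h2, h3⟩ := m.th 2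
  obtain ⟨θ', h1', h2', h3'⟩ := m.th 1
  refine step (m.g 2) (m.aut_aut _) (m.x 2) (m.x_ne 2) (m.hg 2) hk hU θ ?_
  intro P hP hP0 h
  rw [h3] at h
  have hl := m.lam_mem 2 hd P hP h
  rw [MQ.lam, if_neg hd1] at hl
  have hell : (d 2).natAbs = ell (d 2) := by rw [ell, if_neg hd1]
  obtain ⟨n, hn1, hn2⟩ := split_of hsp
  obtain ⟨φ, f1, f2, f3⟩ := (m.res 1).th 0
  have f4 := f2 ((m.res 1).g 0) ((m.res 1).hg 0)
  have hF := m.finrank_FF (m.g 1) (m.g_ne_one 1)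
  refine T2 (m.g 1) (m.aut_aut _) (m.g_ne_one 1) hM (by omega) hd.ell_prime hell ((m.res 1).X 1) ((m.res 1).X_sq 1)
    ((m.res 1).g 0) ((m.res 1).aut_aut _) ?_ (T := 2 * n + tr (d 0)) (N := n ^ 2 + tr (d 0) * n + nm (d 0)) (φ + n) ?_ ?_ hn2 hn1 θ' h1' (inert_of hd.ell_prime.pos hin) P hP hl
  · apply oext
    rw [am_smul, MQ.X_coe, (m.res 1).hg' 0 1 (by decide)]
  · have e := f4.1
    rw [smul_add, show (m.res 1).g 0 • (n : 𝓞 (FF (m.g 1))) = n from map_intCast (MulSemiringAction.toRingHom _ _ ((m.res 1).g 0)) n]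
    have e' : φ + (m.res 1).g 0 • φ = (tr (d 0) : 𝓞 (FF (m.g 1))) := e
    push_cast
    linear_combination e'
  · have e : φ + (m.res 1).g 0 • φ = (tr (d 0) : 𝓞 (FF (m.g 1))) := f4.1
    have e' : φ * (m.res 1).g 0 • φ = (nm (d 0) : 𝓞 (FF (m.g 1))) := f4.2
    rw [smul_add, show (m.res 1).g 0 • (n : 𝓞 (FF (m.g 1))) = n from map_intCast (MulSemiringAction.toRingHom _ _ ((m.res 1).g 0)) n]
    push_cast
    linear_combination e' + n * e
end
end Quin

namespace Quin

section
variable {F : Type*} [Field F] [NumberField F]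

lemma mk1 (σ : F ≃ₐ[ℚ] F) {A B : F} (hA : IsIntegral ℤ A) (h1 : σ A = A) (h2 : σ B = -B) (h : A ^ 2 - B ^ 2 = -4) :
    ∃ u : (𝓞 F)ˣ, ((u : 𝓞 F) : F) = (A + B) / 2 ∧ ((u : 𝓞 F) : F) * σ ((u : 𝓞 F) : F) = -1 := by
  have hs : σ ((A + B) / 2) = (A - B) / 2 := by
    rw [map_div₀, map_ofNat, map_add, h1, h2]; ring
  have hn : (A + B) / 2 * σ ((A + B) / 2) = -1 := by
    rw [hs]; linear_combination h / 4
  obtain ⟨u, hu⟩ := mk_unit σ ((A + B) / 2) (-1) ⟨A, hA⟩ (by rw [hs]; change _ = A; ring) hn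
    isIntegral_one.neg (by rw [inv_neg, inv_one]; exact isIntegral_one.neg) (by norm_num)
  exact ⟨u, hu, by rw [hu, hn]⟩

lemma isInt_I {I : F} (hI : I ^ 2 = -1) : IsIntegral ℤ I := isInt_quad 0 1 (by rw [hI]; simp)

lemma one_add_I_ne {I : F} (hI : I ^ 2 = -1) : 1 + I ≠ 0 := by
  intro h
  have : I = -1 := by linear_combination h
  rw [this] at hI
  norm_num at hI

lemma mk2 (σ : F ≃ₐ[ℚ] F) {A B I : F} (hA : IsIntegral ℤ A) (h1 : σ A = A) (h2 : σ B = -B) (hI : I ^ 2 = -1) (hσI : σ I = I)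
    {e : ℤ} (he : e = 1 ∨ e = -1) (h : A ^ 2 - B ^ 2 = 2 * e) :
    ∃ u : (𝓞 F)ˣ, ((u : 𝓞 F) : F) * σ ((u : 𝓞 F) : F) = ((-e : ℤ) : F) * I := by
  have hI0 := one_add_I_ne hI
  have hs : σ ((A + B) / (1 + I)) = (A - B) / (1 + I) := by
    rw [map_div₀, map_add, map_add, map_one, hσI, h1, h2]; ring
  have hn : (A + B) / (1 + I) * σ ((A + B) / (1 + I)) = ((-e : ℤ) : F) * I := by
    rw [hs]; field_simp; push_cast; linear_combination h + e * hI * (I + 2)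
  have hI1 : I ≠ 0 := by rintro rfl; norm_num at hI
  have he2 : (e : F) ^ 2 = 1 := by rcases he with rfl | rfl <;> norm_num
  have hinv : (((-e : ℤ) : F) * I)⁻¹ = ((e : ℤ) : F) * I := by
    apply inv_eq_of_mul_eq_one_left
    push_cast
    linear_combination (-e ^ 2) * hI + he2
  obtain ⟨u, hu⟩ := mk_unit σ ((A + B) / (1 + I)) (((-e : ℤ) : F) * I) ⟨A * (1 - I), hA.mul (isIntegral_one.sub (isInt_I hI))⟩ (by
      rw [hs]; change _ = A * (1 - I); field_simp; linear_combination A * hI) hn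
    ((isIntegral_algebraMap (R := ℤ) (x := -e)).mul (isInt_I hI))
    (by rw [hinv]; exact (isIntegral_algebraMap (R := ℤ) (x := e)).mul (isInt_I hI))
    (by
      intro h0
      rw [h0] at hn hinv
      have e0 : (e : F) = 0 := by
        rcases mul_eq_zero.mp h0 with h | h
        · push_cast at h; linear_combination -h
        · exact absurd h hI1
      rw [e0] at he2; norm_num at he2)
  exact ⟨u, by rw [hu, hn]⟩

lemma mk3 (σ : F ≃ₐ[ℚ] F) {A B I : F} (hA : IsIntegral ℤ A) (hB : IsIntegral ℤ B) (h1 : σ A = A) (h2 : σ B = B) (hI : I ^ 2 = -1) (hσI : σ I = -I)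
    (h : A ^ 2 + B ^ 2 = -2) :
    ∃ u : (𝓞 F)ˣ, ((u : 𝓞 F) : F) = (A + B * I) / (1 + I) ∧ ((u : 𝓞 F) : F) * σ ((u : 𝓞 F) : F) = -1 := by
  have hI0 := one_add_I_ne hI
  have hI0' : 1 - I ≠ 0 := by
    have := one_add_I_ne (I := -I) (by rw [neg_sq, hI])
    rwa [← sub_eq_add_neg] at this
  have hs : σ ((A + B * I) / (1 + I)) = (A - B * I) / (1 - I) := by
    rw [map_div₀, map_add, map_add, map_mul, map_one, hσI, h1, h2]; ring
  have hn : (A + B * I) / (1 + I) * σ ((A + B * I) / (1 + I)) = -1 := by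
    rw [hs]; field_simp; linear_combination h + (-B ^ 2 - 1) * hI
  obtain ⟨u, hu⟩ := mk_unit σ ((A + B * I) / (1 + I)) (-1) ⟨A + B, hA.add hB⟩ (by rw [hs]; change _ = A + B; field_simp; linear_combination (A - B) * hI) hn
    isIntegral_one.neg (by rw [inv_neg, inv_one]; exact isIntegral_one.neg) (by norm_num)
  exact ⟨u, hu, by rw [hu, hn]⟩

/-- no square classes -/
def NS {n : ℕ} (d : Fin n → ℤ) (i : Fin n) (D : ℤ) : Prop := ∀ S : Finset (Fin n), i ∉ S → ¬ IsSquare (D * ∏ i ∈ S, d i)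
instance {n : ℕ} (d : Fin n → ℤ) (i : Fin n) (D : ℤ) : Decidable (NS d i D) := by unfold NS; infer_instance

lemma MQ.prod_sg {n : ℕ} {d : Fin n → ℤ} (m : MQ n F d) (S : Finset (Fin n)) (j : Fin n) :
    m.g j (∏ i ∈ S, m.x i) = (if j ∈ S then -1 else 1) * ∏ i ∈ S, m.x i := by
  classical
  rw [map_prod]
  have h1 : ∀ i, m.g j (m.x i) = (if i = j then (-1 : F) else 1) * m.x i := by
    intro i
    by_cases h : i = j
    · rw [if_pos h, h, m.hg]; ring
    · rw [if_neg h, m.hg' _ _ (Ne.symm h)]; ring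
  rw [Finset.prod_congr rfl (fun i _ => h1 i), Finset.prod_mul_distrib, Finset.prod_ite_eq' S j (fun _ => (-1 : F))]

lemma MQ.sq_rat {n : ℕ} {d : Fin n → ℤ} (m : MQ n F d) (D : ℤ) (z : F) (hz : z ^ 2 = D) (hD : D ≠ 0) :
    ∃ S : Finset (Fin n), (∀ i ∈ S, m.g i z = -z) ∧ IsSquare (D * ∏ i ∈ S, d i) := by
  classical
  have hpm : ∀ i, m.g i z = z ∨ m.g i z = -z := fun i => by
    apply sq_eq_sq_iff_eq_or_eq_neg.mp
    rw [← map_pow, hz, map_intCast]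
  have hz0 : z ≠ 0 := by
    rintro rfl
    apply hD
    have : (D : F) = 0 := by rw [← hz]; simp
    exact_mod_cast this
  refine ⟨Finset.univ.filter (fun i => m.g i z = -z), fun i hi => (Finset.mem_filter.mp hi).2, ?_⟩
  set S := Finset.univ.filter (fun i => m.g i z = -z) with hS
  obtain ⟨q, hq⟩ := m.rat_of_fixed (z * ∏ i ∈ S, m.x i) (fun j => by
    rw [map_mul, m.prod_sg]
    by_cases h : m.g j z = -z
    · rw [if_pos (by rw [hS]; simp [h]), h]; ring
    · rw [if_neg (by rw [hS]; simp [h]), (hpm j).resolve_right h]; ring)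
  have h2 : ((q * q : ℚ) : F) = ((D * ∏ i ∈ S, d i : ℤ) : F) := by
    push_cast
    rw [← hq, mul_mul_mul_comm, ← sq, hz, ← Finset.prod_mul_distrib]
    congr 1
    exact Finset.prod_congr rfl (fun i _ => by rw [← sq, m.hx])
  have h3 : q * q = ((D * ∏ i ∈ S, d i : ℤ) : ℚ) := by exact_mod_cast h2
  have h4 : IsSquare (((D * ∏ i ∈ S, d i : ℤ) : ℚ)) := ⟨q, h3.symm⟩
  exact Rat.isSquare_intCast_iff.mp h4

lemma MQ.ns {n : ℕ} {d : Fin n → ℤ} (m : MQ n F d) {i : Fin n} {D : ℤ} (h : NS d i D) (hD : D ≠ 0) (z : F) (hz : m.g i z = z) : z ^ 2 ≠ D := by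
  intro h1
  obtain ⟨S, h2, h3⟩ := m.sq_rat D z h1 hD
  refine h S (fun hi => ?_) h3
  have h4 := h2 i hi
  rw [hz] at h4
  have : z = 0 := by linear_combination h4 / 2
  rw [this] at h1
  apply hD
  have : (D : F) = 0 := by rw [← h1]; simp
  exact_mod_cast this

/-- no fourth root of minus one -/
lemma MQ.ns8 {n : ℕ} {d : Fin n → ℤ} (m : MQ n F d) {i : Fin n} (h : NS d i 2) (z : F) (hz : m.g i z = z) : z ^ 4 ≠ -1 := by
  intro h1
  have h0 : z ≠ 0 := by rintro rfl; norm_num at h1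
  apply m.ns h (by norm_num) (z - z ^ 3) (by rw [map_sub, map_pow, hz])
  push_cast
  linear_combination (z ^ 2 - 2) * h1

/-- coordinates -/
lemma MQ.coord {n : ℕ} {d : Fin n → ℤ} (m : MQ n F d) (j : Fin n) (x : F) (h : ∀ i, i ≠ j → m.g i x = x) :
    ∃ p q : ℚ, x = p + q * m.x j := by
  have hx0 := m.x_ne j
  obtain ⟨p, hp⟩ := m.rat_of_fixed ((x + m.g j x) / 2) (fun i => by
    rw [map_div₀, map_ofNat, map_add]
    by_cases hi : i = j
    · rw [hi, m.aut_aut, add_comm]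
    · rw [m.aut_aut_comm, h i hi])
  obtain ⟨q, hq⟩ := m.rat_of_fixed ((x - m.g j x) / 2 / m.x j) (fun i => by
    rw [map_div₀, map_div₀, map_ofNat, map_sub]
    by_cases hi : i = j
    · rw [hi, m.aut_aut, m.hg]; field_simp; ring
    · rw [m.aut_aut_comm, h i hi, m.hg' _ _ hi])
  refine ⟨p, q, ?_⟩
  rw [← hp, ← hq]; field_simp; ring

/-- biquadratic over imaginary quadratic -/
lemma k_odd {d : Fin 2 → ℤ} (m : MQ 2 F d) (i j : Fin 2) (hij : i ≠ j) (hi : PD (d i)) (hj : PD (d j)) (hj0 : d j < 0)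
    (hin : inertb (ell (d i)) (d j) = true) (η : (𝓞 F)ˣ)
    (hg : ∀ z, m.g i z = z → z ^ 2 ≠ ((η : 𝓞 F) : F) * m.g i ((η : 𝓞 F) : F)) : OddClass F := by
  have hs : i.succAbove 0 = j := by fin_cases i <;> fin_cases j <;> first | rfl | exact absurd rfl hij
  have hj' : d (i.succAbove 0) = d j := by rw [hs]
  refine biq_odd m i j hi (q_odd (m.res i) (by rw [hj']; exact hj) (Or.inl (by rw [hj']; exact hj0))) hin ?_
  apply U0 (m.g i) (m.aut_aut _) _ η hg
  refine rank_im (d := d j) (by exact_mod_cast hj0) ((m.res i).x 0) ?_ (by rw [(m.res i).hF]; rfl)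
  rw [(m.res i).hx, hj']; norm_cast

lemma M_odd_real {d : Fin 2 → ℤ} (m : MQ 2 F d) (i j : Fin 2) (hij : i ≠ j) (hi : PD (d i)) (hj : PD (d j)) (hi0 : d i < 0) (hj0 : 0 < d j)
    (hin : inertb (ell (d i)) (d j) = true) (X Y : ℤ) (hXY : X ^ 2 - d j * Y ^ 2 = -4) : OddClass F := by
  have hs : i.succAbove 0 = j := by fin_cases i <;> fin_cases j <;> first | rfl | exact absurd rfl hij
  have hj' : d (i.succAbove 0) = d j := by rw [hs]
  have hc : ∀ k, k ≠ j → k = i := by omega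
  refine biq_odd m i j hi (q_odd (m.res i) (by rw [hj']; exact hj) (Or.inr ?_)) hin ?_
  · obtain ⟨e, -, he⟩ := mk1 ((m.res i).g 0) (A := (X : FF (m.g i))) (B := (Y : FF (m.g i)) * (m.res i).x 0) isIntegral_algebraMap (map_intCast _ _)
      (by rw [map_mul, (m.res i).hg, map_intCast]; ring) (by
        rw [mul_pow, (m.res i).hx, hj']
        have : ((X ^ 2 - d j * Y ^ 2 : ℤ) : FF (m.g i)) = ((-4 : ℤ) : FF (m.g i)) := by rw [hXY]
        push_cast at this
        linear_combination this)
    exact ⟨e, he⟩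
  · obtain ⟨e, he1, he⟩ := mk1 (m.g j) (A := (X : F)) (B := (Y : F) * m.x j) isIntegral_algebraMap (map_intCast _ _)
      (by rw [map_mul, m.hg, map_intCast]; ring) (by
        rw [mul_pow, m.hx]
        have : ((X ^ 2 - d j * Y ^ 2 : ℤ) : F) = ((-4 : ℤ) : F) := by rw [hXY]
        push_cast at this
        linear_combination this)
    have hreal : ∀ φ : F →+* ℂ, ∀ x, m.g i x = x → (φ x).im = 0 := by
      intro φ x hx
      obtain ⟨p, q, rfl⟩ := m.coord j x (fun k hk => by rw [hc k hk, hx])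
      have h1 : (φ (m.x j)) ^ 2 = ((d j : ℝ) : ℂ) := by rw [← map_pow, m.hx]; simp
      have h2 : (φ (m.x j)).im = 0 := by
        have h3 := congrArg Complex.re h1
        have h4 := congrArg Complex.im h1
        rw [sq, Complex.mul_re, Complex.ofReal_re] at h3
        rw [sq, Complex.mul_im, Complex.ofReal_im] at h4
        have h5 : (0 : ℝ) < d j := by exact_mod_cast hj0
        by_contra hne
        have : (φ (m.x j)).re = 0 := by
          have : (φ (m.x j)).re * (φ (m.x j)).im = 0 := by linarith
          exact (mul_eq_zero.mp this).resolve_right hne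
        rw [this] at h3
        nlinarith [sq_nonneg (φ (m.x j)).im]
      rw [map_add, map_mul, map_ratCast, map_ratCast, Complex.add_im, Complex.mul_im, h2]
      simp
    refine UR (m.g i) (m.g j) (m.aut_aut _) (rank_two (by rw [(m.res i).hF]; rfl)) hreal ?_ e ?_ he
    · intro φ x
      have hx0 := m.x_ne i
      have r1 := hreal φ ((x + m.g i x) / 2) (by rw [map_div₀, map_ofNat, map_add, m.aut_aut, add_comm])
      have r2 := hreal φ ((x - m.g i x) / 2 / m.x i) (by rw [map_div₀, map_div₀, map_ofNat, map_sub, m.aut_aut, m.hg]; field_simp; ring)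
      have e1 : x * m.g i x = ((x + m.g i x) / 2) ^ 2 - ((x - m.g i x) / 2 / m.x i) ^ 2 * d i := by
        rw [← m.hx]; field_simp; ring
      rw [e1, map_sub, map_mul, map_pow, map_pow, map_intCast]
      set P := φ ((x + m.g i x) / 2)
      set Q := φ ((x - m.g i x) / 2 / m.x i)
      have h5 : (d i : ℝ) < 0 := by exact_mod_cast hi0
      simp only [sq, Complex.sub_re, Complex.mul_re, Complex.mul_im, r1, r2, Complex.intCast_re, Complex.intCast_im]
      nlinarith [sq_nonneg P.re, mul_nonneg (neg_pos.mpr h5).le (sq_nonneg Q.re)]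
    · rw [he1, map_div₀, map_ofNat, map_add, map_mul, map_intCast, map_intCast, m.hg' _ _ hij]
end
end Quin

namespace Quin

lemma local_int {p : ℕ} [Fact p.Prime] {c : ℤ} (hc : c.natAbs = p) {A B ν : ℚ_[p]} (h : A ^ 2 - c * B ^ 2 = ν) (hν : ‖ν‖ = 1) :
    ‖A‖ ≤ 1 ∧ ‖B‖ ≤ 1 := by
  have hp1 : (1 : ℝ) < p := by exact_mod_cast (Fact.out : p.Prime).one_lt
  have hp0 : (p : ℝ) ≠ 0 := by positivity
  have hcn : ‖(c : ℚ_[p])‖ = (p : ℝ) ^ (-1 : ℤ) := by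
    have : (c : ℚ_[p]) = p ∨ (c : ℚ_[p]) = -p := by
      rcases Int.natAbs_eq c with h | h
      · left; rw [h, hc]; simp
      · right; rw [h, hc]; simp
    rcases this with h | h <;> rw [h] <;> simp
  by_cases hB : B = 0
  · subst hB
    simp only [ne_eq, OfNat.ofNat_ne_zero, not_false_eq_true, zero_pow, mul_zero, sub_zero] at h
    refine ⟨?_, by simp⟩
    have : ‖A‖ ^ 2 = 1 := by rw [← norm_pow, h, hν]
    nlinarith [norm_nonneg A]
  · have nB : ‖-(c * B ^ 2)‖ = (p : ℝ) ^ (-1 - 2 * B.valuation) := by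
      rw [norm_neg, norm_mul, norm_pow, hcn, Padic.norm_eq_zpow_neg_valuation hB, ← zpow_natCast, ← zpow_mul, ← zpow_add₀ hp0]
      congr 1; push_cast; ring
    by_cases hA : A = 0
    · subst hA
      exfalso
      have h1 : -(c * B ^ 2) = ν := by rw [← h]; ring
      rw [h1, hν, ← zpow_zero (p : ℝ)] at nB
      have := zpow_right_injective₀ (by positivity) hp1.ne' nB
      omega
    · have nA : ‖A ^ 2‖ = (p : ℝ) ^ (- 2 * A.valuation) := by
        rw [norm_pow, Padic.norm_eq_zpow_neg_valuation hA, ← zpow_natCast, ← zpow_mul]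
        congr 1; push_cast; ring
      have hne : ‖A ^ 2‖ ≠ ‖-(c * B ^ 2)‖ := by
        rw [nA, nB]
        intro h
        have := zpow_right_injective₀ (by positivity) hp1.ne' h
        omega
      have hm := Padic.add_eq_max_of_ne hne
      rw [← sub_eq_add_neg, h, hν] at hm
      have m1 : ‖A ^ 2‖ ≤ 1 := hm ▸ le_max_left _ _
      have m2 : ‖-(c * B ^ 2)‖ ≤ 1 := hm ▸ le_max_right _ _
      constructor
      · rw [norm_pow] at m1
        nlinarith [norm_nonneg A]
      · rw [nB, ← zpow_zero (p : ℝ), zpow_le_zpow_iff_right₀ hp1] at m2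
        rw [Padic.norm_eq_zpow_neg_valuation hB, ← zpow_zero (p : ℝ), zpow_le_zpow_iff_right₀ hp1]
        omega

lemma disc_eq (d : ℤ) : tr d ^ 2 - 4 * nm d = if d % 4 = 1 then d else 4 * d := by
  unfold tr nm
  split_ifs <;> omega

lemma hensel_sqrt {p : ℕ} [Fact p.Prime] {d : ℤ} (h : splitb p d = true) : ∃ r : ℚ_[p], r ^ 2 = d := by
  obtain ⟨n, h1, h2⟩ := split_of h
  let f : Polynomial ℤ_[p] := Polynomial.X ^ 2 + Polynomial.C (tr d : ℤ_[p]) * Polynomial.X + Polynomial.C (nm d : ℤ_[p])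
  have e1 : ∀ z : ℤ_[p], f.aeval z = z ^ 2 + tr d * z + nm d := by intro z; simp [f]
  have e2 : ∀ z : ℤ_[p], f.derivative.aeval z = 2 * z + tr d := by intro z; simp [f, one_add_one_eq_two]
  have n1 : ‖f.aeval (n : ℤ_[p])‖ < 1 := by
    rw [e1]
    have := (PadicInt.norm_int_lt_one_iff_dvd (p := p) (n ^ 2 + tr d * n + nm d)).mpr h1
    push_cast at this; exact this
  have n2 : ‖f.derivative.aeval (n : ℤ_[p])‖ = 1 := by
    rw [e2]
    have := (PadicInt.norm_int_lt_one_iff_dvd (p := p) (2 * n + tr d)).not.mpr h2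
    push_cast at this
    exact le_antisymm (PadicInt.norm_le_one _) (not_lt.mp this)
  obtain ⟨z, hz, -⟩ := hensels_lemma (F := f) (a := (n : ℤ_[p])) (by rw [n2]; simpa using n1)
  rw [e1] at hz
  have hz' : (2 * (z : ℚ_[p]) + tr d) ^ 2 = ((tr d ^ 2 - 4 * nm d : ℤ) : ℚ_[p]) := by
    have := congrArg (fun z : ℤ_[p] => (z : ℚ_[p])) hz
    push_cast at this ⊢
    linear_combination 4 * this
  rw [disc_eq] at hz'
  split_ifs at hz' with h4
  · exact ⟨_, hz'⟩
  · refine ⟨(2 * (z : ℚ_[p]) + tr d) / 2, ?_⟩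
    rw [div_pow, hz']; push_cast; ring

lemma local_contra {p : ℕ} [Fact p.Prime] {c : ℤ} (hc : c.natAbs = p) {A B ν : ℚ_[p]} (h : A ^ 2 - c * B ^ 2 = ν) 
    (hν : (ν = -1 ∧ (c = -2 ∨ p % 4 = 3)) ∨ (ν ^ 2 = -1 ∧ ∀ z : ZMod p, z ^ 4 ≠ -1)) : False := by
  have n1 : ‖ν‖ = 1 := by
    rcases hν with ⟨h, -⟩ | ⟨h, -⟩
    · rw [h]; simp
    · have : ‖ν‖ ^ 2 = 1 := by rw [← norm_pow, h]; simp
      nlinarith [norm_nonneg ν]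
  obtain ⟨hA, hB⟩ := local_int hc h n1
  obtain ⟨a, rfl⟩ : ∃ a : ℤ_[p], (a : ℚ_[p]) = A := ⟨⟨A, hA⟩, rfl⟩
  obtain ⟨b, rfl⟩ : ∃ a : ℤ_[p], (a : ℚ_[p]) = B := ⟨⟨B, hB⟩, rfl⟩
  obtain ⟨v, rfl⟩ : ∃ a : ℤ_[p], (a : ℚ_[p]) = ν := ⟨⟨ν, n1.le⟩, rfl⟩
  have h' : a ^ 2 - c * b ^ 2 = v := Subtype.ext (by push_cast; exact h)
  have hcp : (c : ZMod p) = 0 := by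
    rw [ZMod.intCast_zmod_eq_zero_iff_dvd]
    exact Int.natCast_dvd.mpr (by rw [hc])
  have h2 := congrArg PadicInt.toZMod h'
  rw [map_sub, map_mul, map_intCast, hcp, zero_mul, sub_zero, map_pow] at h2
  rcases hν with ⟨hv, hc2 | hp⟩ | ⟨hv, hp⟩
  · have : p = 2 := by rw [← hc, hc2]; rfl
    subst this
    have hv' : v = -1 := Subtype.ext (by push_cast; exact hv)
    rw [hv', hc2] at h'
    have h3 := congrArg (PadicInt.toZModPow 3) h'
    simp only [map_sub, map_mul, map_intCast, map_pow, map_neg, map_one] at h3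
    have key : ∀ x y : ZMod (2 ^ 3), x ^ 2 - ((-2 : ℤ) : ZMod (2 ^ 3)) * y ^ 2 ≠ -1 := by decide
    exact key _ _ h3
  · have hv' : v = -1 := Subtype.ext (by push_cast; exact hv)
    rw [hv', map_neg, map_one] at h2
    exact ZMod.mod_four_ne_three_of_sq_eq_neg_one h2 hp
  · have hv' : v ^ 2 = -1 := Subtype.ext (by push_cast; exact hv)
    apply hp (PadicInt.toZMod a)
    rw [show (4 : ℕ) = 2 * 2 from rfl, pow_mul, h2, ← map_pow, hv', map_neg, map_one]

section
variable {K : Type*} [Field K] [NumberField K]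

lemma non_norm {d : Fin 3 → ℤ} (m : MQ 3 K d) (hpr : (d 2).natAbs.Prime) (hsp : splitb (d 2).natAbs (d 0) = true)
    (η : K) (p q : ℤ) (hη : η * m.g 1 η = p + q * m.x 0)
    (hν : (p = -1 ∧ q = 0 ∧ (d 2 = -2 ∨ (d 2).natAbs % 4 = 3)) ∨ (p = 0 ∧ (q = 1 ∨ q = -1) ∧ d 0 = -1 ∧ ∀ z : ZMod (d 2).natAbs, z ^ 4 ≠ -1)) : ¬ IsN (m.g 2) η := by
  rintro ⟨a, ha⟩
  have : Fact (d 2).natAbs.Prime := ⟨hpr⟩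
  set b := a * m.g 1 a with hb
  have hb1 : m.g 1 b = b := by rw [hb, map_mul, m.aut_aut, mul_comm]
  have hb2 : b * m.g 2 b = p + q * m.x 0 := by
    rw [← hη, ← ha, hb, map_mul, map_mul, m.aut_aut_comm (m.g 1) (m.g 2)]; ring
  have hw := m.x_ne 2
  obtain ⟨x0, x1, hx⟩ := m.coord 0 ((b + m.g 2 b) / 2) (fun i hi => by
    rw [map_div₀, map_ofNat, map_add]
    fin_cases i
    · exact absurd rfl hi
    · simp only [Fin.mk_one, Fin.isValue]
      rw [m.aut_aut_comm (m.g 1), hb1]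
    · simp only [Fin.reduceFinMk]
      rw [m.aut_aut, add_comm])
  obtain ⟨y0, y1, hy⟩ := m.coord 0 ((b - m.g 2 b) / 2 / m.x 2) (fun i hi => by
    rw [map_div₀, map_div₀, map_ofNat, map_sub]
    fin_cases i
    · exact absurd rfl hi
    · simp only [Fin.mk_one, Fin.isValue]
      rw [m.aut_aut_comm (m.g 1), hb1, m.hg' _ _ (by decide)]
    · simp only [Fin.reduceFinMk]
      rw [m.aut_aut, m.hg]; field_simp; ring)
  have hs := m.hx 0
  have hw2 := m.hx 2
  have e1 : (x0 + x1 * m.x 0) ^ 2 - d 2 * (y0 + y1 * m.x 0) ^ 2 = p + q * m.x 0 := by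
    rw [← hx, ← hy, ← hb2, ← hw2]; field_simp; ring
  have e2 : ((x0 ^ 2 + d 0 * x1 ^ 2 - d 2 * (y0 ^ 2 + d 0 * y1 ^ 2) - p : ℚ) : K) + ((2 * x0 * x1 - 2 * d 2 * y0 * y1 - q : ℚ) : K) * m.x 0 = 0 := by
    push_cast
    linear_combination e1 - (x1 ^ 2 - d 2 * y1 ^ 2) * hs
  set P : ℚ := x0 ^ 2 + d 0 * x1 ^ 2 - d 2 * (y0 ^ 2 + d 0 * y1 ^ 2) - p with hP
  set Q : ℚ := 2 * x0 * x1 - 2 * d 2 * y0 * y1 - q with hQ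
  have e3 : (P : K) - (Q : K) * m.x 0 = 0 := by
    have := congrArg (m.g 0) e2
    rw [map_add, map_mul, map_ratCast, map_ratCast, m.hg, map_zero] at this
    linear_combination this
  have hP0 : P = 0 := by
    have : (P : K) = 0 := by linear_combination (e2 + e3) / 2
    exact_mod_cast this
  have hQ0 : Q = 0 := by
    have : (Q : K) * m.x 0 = 0 := by linear_combination (e2 - e3) / 2
    have := (mul_eq_zero.mp this).resolve_right (m.x_ne 0)
    exact_mod_cast this
  obtain ⟨r, hr⟩ := hensel_sqrt hsp
  have hP1 : (P : ℚ_[(d 2).natAbs]) = 0 := by rw [hP0]; simp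
  have hQ1 : (Q : ℚ_[(d 2).natAbs]) = 0 := by rw [hQ0]; simp
  rw [hP] at hP1
  rw [hQ] at hQ1
  push_cast at hP1 hQ1
  refine local_contra (p := (d 2).natAbs) rfl (A := x0 + x1 * r) (B := y0 + y1 * r) (ν := p + q * r) ?_ ?_
  · linear_combination hP1 + r * hQ1 + (x1 ^ 2 - d 2 * y1 ^ 2) * hr
  · rcases hν with ⟨rfl, rfl, h⟩ | ⟨rfl, h, h0, h4⟩
    · left; exact ⟨by simp, h⟩
    · right
      refine ⟨?_, h4⟩
      rw [h0] at hr
      push_cast at hr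
      rcases h with rfl | rfl
      · push_cast; linear_combination hr
      · push_cast; linear_combination hr

lemma K_odd {d : Fin 3 → ℤ} (m : MQ 3 K d) (h0 : d 0 < 0) (hd : PD (d 2)) (hd1 : d 2 ≠ -1) (hk : OddClass (FF (m.g 2)))
    (hM : OddClass (FF (m.g 1))) (hin : inertb (ell (d 2)) (d 1) = true) (hsp : splitb (d 2).natAbs (d 0) = true)
    (u : (𝓞 K)ˣ) (hg : ∀ z, m.g 2 z = z → z ^ 2 ≠ ((u : 𝓞 K) : K) * m.g 2 ((u : 𝓞 K) : K))
    (η : (𝓞 K)ˣ) (hηf : m.g 2 ((η : 𝓞 K) : K) = ((η : 𝓞 K) : K)) (p q : ℤ)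
    (hη : ((η : 𝓞 K) : K) * m.g 1 ((η : 𝓞 K) : K) = p + q * m.x 0)
    (hν : (p = -1 ∧ q = 0 ∧ (d 2 = -2 ∨ (d 2).natAbs % 4 = 3)) ∨ (p = 0 ∧ (q = 1 ∨ q = -1) ∧ d 0 = -1 ∧ ∀ z : ZMod (d 2).natAbs, z ^ 4 ≠ -1)) :
    OddClass K := by
  have hell : ell (d 2) = (d 2).natAbs := by rw [ell, if_neg hd1]
  refine tri_odd m hd hd1 hk hM hin (by rw [hell]; exact hsp) ?_
  apply U1 (m.g 2) (m.aut_aut _) _ u hg η hηf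
  · exact non_norm m (hell ▸ hd.ell_prime) hsp _ p q hη hν
  · refine rank_im (d := d 0) (by exact_mod_cast h0) ((m.res 2).x 0) ?_ (by rw [(m.res 2).hF]; rfl)
    rw [(m.res 2).hx]; norm_cast
end
end Quin

namespace Quin

/-- boolean primality -/
def prb (n : ℕ) : Bool := decide (2 ≤ n) && (List.range n).all fun k => decide (k < 2) || n % k != 0
lemma prb_prime {n : ℕ} (h : prb n = true) : n.Prime := by
  rw [prb, Bool.and_eq_true, decide_eq_true_eq, List.all_eq_true] at h
  rw [Nat.prime_def_lt]
  refine ⟨h.1, fun k hk hd => ?_⟩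
  have := h.2 k (List.mem_range.mpr hk)
  rw [Bool.or_eq_true, decide_eq_true_eq, bne_iff_ne] at this
  rcases this with h2 | h2
  · have : k ≠ 0 := by rintro rfl; rw [zero_dvd_iff] at hd; omega
    omega
  · exact absurd (Nat.mod_eq_zero_of_dvd hd) h2
def pdb (d : ℤ) : Bool := d == -1 || d == 2 || d == -2 || (prb d.natAbs && d % 4 == 1)
lemma pdb_PD {d : ℤ} (h : pdb d = true) : PD d := by
  simp only [pdb, Bool.or_eq_true, Bool.and_eq_true, beq_iff_eq] at h
  rcases h with ((h | h) | h) | ⟨h, h2⟩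
  · exact Or.inl h
  · exact Or.inr (Or.inl h)
  · exact Or.inr (Or.inr (Or.inl h))
  · exact Or.inr (Or.inr (Or.inr ⟨prb_prime h, h2⟩))

section
variable {K : Type*} [Field K] [NumberField K]

lemma lift_unit (σ : K ≃ₐ[ℚ] K) (η : (𝓞 (FF σ))ˣ) : ∃ η' : (𝓞 K)ˣ, ((η' : 𝓞 K) : K) = (((η : 𝓞 (FF σ)) : FF σ) : K) :=
  ⟨Units.map (algebraMap (𝓞 (FF σ)) (𝓞 K)).toMonoidHom η, rfl⟩

lemma biq_odd8 {d : Fin 2 → ℤ} (m : MQ 2 K d) (i : Fin 2) (hd : PD (d i)) (hell : ell (d i) = 2) (hk : OddClass (FF (m.g i)))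
    {z : K} (hz : z ^ 4 = -1)
    (hU : ∀ v : (𝓞 K)ˣ, IsN (m.g i) ((v : 𝓞 K) : K) → IsNU (m.g i) ((v : 𝓞 K) : K)) : OddClass K := by
  obtain ⟨θ, h1, h2, h3⟩ := m.th i
  refine step (m.g i) (m.aut_aut _) (m.x i) (m.x_ne i) (m.hg i) hk hU θ ?_
  intro P hP hP0 h
  rw [h3] at h
  obtain ⟨u, c, hu, hc, hl⟩ := m.lam_sq i
  have hm := m.lam_mem i hd P hP h
  have hz' : IsIntegral ℤ z := IsIntegral.of_pow (n := 4) (by norm_num) (by rw [hz]; exact isIntegral_one.neg)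
  obtain ⟨ζ, hζ⟩ : ∃ ζ : 𝓞 K, ζ ^ 4 = -1 := ⟨⟨z, hz'⟩, by apply RingOfIntegers.ext; push_cast; exact hz⟩
  have hv : (-2 * ζ + 3 * ζ ^ 2 - 2 * ζ ^ 3) * (-2 * ζ - 3 * ζ ^ 2 - 2 * ζ ^ 3) = 1 := by
    linear_combination (4 * ζ ^ 2 - 1) * hζ
  have h4 : (1 - ζ) ^ 4 = ((2 : ℤ) : 𝓞 K) * (-2 * ζ + 3 * ζ ^ 2 - 2 * ζ ^ 3) := by
    push_cast; linear_combination hζ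
  have hv' : IsUnit (-2 * ζ + 3 * ζ ^ 2 - 2 * ζ ^ 3) := IsUnit.of_mul_eq_one _ hv
  have hsp : Ideal.span {1 - ζ} ^ 4 = Ideal.span {((2 : ℤ) : 𝓞 K)} := by
    rw [Ideal.span_singleton_pow, h4, Ideal.span_singleton_mul_right_unit hv']
  have hN : Ideal.absNorm (Ideal.span {1 - ζ}) = 2 := by
    have h5 := congrArg Ideal.absNorm hsp
    rw [map_pow, absNorm_int, m.hF] at h5
    exact Nat.pow_left_injective (n := 4) (by norm_num) h5
  have hcP : (c : 𝓞 K) ∈ P := by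
    have h6 : u * (c : 𝓞 K) ∈ P := by rw [← hl]; exact P.mul_mem_left _ hm
    exact (hP.mem_or_mem h6).resolve_left fun h7 => hP.ne_top (Ideal.eq_top_of_isUnit_mem _ h7 hu)
  have h2P : ((2 : ℤ) : 𝓞 K) ∈ P := by
    rw [hell] at hc
    have : c = 2 ∨ c = -2 := by omega
    rcases this with rfl | rfl
    · exact hcP
    · have := P.neg_mem hcP; push_cast at this ⊢; simpa using this
  refine odd_of_principal (T1' hP.ne_top Nat.prime_two ?_ hN)
  apply hP.mem_of_pow_mem 4
  rw [h4]
  exact P.mul_mem_right _ h2P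

lemma k_odd8 {d : Fin 2 → ℤ} (m : MQ 2 K d) (i j : Fin 2) (hij : i ≠ j) (hi : PD (d i)) (hj : PD (d j)) (hj0 : d j < 0)
    (hell : ell (d i) = 2) {z : K} (hz : z ^ 4 = -1) (η : (𝓞 K)ˣ)
    (hg : ∀ z, m.g i z = z → z ^ 2 ≠ ((η : 𝓞 K) : K) * m.g i ((η : 𝓞 K) : K)) : OddClass K := by
  have hs : i.succAbove 0 = j := by fin_cases i <;> fin_cases j <;> first | rfl | exact absurd rfl hij
  have hj' : d (i.succAbove 0) = d j := by rw [hs]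
  refine biq_odd8 m i hi hell (q_odd (m.res i) (by rw [hj']; exact hj) (Or.inl (by rw [hj']; exact hj0))) hz ?_
  apply U0 (m.g i) (m.aut_aut _) _ η hg
  refine rank_im (d := d j) (by exact_mod_cast hj0) ((m.res i).x 0) ?_ (by rw [(m.res i).hF]; rfl)
  rw [(m.res i).hx, hj']; norm_cast

/-- the conditions common to the first family -/
def Base (a b c : ℤ) : Prop := a < 0 ∧ c < 0 ∧ pdb a = true ∧ pdb b = true ∧ pdb c = true ∧ c ≠ -1 ∧
  inertb (ell c) b = true ∧ splitb c.natAbs a = true ∧ (inertb (ell b) a = true ∨ (a = -2 ∧ b = -1)) ∧ inertb (ell a) c = true ∧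
  (c = -2 ∨ c.natAbs % 4 = 3) ∧ NS ![a, b] 1 (-1) ∧ NS ![a, c] 0 (-1)
instance (a b c : ℤ) : Decidable (Base a b c) := by unfold Base; infer_instance

lemma res2_eq (a b c : ℤ) : (fun j => (![a, b, c] : Fin 3 → ℤ) ((2 : Fin 3).succAbove j)) = ![a, b] := by
  ext j; fin_cases j <;> rfl
lemma res1_eq (a b c : ℤ) : (fun j => (![a, b, c] : Fin 3 → ℤ) ((1 : Fin 3).succAbove j)) = ![a, c] := by
  ext j; fin_cases j <;> rfl

lemma base_odd {a b c : ℤ} (m : MQ 3 K ![a, b, c]) (hB : Base a b c)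
    (hk : ∃ η : (𝓞 (FF (m.g 2)))ˣ, ((η : 𝓞 (FF (m.g 2))) : FF (m.g 2)) * (m.res 2).g 1 ((η : 𝓞 (FF (m.g 2))) : FF (m.g 2)) = -1)
    (hM : ∃ η : (𝓞 (FF (m.g 1)))ˣ, ((η : 𝓞 (FF (m.g 1))) : FF (m.g 1)) * (m.res 1).g 0 ((η : 𝓞 (FF (m.g 1))) : FF (m.g 1)) = -1)
    (hu : ∃ u : (𝓞 K)ˣ, ∀ z, m.g 2 z = z → z ^ 2 ≠ ((u : 𝓞 K) : K) * m.g 2 ((u : 𝓞 K) : K)) : OddClass K := by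
  obtain ⟨ha, hc, pa, pb, pc, c1, i1, s1, i2, i3, h4, n1, n2⟩ := hB
  obtain ⟨u, hu⟩ := hu
  obtain ⟨η, hη⟩ := hk
  obtain ⟨e, he⟩ := hM
  obtain ⟨η', hη'⟩ := lift_unit _ η
  refine K_odd m ha (pdb_PD pc) c1 ?_ ?_ i1 s1 u hu η' ?_ (-1) 0 ?_ (Or.inl ⟨rfl, rfl, h4⟩)
  · have key : ∀ z, (m.res 2).g 1 z = z → z ^ 2 ≠ ((η : 𝓞 (FF (m.g 2))) : FF (m.g 2)) * (m.res 2).g 1 ((η : 𝓞 (FF (m.g 2))) : FF (m.g 2)) := by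
      rw [hη]
      intro z hz
      have := (m.res 2).ns (i := 1) (D := -1) (by rw [res2_eq]; exact n1) (by norm_num) z hz
      push_cast at this; exact this
    rcases i2 with i2 | ⟨rfl, rfl⟩
    · exact k_odd (m.res 2) 1 0 (by decide) (pdb_PD pb) (pdb_PD pa) ha i2 η key
    · have hs : (m.res 2).x 0 ^ 2 = (-2 : FF (m.g 2)) := by
        rw [(m.res 2).hx 0]; change ((-2 : ℤ) : FF (m.g 2)) = -2; simp
      have ht : (m.res 2).x 1 ^ 2 = (-1 : FF (m.g 2)) := by
        rw [(m.res 2).hx 1]; change ((-1 : ℤ) : FF (m.g 2)) = -1; simp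
      refine k_odd8 (m.res 2) 1 0 (by decide) (pdb_PD pb) (pdb_PD pa) ha rfl (z := (m.res 2).x 0 * (1 - (m.res 2).x 1) / 2) ?_ η key
      have h5 : ((m.res 2).x 0 * (1 - (m.res 2).x 1) / 2) ^ 2 = (m.res 2).x 1 := by
        linear_combination (1 - (m.res 2).x 1) ^ 2 / 4 * hs - 1 / 2 * ht
      rw [show (4 : ℕ) = 2 * 2 from rfl, pow_mul, h5, ht]
  · refine k_odd (m.res 1) 0 1 (by decide) (pdb_PD pa) (pdb_PD pc) hc i3 e ?_
    rw [he]
    intro z hz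
    have := (m.res 1).ns (i := 0) (D := -1) (by rw [res1_eq]; exact n2) (by norm_num) z hz
    push_cast at this; exact this
  · rw [hη']; exact mem_FF.mp ((η : 𝓞 (FF (m.g 2))) : FF (m.g 2)).2
  · rw [hη']
    have h1 := m.res_g 2 1 ((η : 𝓞 (FF (m.g 2))) : FF (m.g 2))
    have h2 : (2 : Fin 3).succAbove 1 = 1 := rfl
    rw [h2] at h1
    rw [← h1]
    have h3 := congrArg (fun y : FF (m.g 2) => (y : K)) hη
    push_cast at h3
    rw [h3]; simp

lemma unit1 {n : ℕ} {d : Fin n → ℤ} (m : MQ n K d) (i j : Fin n) (hij : i ≠ j) {X Y : ℤ} (h : d j * X ^ 2 - d i * Y ^ 2 = -4) :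
    ∃ u : (𝓞 K)ˣ, ((u : 𝓞 K) : K) * m.g i ((u : 𝓞 K) : K) = -1 := by
  obtain ⟨u, -, hu⟩ := mk1 (m.g i) (A := (X : K) * m.x j) (B := (Y : K) * m.x i) ((isIntegral_algebraMap (R := ℤ) (x := X)).mul (m.isInt j))
    (by rw [map_mul, map_intCast, m.hg' _ _ hij]) (by rw [map_mul, map_intCast, m.hg]; ring) (by
      have h' : ((d j * X ^ 2 - d i * Y ^ 2 : ℤ) : K) = ((-4 : ℤ) : K) := by rw [h]
      push_cast at h'
      rw [mul_pow, mul_pow, m.hx, m.hx]; linear_combination h')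
  exact ⟨u, hu⟩

lemma unit0 {n : ℕ} {d : Fin n → ℤ} (m : MQ n K d) (i : Fin n) {X Y : ℤ} (h : X ^ 2 - d i * Y ^ 2 = -4) :
    ∃ u : (𝓞 K)ˣ, ((u : 𝓞 K) : K) * m.g i ((u : 𝓞 K) : K) = -1 := by
  obtain ⟨u, -, hu⟩ := mk1 (m.g i) (A := (X : K)) (B := (Y : K) * m.x i) (isIntegral_algebraMap (R := ℤ) (x := X))
    (map_intCast _ _) (by rw [map_mul, map_intCast, m.hg]; ring) (by
      have h' : ((X ^ 2 - d i * Y ^ 2 : ℤ) : K) = ((-4 : ℤ) : K) := by rw [h]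
      push_cast at h'
      rw [mul_pow, m.hx]; linear_combination h')
  exact ⟨u, hu⟩

lemma unit2 {n : ℕ} {d : Fin n → ℤ} (m : MQ n K d) (i j k : Fin n) (hij : i ≠ j) (hik : i ≠ k) {X Y : ℤ} (h : d j * X ^ 2 - d k * d i * Y ^ 2 = -4) :
    ∃ u : (𝓞 K)ˣ, ((u : 𝓞 K) : K) * m.g i ((u : 𝓞 K) : K) = -1 := by
  obtain ⟨u, -, hu⟩ := mk1 (m.g i) (A := (X : K) * m.x j) (B := (Y : K) * m.x k * m.x i) ((isIntegral_algebraMap (R := ℤ) (x := X)).mul (m.isInt j))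
    (by rw [map_mul, map_intCast, m.hg' _ _ hij]) (by rw [map_mul, map_mul, map_intCast, m.hg, m.hg' _ _ hik]; ring) (by
      have h' : ((d j * X ^ 2 - d k * d i * Y ^ 2 : ℤ) : K) = ((-4 : ℤ) : K) := by rw [h]
      push_cast at h'
      rw [mul_pow, mul_pow, mul_pow, m.hx, m.hx, m.hx]; linear_combination h')
  exact ⟨u, hu⟩

def Chk1a (a b c X1 Y1 X2 Y2 X3 Y3 : ℤ) : Prop := Base a b c ∧ NS ![a, b, c] 2 (-1) ∧
  a * X1 ^ 2 - b * Y1 ^ 2 = -4 ∧ b * X2 ^ 2 - c * Y2 ^ 2 = -4 ∧ c * X3 ^ 2 - a * Y3 ^ 2 = -4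
instance (a b c X1 Y1 X2 Y2 X3 Y3 : ℤ) : Decidable (Chk1a a b c X1 Y1 X2 Y2 X3 Y3) := by unfold Chk1a; infer_instance

lemma neg_one_of {d : Fin 3 → ℤ} (m : MQ 3 K d) (hn : NS d 2 (-1)) (h : ∃ u : (𝓞 K)ˣ, ((u : 𝓞 K) : K) * m.g 2 ((u : 𝓞 K) : K) = -1) :
    ∃ u : (𝓞 K)ˣ, ∀ z, m.g 2 z = z → z ^ 2 ≠ ((u : 𝓞 K) : K) * m.g 2 ((u : 𝓞 K) : K) := by
  obtain ⟨u, hu⟩ := h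
  refine ⟨u, fun z hz => ?_⟩
  rw [hu]
  have := m.ns (i := 2) (D := -1) hn (by norm_num) z hz
  push_cast at this; exact this

lemma chk1a {a b c X1 Y1 X2 Y2 X3 Y3 : ℤ} (m : MQ 3 K ![a, b, c]) (h : Chk1a a b c X1 Y1 X2 Y2 X3 Y3) : OddClass K := by
  obtain ⟨hB, hn, h1, h2, h3⟩ := h
  exact base_odd m hB (unit1 (m.res 2) 1 0 (by decide) h1) (unit1 (m.res 1) 0 1 (by decide) h3)
    (neg_one_of m hn (unit1 m 2 1 (by decide) h2))

def Chk1b (a b c X1 Y1 X2 Y2 X3 Y3 : ℤ) : Prop := Base a b c ∧ NS ![a, b, c] 2 (-1) ∧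
  X1 ^ 2 - b * Y1 ^ 2 = -4 ∧ b * X2 ^ 2 - a * c * Y2 ^ 2 = -4 ∧ c * X3 ^ 2 - a * Y3 ^ 2 = -4
instance (a b c X1 Y1 X2 Y2 X3 Y3 : ℤ) : Decidable (Chk1b a b c X1 Y1 X2 Y2 X3 Y3) := by unfold Chk1b; infer_instance

lemma chk1b {a b c X1 Y1 X2 Y2 X3 Y3 : ℤ} (m : MQ 3 K ![a, b, c]) (h : Chk1b a b c X1 Y1 X2 Y2 X3 Y3) : OddClass K := by
  obtain ⟨hB, hn, h1, h2, h3⟩ := h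
  exact base_odd m hB (unit0 (m.res 2) 1 h1) (unit1 (m.res 1) 0 1 (by decide) h3)
    (neg_one_of m hn (unit2 m 2 1 0 (by decide) (by decide) h2))

lemma of_ns8 {d : Fin 3 → ℤ} (m : MQ 3 K d) (hn : NS d 2 2) {I : K} (hI : I ^ 2 = -1) {e : ℤ} (he : e = 1 ∨ e = -1)
    (h : ∃ u : (𝓞 K)ˣ, ((u : 𝓞 K) : K) * m.g 2 ((u : 𝓞 K) : K) = ((-e : ℤ) : K) * I) :
    ∃ u : (𝓞 K)ˣ, ∀ z, m.g 2 z = z → z ^ 2 ≠ ((u : 𝓞 K) : K) * m.g 2 ((u : 𝓞 K) : K) := by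
  obtain ⟨u, hu⟩ := h
  refine ⟨u, fun z hz h2 => ?_⟩
  apply m.ns8 hn z hz
  rw [show (4 : ℕ) = 2 * 2 from rfl, pow_mul, h2, hu, mul_pow, hI]
  rcases he with rfl | rfl <;> norm_num

def Chk2 (a c X1 Y1 X2 Y2 X3 Y3 e : ℤ) : Prop := Base a (-1) c ∧ NS ![a, -1, c] 2 2 ∧
  X1 ^ 2 + a * Y1 ^ 2 = -2 ∧ (e = 1 ∨ e = -1) ∧ X2 ^ 2 + c * Y2 ^ 2 = 2 * e ∧ c * X3 ^ 2 - a * Y3 ^ 2 = -4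
instance (a c X1 Y1 X2 Y2 X3 Y3 e : ℤ) : Decidable (Chk2 a c X1 Y1 X2 Y2 X3 Y3 e) := by unfold Chk2; infer_instance

lemma chk2 {a c X1 Y1 X2 Y2 X3 Y3 e : ℤ} (m : MQ 3 K ![a, -1, c]) (h : Chk2 a c X1 Y1 X2 Y2 X3 Y3 e) : OddClass K := by
  obtain ⟨hB, hn, h1, he, h2, h3⟩ := h
  have ht : m.x 1 ^ 2 = -1 := by rw [m.hx]; simp
  have hw : m.x 2 ^ 2 = (c : K) := m.hx 2
  refine base_odd m hB ?_ (unit1 (m.res 1) 0 1 (by decide) h3) (of_ns8 m hn ht he ?_)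
  · obtain ⟨u, -, hu⟩ := mk3 ((m.res 2).g 1) (A := (X1 : FF (m.g 2))) (B := (Y1 : FF (m.g 2)) * (m.res 2).x 0) (I := (m.res 2).x 1)
      (isIntegral_algebraMap (R := ℤ) (x := X1)) ((isIntegral_algebraMap (R := ℤ) (x := Y1)).mul ((m.res 2).isInt 0)) (map_intCast _ _)
      (by rw [map_mul, map_intCast, (m.res 2).hg' _ _ (by decide)])
      (by rw [(m.res 2).hx]; change (((-1 : ℤ) : ℤ) : FF (m.g 2)) = -1; simp) ((m.res 2).hg 1) (by
        have hs : (m.res 2).x 0 ^ 2 = (a : FF (m.g 2)) := (m.res 2).hx 0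
        have h' : ((X1 ^ 2 + a * Y1 ^ 2 : ℤ) : FF (m.g 2)) = ((-2 : ℤ) : FF (m.g 2)) := by rw [h1]
        push_cast at h'
        rw [mul_pow, hs]; linear_combination h')
    exact ⟨u, hu⟩
  · refine mk2 (m.g 2) (A := (X2 : K)) (B := (Y2 : K) * m.x 1 * m.x 2) (isIntegral_algebraMap (R := ℤ) (x := X2)) (map_intCast _ _)
      (by rw [map_mul, map_mul, map_intCast, m.hg, m.hg' _ _ (by decide)]; ring) ht (m.hg' _ _ (by decide)) he ?_
    have h' : ((X2 ^ 2 + c * Y2 ^ 2 : ℤ) : K) = ((2 * e : ℤ) : K) := by rw [h2]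
    push_cast at h'
    rw [mul_pow, mul_pow, hw, ht]; linear_combination h'

/-- fields containing i at the bottom -/
def Base3 (b c X1 Y1 e1 X3 Y3 : ℤ) : Prop := 0 < c ∧ pdb b = true ∧ pdb c = true ∧
  inertb (ell c) b = true ∧ splitb c.natAbs (-1) = true ∧ (inertb (ell b) (-1) = true ∨ b = 2) ∧ inertb 2 c = true ∧
  (∀ z : ZMod c.natAbs, z ^ 4 ≠ -1) ∧ NS ![-1, b] 1 2 ∧ (e1 = 1 ∨ e1 = -1) ∧ X1 ^ 2 + b * Y1 ^ 2 = 2 * e1 ∧ X3 ^ 2 - c * Y3 ^ 2 = -4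

lemma base3_odd {b c X1 Y1 e1 X3 Y3 : ℤ} (m : MQ 3 K ![-1, b, c]) (hB : Base3 b c X1 Y1 e1 X3 Y3)
    (hu : ∃ u : (𝓞 K)ˣ, ∀ z, m.g 2 z = z → z ^ 2 ≠ ((u : 𝓞 K) : K) * m.g 2 ((u : 𝓞 K) : K)) : OddClass K := by
  obtain ⟨hc, pb, pc, i1, s1, i2, i3, h4, n1, he, h1, h3⟩ := hB
  obtain ⟨u, hu⟩ := hu
  have hs : (m.res 2).x 0 ^ 2 = (-1 : FF (m.g 2)) := by
    rw [(m.res 2).hx 0]; change ((-1 : ℤ) : FF (m.g 2)) = -1; simp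
  have ht : (m.res 2).x 1 ^ 2 = (b : FF (m.g 2)) := (m.res 2).hx 1
  obtain ⟨η, hη⟩ := mk2 ((m.res 2).g 1) (A := (X1 : FF (m.g 2))) (B := (Y1 : FF (m.g 2)) * (m.res 2).x 0 * (m.res 2).x 1)
    (isIntegral_algebraMap (R := ℤ) (x := X1)) (map_intCast _ _)
    (by rw [map_mul, map_mul, map_intCast, (m.res 2).hg, (m.res 2).hg' _ _ (by decide)]; ring) hs ((m.res 2).hg' _ _ (by decide)) he (by
      have h' : ((X1 ^ 2 + b * Y1 ^ 2 : ℤ) : FF (m.g 2)) = ((2 * e1 : ℤ) : FF (m.g 2)) := by rw [h1]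
      push_cast at h'
      rw [mul_pow, mul_pow, hs, ht]; linear_combination h')
  obtain ⟨η', hη'⟩ := lift_unit _ η
  have pa : PD (-1) := Or.inl rfl
  refine K_odd m (by change (-1:ℤ) < 0; norm_num) (pdb_PD pc) (by change c ≠ -1; omega) ?_ ?_ i1 s1 u hu η' ?_ 0 (-e1) ?_ (Or.inr ⟨rfl, by omega, rfl, h4⟩)
  · have key : ∀ z, (m.res 2).g 1 z = z → z ^ 2 ≠ ((η : 𝓞 (FF (m.g 2))) : FF (m.g 2)) * (m.res 2).g 1 ((η : 𝓞 (FF (m.g 2))) : FF (m.g 2)) := by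
      rw [hη]
      intro z hz h2
      apply (m.res 2).ns8 (i := 1) (by rw [res2_eq]; exact n1) z hz
      rw [show (4 : ℕ) = 2 * 2 from rfl, pow_mul, h2, mul_pow, hs]
      rcases he with rfl | rfl <;> norm_num
    rcases i2 with i2 | rfl
    · exact k_odd (m.res 2) 1 0 (by decide) (pdb_PD pb) pa (by change (-1:ℤ) < 0; norm_num) i2 η key
    · refine k_odd8 (m.res 2) 1 0 (by decide) (pdb_PD pb) pa (by change (-1:ℤ) < 0; norm_num) rfl (z := (m.res 2).x 1 * (1 + (m.res 2).x 0) / 2) ?_ η key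
      have h5 : ((m.res 2).x 1 * (1 + (m.res 2).x 0) / 2) ^ 2 = (m.res 2).x 0 := by
        push_cast at ht
        linear_combination (1 + (m.res 2).x 0) ^ 2 / 4 * ht + 1 / 2 * hs
      rw [show (4 : ℕ) = 2 * 2 from rfl, pow_mul, h5, hs]
  · exact M_odd_real (m.res 1) 0 1 (by decide) pa (pdb_PD pc) (by change (-1:ℤ) < 0; norm_num) hc i3 X3 Y3 h3
  · rw [hη']; exact mem_FF.mp ((η : 𝓞 (FF (m.g 2))) : FF (m.g 2)).2
  · rw [hη']
    have h1 := m.res_g 2 1 ((η : 𝓞 (FF (m.g 2))) : FF (m.g 2))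
    have h2 : (2 : Fin 3).succAbove 1 = 1 := rfl
    rw [h2] at h1
    rw [← h1]
    have h3 := congrArg (fun y : FF (m.g 2) => (y : K)) hη
    push_cast at h3
    have h5 : (((m.res 2).x 0 : FF (m.g 2)) : K) = m.x 0 := m.res_x 2 0
    rw [h3, h5]; push_cast; ring

def Chk3 (b c X1 Y1 e1 X2 Y2 e X3 Y3 : ℤ) : Prop := Base3 b c X1 Y1 e1 X3 Y3 ∧ NS ![-1, b, c] 2 2 ∧
  (e = 1 ∨ e = -1) ∧ -b * X2 ^ 2 - c * Y2 ^ 2 = 2 * e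

lemma chk3 {b c X1 Y1 e1 X2 Y2 e X3 Y3 : ℤ} (m : MQ 3 K ![-1, b, c]) (h : Chk3 b c X1 Y1 e1 X2 Y2 e X3 Y3) : OddClass K := by
  obtain ⟨hB, hn, he, h2⟩ := h
  have hs : m.x 0 ^ 2 = -1 := by rw [m.hx]; simp
  have ht : m.x 1 ^ 2 = (b : K) := m.hx 1
  have hw : m.x 2 ^ 2 = (c : K) := m.hx 2
  refine base3_odd m hB (of_ns8 m hn hs he ?_)
  refine mk2 (m.g 2) (A := (X2 : K) * m.x 0 * m.x 1) (B := (Y2 : K) * m.x 2) (((isIntegral_algebraMap (R := ℤ) (x := X2)).mul (m.isInt 0)).mul (m.isInt 1))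
    (by rw [map_mul, map_mul, map_intCast, m.hg' _ _ (by decide), m.hg' _ _ (by decide)])
    (by rw [map_mul, map_intCast, m.hg]; ring) hs (m.hg' _ _ (by decide)) he ?_
  have h' : ((-b * X2 ^ 2 - c * Y2 ^ 2 : ℤ) : K) = ((2 * e : ℤ) : K) := by rw [h2]
  push_cast at h'
  rw [mul_pow, mul_pow, mul_pow, hs, ht, hw]; linear_combination h'

instance (b c X1 Y1 e1 X3 Y3 : ℤ) [NeZero c.natAbs] : Decidable (Base3 b c X1 Y1 e1 X3 Y3) := by unfold Base3; infer_instance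
instance (b c X1 Y1 e1 X2 Y2 e X3 Y3 : ℤ) [NeZero c.natAbs] : Decidable (Chk3 b c X1 Y1 e1 X2 Y2 e X3 Y3) := by unfold Chk3; infer_instance

/-- fields containing a primitive eighth root of unity, first type; u = (X + Y t) / 2 + (Z + W t) w / 2 -/
lemma v4a {c X3 Y3 X Y Z W : ℤ} (m : MQ 3 K ![-1, 2, c]) (hB : Base3 2 c 0 1 1 X3 Y3)
    (h1 : X ^ 2 + 2 * Y ^ 2 - c * (Z ^ 2 + 2 * W ^ 2) = -4) (h2 : 2 * X * Y - c * (2 * Z * W) = -4) : OddClass K := by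
  have hs : m.x 0 ^ 2 = -1 := by rw [m.hx]; simp
  have ht : m.x 1 ^ 2 = 2 := by rw [m.hx]; simp
  have hw : m.x 2 ^ 2 = (c : K) := m.hx 2
  have e1 : (X ^ 2 + 2 * Y ^ 2 - c * (Z ^ 2 + 2 * W ^ 2) : K) = -4 := by exact_mod_cast congrArg (Int.cast : ℤ → K) h1
  have e2 : (2 * X * Y - c * (2 * Z * W) : K) = -4 := by exact_mod_cast congrArg (Int.cast : ℤ → K) h2
  have s2 : m.g 2 (m.x 1) = m.x 1 := m.hg' _ _ (by decide)
  have hσ : m.g 2 ((X + Y * m.x 1) / 2 + (Z + W * m.x 1) * m.x 2 / 2) = (X + Y * m.x 1) / 2 - (Z + W * m.x 1) * m.x 2 / 2 := by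
    simp only [map_add, map_div₀, map_mul, map_intCast, map_ofNat, s2, m.hg]; ring
  have hn : ((X + Y * m.x 1) / 2 + (Z + W * m.x 1) * m.x 2 / 2) * m.g 2 ((X + Y * m.x 1) / 2 + (Z + W * m.x 1) * m.x 2 / 2) = -(1 + m.x 1) := by
    rw [hσ]
    linear_combination (1 / 4) * e1 + (1 / 4) * m.x 1 * e2 + (Y ^ 2 / 4 - W ^ 2 / 4 * c) * ht - (Z + W * m.x 1) ^ 2 / 4 * hw
  have hinv : (-(1 + m.x 1))⁻¹ = 1 - m.x 1 := by
    apply inv_eq_of_mul_eq_one_left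
    linear_combination ht
  have i1 := m.isInt 1
  obtain ⟨u, hu⟩ := mk_unit (m.g 2) _ _ ⟨X + Y * m.x 1, (isIntegral_algebraMap (R := ℤ) (x := X)).add ((isIntegral_algebraMap (R := ℤ) (x := Y)).mul i1)⟩
    (by rw [hσ]; change _ = (X : K) + Y * m.x 1; ring) hn (isIntegral_one.add i1).neg (by rw [hinv]; exact isIntegral_one.sub i1)
    (by
      intro h
      have : m.x 1 = -1 := by linear_combination -h
      rw [this] at ht; norm_num at ht)
  refine base3_odd m hB ⟨u, fun z hz h => ?_⟩
  rw [hu, hn] at h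
  have g0 : m.g 0 (m.x 1) = m.x 1 := m.hg' _ _ (by decide)
  have hpm : m.g 0 z = z ∨ m.g 0 z = -z := by
    apply sq_eq_sq_iff_eq_or_eq_neg.mp
    rw [← map_pow, h, map_neg, map_add, map_one, g0]
  obtain ⟨q, hq⟩ := m.rat_of_fixed (z * m.g 1 z) (fun i => by
    fin_cases i
    · simp only [Fin.zero_eta, Fin.isValue]
      rw [map_mul, m.aut_aut_comm (m.g 0)]
      rcases hpm with h | h <;> rw [h]
      rw [map_neg]; ring
    · simp only [Fin.mk_one, Fin.isValue]
      rw [map_mul, m.aut_aut, mul_comm]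
    · simp only [Fin.reduceFinMk]
      rw [map_mul, m.aut_aut_comm (m.g 2), hz])
  have h5 : (z * m.g 1 z) ^ 2 = -1 := by
    rw [mul_pow, ← map_pow, h, map_neg, map_add, map_one, m.hg]
    linear_combination -ht
  rw [hq] at h5
  have h6 : q ^ 2 = -1 := by exact_mod_cast h5
  nlinarith [sq_nonneg q]

/-- second type; s^2 = -2, t^2 = -1 -/
lemma v4b {c X3 Y3 A0 A1 A2 A3 B0 B1 B2 B3 : ℤ} (m : MQ 3 K ![-2, -1, c]) (hB : Base (-2) (-1) c)
    (h3 : c * X3 ^ 2 - (-2) * Y3 ^ 2 = -4) (hns : NS ![-2, -1, c] 0 2)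
    (q0 : A0 ^ 2 - 2 * A1 ^ 2 - A2 ^ 2 + 2 * A3 ^ 2 - c * (B0 ^ 2 - 2 * B1 ^ 2 - B2 ^ 2 + 2 * B3 ^ 2) = -16)
    (q1 : 2 * A0 * A1 - 2 * A2 * A3 - c * (2 * B0 * B1 - 2 * B2 * B3) = 8)
    (q2 : 2 * A0 * A2 - 4 * A1 * A3 - c * (2 * B0 * B2 - 4 * B1 * B3) = -16)
    (q3 : 2 * A0 * A3 + 2 * A1 * A2 - c * (2 * B0 * B3 + 2 * B1 * B2) = -8)
    (hA : A0 % 2 = 0 ∧ A2 % 2 = 0 ∧ (A1 + A3) % 2 = 0) : OddClass K := by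
  have hs : m.x 0 ^ 2 = -2 := by rw [m.hx]; simp
  have ht : m.x 1 ^ 2 = -1 := by rw [m.hx]; simp
  have hw : m.x 2 ^ 2 = (c : K) := m.hx 2
  have s0 : m.g 2 (m.x 0) = m.x 0 := m.hg' _ _ (by decide)
  have s1 : m.g 2 (m.x 1) = m.x 1 := m.hg' _ _ (by decide)
  set s := m.x 0 with hsd
  set t := m.x 1 with htd
  set w := m.x 2 with hwd
  have e0 : (A0 ^ 2 - 2 * A1 ^ 2 - A2 ^ 2 + 2 * A3 ^ 2 - c * (B0 ^ 2 - 2 * B1 ^ 2 - B2 ^ 2 + 2 * B3 ^ 2) : K) = -16 := by exact_mod_cast congrArg (Int.cast : ℤ → K) q0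
  have e1 : (2 * A0 * A1 - 2 * A2 * A3 - c * (2 * B0 * B1 - 2 * B2 * B3) : K) = 8 := by exact_mod_cast congrArg (Int.cast : ℤ → K) q1
  have e2 : (2 * A0 * A2 - 4 * A1 * A3 - c * (2 * B0 * B2 - 4 * B1 * B3) : K) = -16 := by exact_mod_cast congrArg (Int.cast : ℤ → K) q2
  have e3 : (2 * A0 * A3 + 2 * A1 * A2 - c * (2 * B0 * B3 + 2 * B1 * B2) : K) = -8 := by exact_mod_cast congrArg (Int.cast : ℤ → K) q3
  have hz : ∃ z, z = s * (1 - t) / 2 := ⟨_, rfl⟩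
  obtain ⟨ζ, hζ⟩ := hz
  have z2 : ζ ^ 2 = t := by rw [hζ]; linear_combination (1 - t) ^ 2 / 4 * hs - 1 / 2 * ht
  have zs : s = ζ * (1 + t) := by rw [hζ]; linear_combination s / 2 * ht
  have i1 : IsIntegral ℤ t := m.isInt 1
  have iz : IsIntegral ℤ ζ := IsIntegral.of_pow (n := 2) (by norm_num) (by rw [z2]; exact i1)
  have gz2 : m.g 2 ζ = ζ := by rw [hζ]; simp only [map_div₀, map_mul, map_sub, map_one, map_ofNat, s0, s1]
  obtain ⟨a0, ha0⟩ : ∃ a, A0 = 2 * a := ⟨A0 / 2, by omega⟩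
  obtain ⟨a2, ha2⟩ : ∃ a, A2 = 2 * a := ⟨A2 / 2, by omega⟩
  obtain ⟨l, hl⟩ : ∃ l, A3 = 2 * l - A1 := ⟨(A1 + A3) / 2, by omega⟩
  have c0 : (A0 : K) = 2 * a0 := by exact_mod_cast congrArg (Int.cast : ℤ → K) ha0
  have c2 : (A2 : K) = 2 * a2 := by exact_mod_cast congrArg (Int.cast : ℤ → K) ha2
  have c3 : (A3 : K) = 2 * l - A1 := by exact_mod_cast congrArg (Int.cast : ℤ → K) hl
  have hσ : m.g 2 ((A0 + A1 * s + A2 * t + A3 * (s * t)) / 4 + (B0 + B1 * s + B2 * t + B3 * (s * t)) * w / 4)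
      = (A0 + A1 * s + A2 * t + A3 * (s * t)) / 4 - (B0 + B1 * s + B2 * t + B3 * (s * t)) * w / 4 := by
    simp only [map_add, map_div₀, map_mul, map_intCast, map_ofNat, s0, s1, hwd, m.hg]; ring
  have hn : ((A0 + A1 * s + A2 * t + A3 * (s * t)) / 4 + (B0 + B1 * s + B2 * t + B3 * (s * t)) * w / 4)
      * m.g 2 ((A0 + A1 * s + A2 * t + A3 * (s * t)) / 4 + (B0 + B1 * s + B2 * t + B3 * (s * t)) * w / 4) = -(1 + t) + ζ := by
    rw [hσ, hζ]
    have k1 : (A0 + A1 * s + A2 * t + A3 * (s * t) : K) ^ 2 = (A0 ^ 2 - 2 * A1 ^ 2 - A2 ^ 2 + 2 * A3 ^ 2)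
        + (2 * A0 * A1 - 2 * A2 * A3) * s + (2 * A0 * A2 - 4 * A1 * A3) * t + (2 * A0 * A3 + 2 * A1 * A2) * (s * t) := by
      linear_combination (A1 ^ 2 + 2 * A1 * A3 * t + A3 ^ 2 * t ^ 2) * hs + (A2 ^ 2 + 2 * A2 * A3 * s - 2 * A3 ^ 2) * ht
    have k2 : (B0 + B1 * s + B2 * t + B3 * (s * t) : K) ^ 2 = (B0 ^ 2 - 2 * B1 ^ 2 - B2 ^ 2 + 2 * B3 ^ 2)
        + (2 * B0 * B1 - 2 * B2 * B3) * s + (2 * B0 * B2 - 4 * B1 * B3) * t + (2 * B0 * B3 + 2 * B1 * B2) * (s * t) := by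
      linear_combination (B1 ^ 2 + 2 * B1 * B3 * t + B3 ^ 2 * t ^ 2) * hs + (B2 ^ 2 + 2 * B2 * B3 * s - 2 * B3 ^ 2) * ht
    linear_combination (1 / 16) * k1 - (1 / 16) * c * k2 - (B0 + B1 * s + B2 * t + B3 * (s * t)) ^ 2 / 16 * hw
      + (1 / 16) * e0 + (1 / 16) * s * e1 + (1 / 16) * t * e2 + (1 / 16) * (s * t) * e3
  have hmul : t * ζ * (1 - s * t) * (-(1 + t) + ζ) = 1 := by
    have hγ : -(1 + t) + ζ = ζ * (1 + s * t) := by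
      rw [zs]; linear_combination -(t + t ^ 2) * z2 - (1 + t) * ht
    rw [hγ]
    linear_combination t * (1 - s ^ 2 * t ^ 2) * z2 - t ^ 4 * hs + (2 * t ^ 2 - 1) * ht
  have hinv : (-(1 + t) + ζ)⁻¹ = t * ζ * (1 - s * t) := inv_eq_of_mul_eq_one_left hmul
  have i0 : IsIntegral ℤ s := m.isInt 0
  have ii : ∀ n : ℤ, IsIntegral ℤ (n : K) := fun n => isIntegral_algebraMap (R := ℤ) (x := n)
  obtain ⟨u, hu⟩ := mk_unit (m.g 2) _ _ ⟨a0 + a2 * t + ζ * ((A1 - l) + l * t), ((ii _).add ((ii _).mul i1)).add (iz.mul (((ii _).sub (ii _)).add ((ii _).mul i1)))⟩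
    (by
      rw [hσ]; change _ = (a0 + a2 * t + ζ * ((A1 - l) + l * t) : K)
      rw [c0, c2, c3, zs]
      linear_combination (ζ * (2 * l - A1) / 2) * ht) hn ((isIntegral_one.add i1).neg.add iz)
    (by rw [hinv]; exact (i1.mul iz).mul (isIntegral_one.sub (i0.mul i1)))
    (by intro h; rw [h, mul_zero] at hmul; exact zero_ne_one hmul)
  refine base_odd m hB (unit2 (m.res 2) 1 0 0 (by decide) (by decide) (X := 1) (Y := 1) (by change (-2 : ℤ) * 1 ^ 2 - (-2) * (-1) * 1 ^ 2 = -4; norm_num)) (unit1 (m.res 1) 0 1 (by decide) h3) ⟨u, fun z hz h => ?_⟩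
  rw [hu, hn] at h
  have g1 : m.g 0 t = t := m.hg' _ _ (by decide)
  have g0 : m.g 0 ζ = -ζ := by
    rw [hζ]; simp only [map_div₀, map_mul, map_sub, map_one, map_ofNat, g1, hsd, m.hg]; ring
  apply m.ns8 hns (z * m.g 0 z) (by rw [map_mul, m.aut_aut, mul_comm])
  have h5 : (z * m.g 0 z) ^ 2 = t := by
    rw [mul_pow, ← map_pow, h, map_add, map_neg, map_add, map_one, g1, g0]
    linear_combination -z2 + ht
  rw [show (4 : ℕ) = 2 * 2 from rfl, pow_mul, h5, ht]
end
end Quin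

namespace Quin

lemma smul_int' {F : Type*} [Field F] [NumberField F] (g : F ≃ₐ[ℚ] F) (k : ℤ) : g • (k : 𝓞 F) = k :=
  oext (by rw [am_smul]; simp)

section
variable {F : Type*} [Field F] [NumberField F] {d : Fin 1 → ℤ} (m : MQ 1 F d)
include m

lemma q_fin : Module.finrank ℚ F = 2 := by rw [m.hF]; norm_num

/-- fixed integers are rational integers -/
lemma q_fixed (y : 𝓞 F) (h : m.g 0 • y = y) : ∃ k : ℤ, y = k := by
  obtain ⟨q, hq⟩ := m.rat_of_fixed (y := (y : F)) (by
    intro i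
    fin_cases i
    exact congrArg (fun z : 𝓞 F => (z : F)) h)
  have hi : IsIntegral ℤ q := by
    have := y.isIntegral_coe
    rw [← RingOfIntegers.coe_eq_algebraMap, hq, show ((q : ℚ) : F) = algebraMap ℚ F q from rfl] at this
    exact (isIntegral_algebraMap_iff (algebraMap ℚ F).injective).mp this
  obtain ⟨k, hk⟩ := IsIntegrallyClosed.isIntegral_iff.mp hi
  refine ⟨k, oext ?_⟩
  rw [← RingOfIntegers.coe_eq_algebraMap, hq, ← hk]; simp

lemma q_smul2 (y : 𝓞 F) : m.g 0 • m.g 0 • y = y := oext (by rw [am_smul, am_smul, m.aut_aut])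

/-- I * σ I is generated by the norm -/
lemma q_norm (I : Ideal (𝓞 F)) : I * m.g 0 • I = Ideal.span {((Ideal.absNorm I : ℤ) : 𝓞 F)} := by
  have h0 := map_relNorm_inv (m.g 0) (m.aut_aut _) (m.g_ne_one 0) I
  have h1 : Module.finrank ℚ (FF (m.g 0)) = 1 := by
    have := m.finrank_FF (m.g 0) (m.g_ne_one 0); omega
  obtain ⟨n, hn, h2⟩ : ∃ n, Odd n ∧ _ := odd_one h1 ⊤
  have h3 : (Ideal.relNorm (𝓞 (FF (m.g 0))) I).IsPrincipal := by
    have hs : Function.Surjective (algebraMap ℤ (𝓞 (FF (m.g 0)))) := by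
      intro y
      obtain ⟨k, hk⟩ := q_fixed m (algebraMap (𝓞 (FF (m.g 0))) (𝓞 F) y) (by
        apply oext
        rw [am_smul]
        exact mem_FF.mp (y : FF (m.g 0)).2)
      refine ⟨k, RingOfIntegers.algebraMap.injective (FF (m.g 0)) F ?_⟩
      rw [hk]; simp
    have : IsPrincipalIdealRing (𝓞 (FF (m.g 0))) := IsPrincipalIdealRing.of_surjective _ hs
    exact IsPrincipalIdealRing.principal _
  obtain ⟨x, hx⟩ := h3.principal
  rw [hx] at h0
  have h4 : m.g 0 • algebraMap (𝓞 (FF (m.g 0))) (𝓞 F) x = algebraMap (𝓞 (FF (m.g 0))) (𝓞 F) x := by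
    apply oext
    rw [am_smul]
    exact mem_FF.mp (x : FF (m.g 0)).2
  obtain ⟨k, hk⟩ := q_fixed m _ h4
  rw [← Ideal.span, Ideal.map_span, Set.image_singleton, hk] at h0
  have h5 := congrArg Ideal.absNorm h0
  rw [absNorm_int, map_mul, absNorm_smul, q_fin m, ← sq] at h5
  have h6 : k.natAbs = Ideal.absNorm I := Nat.pow_left_injective (n := 2) (by norm_num) h5
  rw [← h0, ← h6, Ideal.span_singleton_eq_span_singleton]
  rcases Int.natAbs_eq k with h7 | h7
  · rw [← h7]
  · nth_rw 1 [h7]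
    push_cast
    exact Associated.neg_left (Associated.refl _)

lemma q_inv (I : Ideal (𝓞 F)) (hI : I ≠ ⊥) : cl (m.g 0 • I) = (cl I)⁻¹ := by
  rw [eq_comm, inv_eq_iff_mul_eq_one, ← cl_mul hI (smul_ne_bot _ hI), q_norm, cl_span]

/-- norm of an element -/
lemma q_el {x : 𝓞 F} {k : ℤ} (h : x * m.g 0 • x = k) : Ideal.absNorm (Ideal.span {x}) = k.natAbs := by
  have h1 := q_norm m (Ideal.span {x})
  rw [smul_span, Ideal.span_singleton_mul_span_singleton, h] at h1
  have h5 := congrArg Ideal.absNorm h1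
  rw [absNorm_int, absNorm_int, q_fin m] at h5
  exact (Nat.pow_left_injective (n := 2) (by norm_num) h5).symm

end

/-- norm form -/
def qn (d u v : ℤ) : ℤ := u * u + tr d * u * v + nm d * v * v

section
variable {F : Type*} [Field F] [NumberField F] {d : Fin 1 → ℤ} (m : MQ 1 F d)
include m

lemma q_ex (u v : ℤ) : ∃ x : 𝓞 F, x * m.g 0 • x = qn (d 0) u v ∧ x + m.g 0 • x = (2 * u + tr (d 0) * v : ℤ) := by
  obtain ⟨θ, h1, h2, h3⟩ := m.th 0
  obtain ⟨h4, h5⟩ := h2 (m.g 0) (m.hg 0)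
  have h6 : m.g 0 • (u + v * θ : 𝓞 F) = u + v * m.g 0 • θ := by
    rw [smul_add, smul_mul', smul_int', smul_int']
  refine ⟨u + v * θ, ?_, ?_⟩
  · rw [h6, qn]; push_cast
    linear_combination (u * v : 𝓞 F) * h4 + (v * v : 𝓞 F) * h5
  · rw [h6]; push_cast
    linear_combination (v : 𝓞 F) * h4

/-- goodness of a prime number -/
def Good (_ : MQ 1 F d) (W : Subgroup (ClassGroup (𝓞 F))) (p : ℕ) : Prop :=
  ∀ Q : Ideal (𝓞 F), Q.IsPrime → Q ≠ ⊥ → (p : 𝓞 F) ∈ Q → cl Q ∈ W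

omit m in
lemma absNorm_prime {Q : Ideal (𝓞 F)} (hQ : Q.IsPrime) {p : ℕ} (hp : p.Prime) (h : (p : 𝓞 F) ∈ Q)
    (hf : Module.finrank ℚ F = 2) :
    Ideal.absNorm Q = p ∨ Ideal.absNorm Q = p ^ 2 := by
  have h1 : Ideal.absNorm Q ∣ p ^ 2 := by
    have := Ideal.absNorm_dvd_absNorm_of_le ((Ideal.span_singleton_le_iff_mem _).mpr h)
    have h2 := absNorm_int (F := F) (p : ℤ)
    rw [hf] at h2
    rw [Int.cast_natCast, Int.natAbs_natCast] at h2
    rwa [h2] at this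
  obtain ⟨k, hk, h2⟩ := (Nat.dvd_prime_pow hp).mp h1
  interval_cases k
  · exact absurd (Ideal.absNorm_eq_one_iff.mp (by simpa using h2)) hQ.ne_top
  · left; simpa using h2
  · right; exact h2

omit m in
lemma prime_of_dvd {Q : Ideal (𝓞 F)} (hQ : Q.IsPrime) (h0 : Q ≠ ⊥) : ∃ p : ℕ, p.Prime ∧ (p : 𝓞 F) ∈ Q ∧ p ∣ Ideal.absNorm Q := by
  have h1 : Ideal.absNorm Q ≠ 1 := fun h => hQ.ne_top (Ideal.absNorm_eq_one_iff.mp h)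
  have key : ∀ n : ℕ, n ≠ 0 → (n : 𝓞 F) ∈ Q → ∃ p : ℕ, p.Prime ∧ (p : 𝓞 F) ∈ Q ∧ p ∣ n := by
    intro n
    induction n using Nat.recOnMul with
    | zero => intro h; exact absurd rfl h
    | one =>
      intro _ h
      rw [Nat.cast_one] at h
      exact absurd ((Ideal.eq_top_iff_one _).mpr h) hQ.ne_top
    | prime p hp => intro _ h; exact ⟨p, hp, h, dvd_rfl⟩
    | mul a b ha hb =>
      intro h0 h
      rw [Nat.cast_mul] at h
      rcases hQ.mem_or_mem h with h | h
      · obtain ⟨p, h1, h2, h3⟩ := ha (by rintro rfl; simp at h0) h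
        exact ⟨p, h1, h2, h3.mul_right _⟩
      · obtain ⟨p, h1, h2, h3⟩ := hb (by rintro rfl; simp at h0) h
        exact ⟨p, h1, h2, h3.mul_left _⟩
  exact key _ (by rwa [Ne, Ideal.absNorm_eq_zero_iff]) (Ideal.absNorm_mem Q)

/-- transitivity -/
lemma q_trans {P Q : Ideal (𝓞 F)} (hP : P.IsPrime) (hQ : Q.IsPrime) (hP0 : P ≠ ⊥) {p : ℕ} (hp : p.Prime)
    (h1 : (p : 𝓞 F) ∈ P) (h2 : (p : 𝓞 F) ∈ Q) : Q = P ∨ Q = m.g 0 • P := by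
  have h3 : P * m.g 0 • P ≤ Q := by
    rw [q_norm, Ideal.span_singleton_le_iff_mem]
    rcases absNorm_prime hP hp h1 (q_fin m) with h | h
    · rw [h]; exact_mod_cast h2
    · rw [h]; push_cast; exact Q.pow_mem_of_mem h2 2 (by norm_num)
  rcases hQ.mul_le.mp h3 with h | h
  · exact Or.inl ((hP.isMaximal hP0).eq_of_le hQ.ne_top h).symm
  · right
    have h4 : P ≤ m.g 0 • Q := by
      intro x hx
      rw [Ideal.mem_pointwise_smul_iff_inv_smul_mem]
      apply h
      have : (m.g 0)⁻¹ = m.g 0 := by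
        rw [inv_eq_iff_mul_eq_one]
        exact m.aut_sq _
      rw [this]
      exact Ideal.smul_mem_pointwise_smul _ _ _ hx
    have h5 : m.g 0 • Q ≠ ⊤ := by
      intro h
      have := absNorm_smul (m.g 0) Q
      rw [h, Ideal.absNorm_top] at this
      exact hQ.ne_top (Ideal.absNorm_eq_one_iff.mp this.symm)
    have h6 := (hP.isMaximal hP0).eq_of_le h5 h4
    rw [h6, smul_smul, m.aut_sq, one_smul]

omit m in
/-- classes of ideals supported on good primes -/
lemma good_ideal (m : MQ 1 F d) (W : Subgroup (ClassGroup (𝓞 F))) (J : Ideal (𝓞 F)) (hJ : J ≠ ⊥)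
    (h : ∀ p : ℕ, p.Prime → p ∣ Ideal.absNorm J → Good m W p) : cl J ∈ W := by
  induction J using UniqueFactorizationMonoid.induction_on_prime with
  | h₁ => exact absurd rfl hJ
  | h₂ x hx =>
    rw [Ideal.isUnit_iff] at hx
    rw [hx, cl_top]; exact W.one_mem
  | h₃ a p ha hp ih =>
    have hp0 : p ≠ ⊥ := hp.ne_zero
    rw [cl_mul hp0 ha]
    have hpp := Ideal.isPrime_of_prime hp
    refine W.mul_mem ?_ (ih ha fun q hq hd => h q hq (by rw [map_mul]; exact hd.mul_left _))
    obtain ⟨q, h1, h2, h3⟩ := prime_of_dvd hpp hp0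
    exact h q h1 (by rw [map_mul]; exact h3.mul_right _) p hpp hp0 h2

omit m in
lemma exists_over {I : Ideal (𝓞 F)} (hI : I ≠ ⊥) {p : ℕ} (hp : p.Prime) (h : p ∣ Ideal.absNorm I)
    (hf : Module.finrank ℚ F = 2) :
    ∃ P : Ideal (𝓞 F), P.IsPrime ∧ P ≠ ⊥ ∧ (p : 𝓞 F) ∈ P ∧ P ∣ I := by
  induction I using UniqueFactorizationMonoid.induction_on_prime with
  | h₁ => exact absurd rfl hI
  | h₂ x hx =>
    rw [Ideal.isUnit_iff] at hx
    rw [hx, Ideal.absNorm_top] at h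
    exact absurd h hp.not_dvd_one
  | h₃ a P ha hP ih =>
    have hP0 : P ≠ ⊥ := hP.ne_zero
    have hpp := Ideal.isPrime_of_prime hP
    rw [map_mul] at h
    rcases hp.dvd_mul.mp h with h | h
    · refine ⟨P, hpp, hP0, ?_, dvd_mul_right _ _⟩
      obtain ⟨q, h1, h2, h3⟩ := prime_of_dvd hpp hP0
      have : p = q := by
        rcases absNorm_prime hpp h1 h2 hf with h4 | h4
        · rw [h4] at h; exact (Nat.prime_dvd_prime_iff_eq hp h1).mp h
        · rw [h4] at h; exact (Nat.prime_dvd_prime_iff_eq hp h1).mp (hp.dvd_of_dvd_pow h)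
      rwa [this]
    · obtain ⟨Q, h1, h2, h3, h4⟩ := ih ha h
      exact ⟨Q, h1, h2, h3, h4.mul_left _⟩

/-- one prime over p suffices -/
lemma good_of_one (W : Subgroup (ClassGroup (𝓞 F))) {P : Ideal (𝓞 F)} (hP : P.IsPrime) (hP0 : P ≠ ⊥) {p : ℕ} (hp : p.Prime)
    (h1 : (p : 𝓞 F) ∈ P) (h : cl P ∈ W) : Good m W p := by
  intro Q hQ hQ0 h2
  rcases q_trans m hP hQ hP0 hp h1 h2 with rfl | rfl
  · exact h
  · rw [q_inv m P hP0]; exact W.inv_mem h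

lemma good_alpha (W : Subgroup (ClassGroup (𝓞 F))) {u v : ℤ} {p c : ℕ} (hp : p.Prime)
    (hN : (qn (d 0) u v).natAbs = p * c) (hc0 : c ≠ 0) (hc : ∀ q : ℕ, q.Prime → q ∣ c → Good m W q) : Good m W p := by
  obtain ⟨x, hx, -⟩ := q_ex m u v
  have h1 := q_el m hx
  rw [hN] at h1
  have h0 : Ideal.span {x} ≠ ⊥ := by
    intro h
    rw [h, Ideal.absNorm_bot] at h1
    exact mul_ne_zero hp.ne_zero hc0 h1.symm
  obtain ⟨P, hP, hP0, hpP, J, hJ⟩ := exists_over h0 hp (by rw [h1]; exact dvd_mul_right _ _) (q_fin m)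
  have hJ0 : J ≠ ⊥ := by
    rintro rfl
    rw [Ideal.mul_bot] at hJ
    exact h0 hJ
  refine good_of_one m W hP hP0 hp hpP ?_
  have h2 := cl_span x
  rw [hJ, cl_mul hP0 hJ0] at h2
  rw [eq_inv_of_mul_eq_one_left h2]
  apply W.inv_mem
  apply good_ideal m W J hJ0
  intro q hq hd
  apply hc q hq
  have h3 := congrArg Ideal.absNorm hJ
  rw [h1, map_mul] at h3
  rcases absNorm_prime hP hp hpP (q_fin m) with h | h
  · rw [h] at h3
    rwa [Nat.eq_of_mul_eq_mul_left hp.pos h3]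
  · rw [h, sq, mul_assoc] at h3
    rw [Nat.eq_of_mul_eq_mul_left hp.pos h3]
    exact hd.mul_left _

lemma good_inert (W : Subgroup (ClassGroup (𝓞 F))) {p : ℕ} (hp : p.Prime) (h : inertb p (d 0) = true) : Good m W p := by
  intro Q hQ hQ0 h2
  obtain ⟨θ, h1, -, -⟩ := m.th 0
  rcases absNorm_prime hQ hp h2 (q_fin m) with h3 | h3
  · exact absurd h3 (absNorm_ne hp θ h1 (inert_of hp.pos h))
  · have h5 := absNorm_int (F := F) (p : ℤ)
    rw [q_fin m, Int.natAbs_natCast] at h5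
    have : Ideal.span {((p : ℤ) : 𝓞 F)} = Q := by
      apply eq_of_le_of_absNorm
      · rw [Ideal.span_singleton_le_iff_mem]; exact_mod_cast h2
      · intro h6
        rw [h6, Ideal.absNorm_bot] at h5
        exact pow_ne_zero 2 hp.ne_zero h5.symm
      · rw [h5, h3]
    rw [← this, cl_span]
    exact W.one_mem

lemma good_ram (W : Subgroup (ClassGroup (𝓞 F))) (hW : ∀ c, c ^ 2 ∈ W → c ∈ W) {p : ℕ} (hp : p.Prime) (t : ℤ)
    (h1 : (p : ℤ) ∣ 2 * t) (h2 : (p : ℤ) ∣ d 0 - t ^ 2) (h3 : ¬ (p : ℤ) ^ 2 ∣ d 0 - t ^ 2) : Good m W p := by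
  intro Q hQ hQ0 hpQ
  obtain ⟨a, ha⟩ := h1
  obtain ⟨b, hb⟩ := h2
  have hb' : ¬ (p : ℤ) ∣ b := by
    intro h; apply h3; rw [hb, sq]; exact mul_dvd_mul_left _ h
  have hco : IsCoprime (p : ℤ) b := (Nat.prime_iff_prime_int.mp hp).coprime_iff_not_dvd.mpr hb'
  obtain ⟨y, z, hyz⟩ := hco
  have ha' : (2 * t : 𝓞 F) = p * a := by exact_mod_cast congrArg (Int.cast : ℤ → 𝓞 F) ha
  have hb' : (d 0 - t ^ 2 : 𝓞 F) = p * b := by exact_mod_cast congrArg (Int.cast : ℤ → 𝓞 F) hb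
  have hyz' : (y * p + z * b : 𝓞 F) = 1 := by exact_mod_cast congrArg (Int.cast : ℤ → 𝓞 F) hyz
  have hX := m.X_sq 0
  set e : 𝓞 F := t + m.X 0 with he
  have he2 : e * e = p * (a * e + b) := by
    linear_combination hX + hb' + e * ha'
  have heQ : e ∈ Q := by
    have : e * e ∈ Q := by rw [he2]; exact Q.mul_mem_right _ hpQ
    exact (hQ.mem_or_mem this).elim id id
  have hpQ2 : (p : 𝓞 F) ∈ Q * Q := by
    have : (p : 𝓞 F) = y * (p * p) + z * (e * e) - z * a * (p * e) := by
      linear_combination (-(p : 𝓞 F)) * hyz' - z * he2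
    rw [this]
    exact Ideal.sub_mem _ (Ideal.add_mem _ (Ideal.mul_mem_left _ _ (Ideal.mul_mem_mul hpQ hpQ))
      (Ideal.mul_mem_left _ _ (Ideal.mul_mem_mul heQ heQ))) (Ideal.mul_mem_left _ _ (Ideal.mul_mem_mul hpQ heQ))
  have h5 := absNorm_int (F := F) (p : ℤ)
  rw [q_fin m, Int.natAbs_natCast, Int.cast_natCast] at h5
  have hle := (Ideal.span_singleton_le_iff_mem _).mpr hpQ2
  have h6 := Ideal.absNorm_dvd_absNorm_of_le hle
  rw [h5, map_mul, ← sq] at h6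
  have h7 : Ideal.absNorm Q ∣ p := (Nat.pow_dvd_pow_iff (by norm_num)).mp h6
  have h8 : Ideal.absNorm Q = p := by
    rcases absNorm_prime hQ hp hpQ (q_fin m) with h | h
    · exact h
    · rw [h] at h7
      have := Nat.le_of_dvd hp.pos h7
      have := hp.two_le
      nlinarith
  have h9 : Ideal.span {(p : 𝓞 F)} = Q * Q := by
    apply eq_of_le_of_absNorm hle
    · intro h6
      rw [h6, Ideal.absNorm_bot] at h5
      exact pow_ne_zero 2 hp.ne_zero h5.symm
    · rw [h5, map_mul, h8, sq]
  apply hW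
  rw [sq, ← cl_mul hQ0 hQ0, ← h9, cl_span]
  exact W.one_mem

/-- a prime ideal whose fifth power is principal -/
lemma five_ideal {u v : ℤ} {p : ℕ} (hp : p.Prime) (hN : (qn (d 0) u v).natAbs = p ^ 5)
    (ht : ¬ (p : ℤ) ∣ 2 * u + tr (d 0) * v) :
    ∃ (P : Ideal (𝓞 F)) (x : 𝓞 F), P.IsPrime ∧ P ≠ ⊥ ∧ (p : 𝓞 F) ∈ P ∧ P ^ 5 = Ideal.span {x} ∧ Ideal.absNorm P = p ∧
      x * m.g 0 • x = qn (d 0) u v ∧ x + m.g 0 • x = (2 * u + tr (d 0) * v : ℤ) := by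
  obtain ⟨x, hx, hx2⟩ := q_ex m u v
  have h1 := q_el m hx
  rw [hN] at h1
  have h0 : Ideal.span {x} ≠ ⊥ := by
    intro h
    rw [h, Ideal.absNorm_bot] at h1
    exact pow_ne_zero 5 hp.ne_zero h1.symm
  obtain ⟨P, hP, hP0, hpP, hd⟩ := exists_over h0 hp (by rw [h1]; exact dvd_pow_self _ (by norm_num)) (q_fin m)
  have hxP : x ∈ P := (Ideal.span_singleton_le_iff_mem _).mp (Ideal.le_of_dvd hd)
  have hxP' : m.g 0 • x ∉ P := by
    intro h
    apply ht
    apply int_mem hP.ne_top hp hpP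
    rw [← hx2]
    exact P.add_mem hxP h
  have hPn : Ideal.absNorm P = p := by
    rcases absNorm_prime hP hp hpP (q_fin m) with h | h
    · exact h
    · exfalso
      have h5 := absNorm_int (F := F) (p : ℤ)
      rw [q_fin m, Int.natAbs_natCast] at h5
      have : Ideal.span {((p : ℤ) : 𝓞 F)} = P := by
        apply eq_of_le_of_absNorm
        · rw [Ideal.span_singleton_le_iff_mem]; exact_mod_cast hpP
        · intro h6
          rw [h6, Ideal.absNorm_bot] at h5
          exact pow_ne_zero 2 hp.ne_zero h5.symm
        · rw [h5, h]
      rw [← this, Ideal.mem_span_singleton] at hxP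
      obtain ⟨y, hy⟩ := hxP
      apply hxP'
      rw [hy, smul_mul', smul_int', ← this]
      exact Ideal.mul_mem_right _ _ (Ideal.mem_span_singleton_self _)
  refine ⟨P, x, hP, hP0, hpP, ?_, hPn, hx, hx2⟩
  have hpr : Prime P := Ideal.prime_of_isPrime hP0 hP
  have h6 : P ^ 5 ∣ Ideal.span {x} * Ideal.span {m.g 0 • x} := by
    rw [← smul_span, q_norm, h1]
    have : (Ideal.span {(((p ^ 5 : ℕ) : ℤ) : 𝓞 F)} : Ideal (𝓞 F)) = Ideal.span {((Ideal.absNorm P : ℤ) : 𝓞 F)} ^ 5 := by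
      rw [Ideal.span_singleton_pow, hPn]; push_cast; rfl
    rw [this, ← q_norm m, mul_pow]
    exact dvd_mul_right _ _
  have h7 : ¬ P ∣ Ideal.span {m.g 0 • x} := by
    intro h
    exact hxP' ((Ideal.span_singleton_le_iff_mem _).mp (Ideal.le_of_dvd h))
  have h8 := hpr.pow_dvd_of_dvd_mul_right 5 h7 h6
  symm
  exact eq_of_le_of_absNorm (Ideal.le_of_dvd h8) h0 (by rw [h1, map_pow, hPn])

end
end Quin

namespace Quin

section
variable {F : Type*} [Field F] [NumberField F] {d : Fin 1 → ℤ} (m : MQ 1 F d)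
include m

lemma q_trace (x : 𝓞 F) {k : ℤ} (h : x + m.g 0 • x = k) : Algebra.trace ℤ (𝓞 F) x = k := by
  classical
  have h1 := Algebra.coe_trace_int (K := F) x
  have h2 := m.gal
  have h3 := trace_eq_sum_automorphisms (K := ℚ) (L := F) (x : F)
  have hc : Fintype.card (F ≃ₐ[ℚ] F) = 2 := by
    rw [← Nat.card_eq_fintype_card, IsGalois.card_aut_eq_finrank, q_fin m]
  have hu : (Finset.univ : Finset (F ≃ₐ[ℚ] F)) = {1, m.g 0} := by
    symm
    apply Finset.eq_univ_of_card
    rw [hc, Finset.card_pair (m.g_ne_one 0).symm]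
  rw [hu, Finset.sum_pair (m.g_ne_one 0).symm] at h3
  have h4 := congrArg (fun z : 𝓞 F => (z : F)) h
  have h5 : algebraMap ℚ F ((Algebra.trace ℤ (𝓞 F) x : ℤ) : ℚ) = algebraMap ℚ F (k : ℚ) := by
    rw [h1]
    refine h3.trans ?_
    refine Eq.trans ?_ (h4.trans ?_)
    · rfl
    · simp
  have h6 := (algebraMap ℚ F).injective h5
  exact_mod_cast h6

lemma q_discr : |discr F| ≤ |tr (d 0) ^ 2 - 4 * nm (d 0)| := by
  classical
  obtain ⟨θ, h1, h2, h3⟩ := m.th 0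
  obtain ⟨h4, h5⟩ := h2 (m.g 0) (m.hg 0)
  have hcard : Module.finrank ℤ (𝓞 F) = 2 := by rw [RingOfIntegers.rank, q_fin m]
  have e := Module.finBasisOfFinrankEq ℤ (𝓞 F) hcard
  have hD := discr_eq_discr F e
  set v : Fin 2 → 𝓞 F := ![1, θ] with hv
  have hP := Algebra.discr_of_matrix_mulVec (A := ℤ) e (Matrix.of fun i j => e.repr (v i) j)
  have hv2 : ((Matrix.of fun i j => e.repr (v i) j : Matrix (Fin 2) (Fin 2) ℤ).map (algebraMap ℤ (𝓞 F))).mulVec e = v := by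
    ext1 i
    rw [Matrix.mulVec, dotProduct]
    conv_rhs => rw [← e.sum_repr (v i)]
    simp [Algebra.smul_def]
  rw [hv2, hD] at hP
  have hdv : Algebra.discr ℤ v = tr (d 0) ^ 2 - 4 * nm (d 0) := by
    rw [Algebra.discr_def, Matrix.det_fin_two]
    simp only [Algebra.traceMatrix_apply, Algebra.traceForm_apply, hv, Matrix.cons_val_zero, Matrix.cons_val_one]
    rw [one_mul, one_mul, mul_one, q_trace m (1 : 𝓞 F) (k := 2) (by rw [smul_one]; norm_num), q_trace m θ h4,
      q_trace m (θ * θ) (k := tr (d 0) ^ 2 - 2 * nm (d 0)) (by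
        rw [smul_mul']; push_cast; linear_combination (θ + m.g 0 • θ + tr (d 0)) * h4 - 2 * h5)]
    ring
  rw [hdv] at hP
  have hne : tr (d 0) ^ 2 - 4 * nm (d 0) ≠ 0 := by
    have := m.hd 0
    rw [tr, nm]
    split_ifs <;> omega
  rw [hP, abs_mul]
  have h6 : 1 ≤ |(Matrix.of fun i j => e.repr (v i) j : Matrix (Fin 2) (Fin 2) ℤ).det ^ 2| := by
    apply Int.one_le_abs
    intro h
    rw [h, zero_mul] at hP
    exact hne hP
  nlinarith [abs_nonneg (discr F)]

lemma q_mink {B : ℕ} (hB : 40000 * |tr (d 0) ^ 2 - 4 * nm (d 0)| < 98596 * ((B : ℤ) + 1) ^ 2) (C : ClassGroup (𝓞 F)) :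
    ∃ I : Ideal (𝓞 F), I ≠ ⊥ ∧ cl I = C ∧ Ideal.absNorm I ≤ B := by
  obtain ⟨⟨I, hI⟩, h1, h2⟩ := exists_ideal_in_class_of_norm_le (K := F) C
  have h0 : I ≠ ⊥ := nonZeroDivisors.ne_zero hI
  refine ⟨I, h0, by rw [cl, dif_neg h0, h1], ?_⟩
  simp only at h2
  rw [q_fin m] at h2
  have h3 := InfinitePlace.card_add_two_mul_card_eq_rank F
  rw [q_fin m] at h3
  have h4 : InfinitePlace.nrComplexPlaces F ≤ 1 := by omega
  have hpi := Real.pi_gt_d2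
  have hpi4 := Real.pi_le_four
  have hge : 1 ≤ 4 / Real.pi := by rw [le_div_iff₀ Real.pi_pos]; linarith
  have h5 : (4 / Real.pi) ^ InfinitePlace.nrComplexPlaces F ≤ 4 / Real.pi := by
    calc (4 / Real.pi) ^ InfinitePlace.nrComplexPlaces F ≤ (4 / Real.pi) ^ 1 := pow_le_pow_right₀ hge h4
      _ = _ := pow_one _
  have h6 : (4 / Real.pi) ≤ 4 / 3.14 := by
    apply div_le_div_of_nonneg_left (by norm_num) (by norm_num) hpi.le
  have hd := q_discr m
  have hd' : (|(discr F : ℝ)|) ≤ ((|tr (d 0) ^ 2 - 4 * nm (d 0)| : ℤ) : ℝ) := by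
    rw [← Int.cast_abs]; exact_mod_cast hd
  have hB' : 40000 * ((|tr (d 0) ^ 2 - 4 * nm (d 0)| : ℤ) : ℝ) < 98596 * ((B : ℝ) + 1) ^ 2 := by exact_mod_cast hB
  have h7 : Real.sqrt |(discr F : ℝ)| < 3.14 / 2 * (B + 1) := by
    rw [Real.sqrt_lt' (by positivity)]
    nlinarith
  have h8 : (Ideal.absNorm I : ℝ) < B + 1 := by
    have hs := Real.sqrt_nonneg |(discr F : ℝ)|
    calc (Ideal.absNorm I : ℝ) ≤ _ := h2
      _ ≤ 4 / 3.14 * ((Nat.factorial 2 : ℝ) / (2 : ℕ) ^ 2 * Real.sqrt |(discr F : ℝ)|) := by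
        apply mul_le_mul_of_nonneg_right (h5.trans h6)
        positivity
      _ < B + 1 := by
        norm_num [Nat.factorial]
        norm_num at h7
        linarith
  have : Ideal.absNorm I < B + 1 := by exact_mod_cast h8
  omega

end

/-- divide out a prime -/
def strip (p : ℕ) : ℕ → ℕ → ℕ
  | 0, n => n
  | f + 1, n => if n % p = 0 then strip p f (n / p) else n

lemma strip_spec (p : ℕ) (hp : p.Prime) : ∀ f n : ℕ, ∃ k, n = strip p f n * p ^ k := by
  intro f
  induction f with
  | zero => intro n; exact ⟨0, by simp [strip]⟩
  | succ f ih =>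
    intro n
    rw [strip]
    split_ifs with h
    · obtain ⟨k, hk⟩ := ih (n / p)
      refine ⟨k + 1, ?_⟩
      rw [pow_succ, ← mul_assoc, ← hk, Nat.div_mul_cancel (Nat.dvd_of_mod_eq_zero h)]
    · exact ⟨0, by simp⟩

/-- divide out a list of primes -/
def red : List ℕ → ℕ → ℕ
  | [], n => n
  | p :: g, n => red g (strip p 40 n)

lemma red_spec : ∀ (g : List ℕ), (∀ p ∈ g, p.Prime) → ∀ n : ℕ, ∃ c, n = red g n * c ∧ ∀ q : ℕ, q.Prime → q ∣ c → q ∈ g := by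
  intro g
  induction g with
  | nil =>
    intro _ n
    exact ⟨1, by simp [red], fun q hq h => absurd h hq.not_dvd_one⟩
  | cons p g ih =>
    intro hg n
    obtain ⟨k, hk⟩ := strip_spec p (hg p (by simp)) 40 n
    obtain ⟨c, h1, h2⟩ := ih (fun q hq => hg q (by simp [hq])) (strip p 40 n)
    refine ⟨c * p ^ k, ?_, ?_⟩
    · rw [red, ← mul_assoc, ← h1, ← hk]
    · intro q hq hd
      rcases hq.dvd_mul.mp hd with h | h
      · exact List.mem_cons_of_mem _ (h2 q hq h)
      · rw [(Nat.prime_dvd_prime_iff_eq hq (hg p (by simp))).mp (hq.dvd_of_dvd_pow h)]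
        simp

/-- run a list of relations -/
def runc (d : ℤ) : List (ℤ × ℤ) → List ℕ → List ℕ
  | [], g => g
  | x :: l, g => let r := red g (qn d x.1 x.2).natAbs; if prb r then runc d l (r :: g) else runc d l g

/-- ramified prime test -/
def ramb (d : ℤ) (p : ℕ) : Bool := prb p && (((d % p == 0) && (d % (p ^ 2 : ℕ) != 0)) || (p == 2 && (d - 1) % 2 == 0 && (d - 1) % 4 != 0))

/-- the full check -/
def qchk (d : ℤ) (B : ℕ) (g0 : List ℕ) (g1 : List ℕ) (l : List (ℤ × ℤ)) : Bool :=
  decide (40000 * |tr d ^ 2 - 4 * nm d| < 98596 * ((B : ℤ) + 1) ^ 2) && g1.all (ramb d) &&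
  (let g := runc d l (g0 ++ g1); (List.range (B + 1)).all fun p => g.contains p || !(prb p) || inertb p d)

lemma prime_prb {p : ℕ} (hp : p.Prime) : prb p = true := by
  rw [prb, Bool.and_eq_true, decide_eq_true_eq, List.all_eq_true]
  refine ⟨hp.two_le, fun k hk => ?_⟩
  rw [Bool.or_eq_true, decide_eq_true_eq, bne_iff_ne]
  by_contra! h
  have h1 := (Nat.dvd_prime hp).mp (Nat.dvd_of_mod_eq_zero h.2)
  have := List.mem_range.mp hk
  omega

section
variable {F : Type*} [Field F] [NumberField F] {d : Fin 1 → ℤ} (m : MQ 1 F d)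
include m

lemma runc_good (W : Subgroup (ClassGroup (𝓞 F))) : ∀ (l : List (ℤ × ℤ)) (g : List ℕ),
    (∀ p ∈ g, p.Prime ∧ Good m W p) → ∀ p ∈ runc (d 0) l g, p.Prime ∧ Good m W p := by
  intro l
  induction l with
  | nil => intro g h; exact h
  | cons x l ih =>
    intro g hg
    rw [runc]
    split_ifs with h
    · apply ih
      intro p hp
      rcases List.mem_cons.mp hp with rfl | hp
      · have hpr := prb_prime h
        refine ⟨hpr, ?_⟩
        obtain ⟨c, h1, h2⟩ := red_spec g (fun p hp => (hg p hp).1) (qn (d 0) x.1 x.2).natAbs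
        by_cases hc : c = 0
        · rw [hc, mul_zero] at h1
          rw [h1] at hpr
          exfalso
          have : ∀ g : List ℕ, red g 0 = 0 := by
            intro g
            have hst : ∀ p f, strip p f 0 = 0 := by
              intro p f
              induction f with
              | zero => rfl
              | succ f ih => rw [strip]; simp [ih]
            induction g with
            | nil => rfl
            | cons p g ih => rw [red, hst, ih]
          rw [this] at hpr
          exact Nat.not_prime_zero hpr
        · exact good_alpha m W hpr h1 hc fun q hq hd => (hg q (h2 q hq hd)).2
      · exact hg p hp
    · exact ih g hg

lemma qchk_top {B : ℕ} {g0 g1 : List ℕ} {l : List (ℤ × ℤ)} (h : qchk (d 0) B g0 g1 l = true)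
    (W : Subgroup (ClassGroup (𝓞 F))) (hW : ∀ c, c ^ 2 ∈ W → c ∈ W) (h0 : ∀ p ∈ g0, p.Prime ∧ Good m W p) :
    ∀ c, c ∈ W := by
  rw [qchk, Bool.and_eq_true, Bool.and_eq_true, decide_eq_true_eq, List.all_eq_true, List.all_eq_true] at h
  obtain ⟨⟨hB, h1⟩, h2⟩ := h
  have h3 := runc_good m W l (g0 ++ g1) (by
    intro p hp
    rcases List.mem_append.mp hp with hp | hp
    · exact h0 p hp
    · have := h1 p hp
      rw [ramb, Bool.and_eq_true] at this
      have hpr := prb_prime this.1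
      refine ⟨hpr, ?_⟩
      have h5 := this.2
      simp only [Bool.or_eq_true, Bool.and_eq_true, beq_iff_eq, bne_iff_ne] at h5
      rcases h5 with ⟨h5, h6⟩ | ⟨⟨h5, h6⟩, h7⟩
      · refine good_ram m W hW hpr 0 (by simp) ?_ ?_
        · simpa using Int.dvd_of_emod_eq_zero h5
        · intro h; apply h6; exact Int.emod_eq_zero_of_dvd (by simpa using h)
      · subst h5
        refine good_ram m W hW hpr 1 (by simp) ?_ ?_
        · push_cast; omega
        · push_cast; omega)
  intro c
  obtain ⟨I, hI, hc, hn⟩ := q_mink m hB c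
  rw [← hc]
  apply good_ideal m W I hI
  intro p hp hd
  have hle : p ≤ B := (Nat.le_of_dvd (Nat.pos_of_ne_zero (by rwa [Ne, Ideal.absNorm_eq_zero_iff])) hd).trans hn
  have h4 := h2 p (List.mem_range.mpr (by omega))
  rw [Bool.or_eq_true, Bool.or_eq_true, prime_prb hp] at h4
  rcases h4 with (h4 | h4) | h4
  · exact (h3 p (by simpa using h4)).2
  · simp at h4
  · exact good_inert m W hp h4

end

/-- 2-saturation of a cyclic subgroup -/
def satW {G : Type*} [CommGroup G] (π : G) : Subgroup G where
  carrier := {c | ∃ k : ℕ, c ^ 2 ^ k ∈ Subgroup.zpowers π}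
  one_mem' := ⟨0, by simp [Subgroup.one_mem]⟩
  mul_mem' := by
    rintro a b ⟨k, hk⟩ ⟨l, hl⟩
    refine ⟨k + l, ?_⟩
    rw [mul_pow]
    apply Subgroup.mul_mem
    · rw [pow_add, pow_mul]; exact Subgroup.pow_mem _ hk _
    · rw [pow_add, mul_comm, pow_mul]; exact Subgroup.pow_mem _ hl _
  inv_mem' := by
    rintro a ⟨k, hk⟩
    exact ⟨k, by rw [inv_pow]; exact Subgroup.inv_mem _ hk⟩

lemma satW_sq {G : Type*} [CommGroup G] (π c : G) (h : c ^ 2 ∈ satW π) : c ∈ satW π := by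
  obtain ⟨k, hk⟩ := h
  exact ⟨k + 1, by rwa [pow_succ, mul_comm, pow_mul]⟩

/-- no square check -/
def nsq (D p : ℕ) : Bool := (List.range (2 * p + 1)).all fun X => decide (4 * p < X * X) || (Nat.sqrt (D * (4 * p - X * X))) ^ 2 != D * (4 * p - X * X)

section
variable {F : Type*} [Field F] [NumberField F] {d : Fin 1 → ℤ} (m : MQ 1 F d)
include m

/-- nontriviality in the imaginary case -/
lemma im_ne {P : Ideal (𝓞 F)} {p : ℕ} (hp : p ≠ 0) (hP : Ideal.absNorm P = p) (hd : d 0 < 0) (h : nsq (d 0).natAbs p = true) : cl P ≠ 1 := by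
  intro h1
  obtain ⟨y, hy⟩ := (cl_eq_one_iff.mp h1).principal
  have hX := m.X_sq 0
  have hgX : m.g 0 • m.X 0 = - m.X 0 := oext (by rw [am_smul, MQ.X_coe, m.hg]; simp [MQ.X_coe])
  obtain ⟨a, ha⟩ := q_fixed m (y + m.g 0 • y) (by rw [smul_add, q_smul2 m]; ring)
  obtain ⟨n, hn⟩ := q_fixed m (y * m.g 0 • y) (by rw [smul_mul', q_smul2 m]; ring)
  obtain ⟨z, hz⟩ := q_fixed m ((y - m.g 0 • y) * m.X 0) (by rw [smul_mul', smul_sub, q_smul2 m, hgX]; ring)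
  have hN := q_el m hn
  change P = Ideal.span {y} at hy
  rw [← hy, hP] at hN
  have key : (a ^ 2 - 4 * n) * d 0 = z ^ 2 := by
    have : ((a : 𝓞 F) ^ 2 - 4 * n) * d 0 = z ^ 2 := by
      rw [← ha, ← hn, ← hz, ← hX]; ring
    exact_mod_cast this
  have hle : a ^ 2 - 4 * n ≤ 0 := by
    by_contra! h
    nlinarith [sq_nonneg z]
  have hn0 : 0 ≤ n := by nlinarith [sq_nonneg a]
  have hnp : n = p := by omega
  subst hnp
  have ha2 : a.natAbs * a.natAbs ≤ 4 * p := by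
    zify; rw [abs_mul_abs_self]; nlinarith
  rw [nsq, List.all_eq_true] at h
  have h5 := h a.natAbs (List.mem_range.mpr (by
    by_contra! h6
    nlinarith))
  rw [Bool.or_eq_true, decide_eq_true_eq, bne_iff_ne] at h5
  rcases h5 with h5 | h5
  · omega
  · apply h5
    have h6 : (d 0).natAbs * (4 * p - a.natAbs * a.natAbs) = z.natAbs * z.natAbs := by
      zify [ha2]
      rw [abs_mul_abs_self, abs_mul_abs_self, abs_of_neg hd]
      linear_combination key
    rw [h6, Nat.sqrt_eq, sq]

/-- trivial 5-part -/
lemma quad_triv {B : ℕ} {g1 : List ℕ} {l : List (ℤ × ℤ)} (h : qchk (d 0) B [] g1 l = true) (c : ClassGroup (𝓞 F)) :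
    ∃ k : ℕ, c ^ 2 ^ k = 1 := by
  obtain ⟨k, hk⟩ := qchk_top m h (satW 1) (satW_sq 1) (by simp) c
  exact ⟨k, by simpa using hk⟩

lemma quad_five {B p : ℕ} {u v : ℤ} {g1 : List ℕ} {l : List (ℤ × ℤ)} (h : qchk (d 0) B [p] g1 l = true) (hp : prb p = true)
    (hN : (qn (d 0) u v).natAbs = p ^ 5) (ht : (2 * u + tr (d 0) * v) % p ≠ 0) :
    ∃ (P : Ideal (𝓞 F)) (x : 𝓞 F), P.IsPrime ∧ P ≠ ⊥ ∧ (p : 𝓞 F) ∈ P ∧ P ^ 5 = Ideal.span {x} ∧ Ideal.absNorm P = p ∧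
      x * m.g 0 • x = qn (d 0) u v ∧ x + m.g 0 • x = (2 * u + tr (d 0) * v : ℤ) ∧
      ∀ c : ClassGroup (𝓞 F), ∃ k : ℕ, c ^ 2 ^ k ∈ Subgroup.zpowers (cl P) := by
  obtain ⟨P, x, h1, h2, h3, h4, h5, h6, h7⟩ := five_ideal m (prb_prime hp) hN (fun h => ht (Int.emod_eq_zero_of_dvd h))
  refine ⟨P, x, h1, h2, h3, h4, h5, h6, h7, fun c => ?_⟩
  refine qchk_top m h (satW (cl P)) (satW_sq _) ?_ c
  intro q hq
  rw [List.mem_singleton] at hq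
  subst hq
  exact ⟨prb_prime hp, good_of_one m _ h1 h2 (prb_prime hp) h3 ⟨0, by simp⟩⟩

end
end Quin

set_option maxRecDepth 100000
namespace Quin

/-- trivial 5-part of a quadratic class group -/
def T0 (d : ℤ) : Prop := ∀ (F : Type) [Field F] [NumberField F] (e : Fin 1 → ℤ), MQ 1 F e → e 0 = d →
  ∀ c : ClassGroup (𝓞 F), ∃ k : ℕ, c ^ 2 ^ k = 1
/-- cyclic 5-part of a quadratic class group -/
def T5 (d : ℤ) : Prop := ∀ (F : Type) [Field F] [NumberField F] (e : Fin 1 → ℤ), MQ 1 F e → e 0 = d →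
  ∃ P : Ideal (𝓞 F), P ≠ ⊥ ∧ cl P ^ 5 = 1 ∧ cl P ≠ 1 ∧ ∀ c : ClassGroup (𝓞 F), ∃ k : ℕ, c ^ 2 ^ k ∈ Subgroup.zpowers (cl P)

def tab0 : List (ℤ × ℕ × List ℕ × List (ℤ × ℤ)) := [
  (-1, 1, [], []), (-2, 1, [], []), (2, 1, [], []), (-3, 1, [], []), (3, 2, [2], []), (5, 1, [], []),
  (-5, 2, [2], []), (-6, 3, [2, 3], []), (6, 3, [2, 3], []), (-7, 1, [], []), (7, 3, [2], [(2, 1)]),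
  (-10, 4, [2], []), (-11, 2, [], []), (11, 4, [2], []), (13, 2, [], []), (-13, 4, [2], []), (14, 4, [2], []),
  (-15, 2, [3], [(1, 1)]), (17, 2, [], [(1, 1)]), (-19, 2, [], []), (19, 5, [2], [(4, 1), (9, 2)]),
  (21, 2, [], []), (22, 5, [2], [(5, 1)]), (-22, 5, [2], []), (29, 3, [], []), (33, 3, [3], [(2, 1)]),
  (-35, 3, [5], [(2, 1)]), (37, 3, [], [(2, 1)]), (-37, 7, [2], []), (38, 7, [2], []), (41, 4, [], [(3, 1)]),
  (-43, 4, [], []), (43, 8, [2], [(7, 1), (6, 1)]), (47, 8, [2], []), (-51, 4, [3], []),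
  (57, 4, [3], [(3, 1)]), (-58, 9, [2], []), (61, 4, [], [(3, 1)]), (-67, 5, [], []),
  (67, 10, [2], [(8, 1), (9, 1)]), (74, 10, [2], [(9, 1), (8, 1)]), (77, 5, [], []),
  (86, 11, [2], [(9, 1), (8, 1), (4, 1)]), (-91, 6, [7], [(3, 1)]), (94, 12, [2], [(29, 3), (10, 1)]),
  (-123, 7, [3], []), (127, 14, [2], [(11, 1), (45, 4), (34, 3)]), (129, 7, [3], [(5, 1), (6, 1)]),
  (131, 14, [2], [(23, 2), (12, 1)]), (133, 7, [7], [(5, 1)]), (141, 7, [3], [(5, 1), (6, 1)]),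
  (143, 15, [2, 11, 13], []), (158, 16, [2], [(25, 2), (13, 1)]), (-163, 8, [], []),
  (163, 16, [2], [(13, 1), (51, 4), (14, 1)]), (179, 17, [2], [(13, 1), (40, 3), (27, 2), (67, 5), (14, 1)]),
  (-187, 8, [11], [(5, 1)]), (197, 8, [], [(6, 1)]), (206, 18, [2], [(43, 3), (29, 2)]),
  (209, 9, [11], [(5, 1), (3, 1)]), (227, 19, [2], []), (-235, 9, [5], []), (237, 9, [3], []),
  (258, 20, [2, 3], [(15, 1), (12, 1)]), (301, 11, [7], [(8, 1), (9, 1), (6, 1)]),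
  (329, 11, [7], [(60, 7), (17, 2)]), (347, 23, [2], [(56, 3), (19, 1), (37, 2), (18, 1)]),
  (357, 12, [3, 7], [(7, 1)]), (381, 12, [3], [(9, 1)]), (393, 12, [3], [(47, 5), (19, 2)]),
  (394, 25, [2], [(20, 1), (19, 1), (22, 1), (17, 1), (16, 1), (24, 1)]), (-427, 13, [7], []),
  (454, 27, [2], [(64, 3), (21, 1), (22, 1), (17, 1), (25, 1)]), (470, 27, [2, 5], [(22, 1)]),
  (489, 14, [3], [(95, 9), (21, 2), (32, 3)]), (517, 14, [11], [(11, 1), (76, 7)]),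
  (553, 14, [7], [(45, 4), (11, 1), (13, 1)]), (569, 15, [], [(80, 7), (23, 2), (11, 1), (35, 3)]),
  (611, 31, [2, 13], [(25, 1), (74, 3), (24, 1), (21, 1)]),
  (619, 31, [2], [(25, 1), (26, 1), (23, 1), (27, 1)]), (635, 32, [2, 5], []),
  (638, 32, [2, 11, 29], [(25, 1), (76, 3), (26, 1), (24, 1), (27, 1)]),
  (681, 16, [3], [(25, 2), (88, 7), (24, 2)]),
  (691, 33, [2], [(79, 3), (27, 1), (25, 1), (28, 1), (22, 1), (31, 1), (16, 1)]),
  (694, 33, [2], [(79, 3), (27, 1), (29, 1), (23, 1), (21, 1)]),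
  (705, 16, [3, 5], [(13, 1), (51, 4), (38, 3)]), (721, 17, [7], [(13, 1), (12, 1), (14, 1)]),
  (737, 17, [11], [(13, 1), (14, 1), (12, 1)]),
  (854, 37, [2, 7], [(29, 1), (30, 1), (28, 1), (32, 1), (22, 1), (19, 1)]),
  (889, 18, [7], [(29, 2), (71, 5), (26, 2), (59, 4)]), (893, 19, [19], [(9, 1), (14, 1), (15, 1)]),
  (917, 19, [7], [(15, 1), (29, 2), (14, 1)]), (1001, 20, [7, 11, 13], [(16, 1), (61, 4), (13, 1)]),
  (1041, 20, [3], [(31, 2), (35, 2), (65, 4), (25, 1)]),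
  (1273, 22, [19], [(52, 3), (17, 1), (69, 4), (15, 1)]),
  (1309, 23, [7, 11, 17], [(35, 2), (17, 1), (16, 1), (12, 1)]), (1397, 23, [11], [(18, 1)]),
  (1501, 24, [19], [(19, 1), (37, 2), (17, 1), (39, 2)]),
  (1589, 25, [7], [(39, 2), (19, 1), (20, 1), (58, 3), (21, 1)]),
  (1645, 25, [5, 7], [(79, 4), (99, 5), (21, 1), (18, 1)]),
  (1857, 27, [3], [(21, 1), (22, 1), (20, 1), (24, 1)]),
  (1905, 27, [3, 5], [(22, 1), (85, 4), (20, 1), (23, 1)]),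
  (1969, 28, [11], [(43, 2), (87, 4), (18, 1), (26, 1)]),
  (2073, 29, [3], [(89, 4), (47, 2), (65, 3), (69, 3), (-4, 1)]),
  (2082, 58, [2, 3], [(46, 1), (91, 2), (45, 1), (48, 1), (42, 1), (50, 1), (38, 1), (56, 1), (60, 1), (68, 1)]),
  (2337, 30, [3, 19], [(71, 3), (47, 2), (22, 1), (19, 1)]),
  (2489, 31, [19], [(49, 2), (24, 1), (25, 1), (23, 1), (22, 1), (97, 4)]),
  (2497, 31, [11], [(49, 2), (21, 1), (97, 4), (51, 2), (75, 3)]),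
  (3817, 39, [11], [(39569, 1302), (1435911, 47248), (4602829, 151454), (5398068167, 177620984), (93912408475, 3090145194), (8, 1)]),
  (4277, 41, [7, 13], [(31, 1)]),
  (4313, 41, [19], [(97, 3), (32, 1), (34, 1), (30, 1), (35, 1), (63, 2), (27, 1), (37, 1)]),
  (4429, 42, [], [(295, 9), (164, 5), (-38, 1), (-25, 1), (-63, 2), (228, 7), (-14, 1)]),
  (4445, 42, [5, 7], [(33, 1), (31, 1), (36, 1), (28, 1)]),
  (5969, 49, [47], [(305, 8), (-79, 2), (-42, 1), (-36, 1), (-80, 2), (-76, 2), (-34, 1)]),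
  (6721, 52, [11, 13, 47], [(81, 2), (38, 1), (36, 1), (45, 1), (35, 1), (33, 1), (31, 1)]),
  (7622, 111, [2, 37, 103], [(87, 1), (88, 1), (95, 1), (74, 1), (71, 1), (66, 1), (-89, 1), (-93, 1), (-80, 1), (100, 1), (102, 1), (-65, 1), (105, 1), (-59, 1)]),
  (7634, 111, [2, 11], [(88, 1), (92, 1), (78, 1), (97, 1), (74, 1), (69, 1), (67, 1), (175, 2), (-86, 1), (-89, 1), (-93, 1), (-95, 1), (-68, 1), (-64, 1), (107, 1), (113, 1)]),
  (11577, 68, [3, 17], [(160, 3), (373, 7), (-55, 1), (107, 2), (-53, 1), (-56, 1), (-51, 1), (-50, 1), (-47, 1)]),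
  (14921, 77, [43], [(121, 2), (303, 5), (-63, 1), (122, 2), (-59, 1), (243, 4), (485, 8), (-58, 1), (302, 5), (-55, 1), (-68, 1)]),
  (18777, 87, [3, 11], [(68, 1), (69, 1), (67, 1), (71, 1), (73, 1), (60, 1), (58, 1), (77, 1), (50, 1), (38, 1)]),
  (27921, 106, [3, 41], [(167, 2), (503, 6), (-83, 2), (-61, 2), (269, 2), (543, 6), (241, 4), (345, 5), (704, 8), (406, 4), (233, 4), (345, 3), (348, 3), (555, 6), (706, 9)]),
  (29842, 220, [2, 43], [(518, 3), (172, 1), (175, 1), (170, 1), (176, 1), (169, 1), (167, 1), (181, 1), (160, 1), (188, 1), (190, 1), (195, 1), (198, 1), (267, 1)]),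
  (29845, 110, [5, 47], [(70, 1), (773, 9), (257, 3), (343, 4), (430, 5), (-90, 1), (-82, 1), (-81, 1), (-93, 1), (431, 5), (-78, 1), (-96, 1), (-99, 1)]),
  (42449, 131, [11, 17], [(205, 2), (307, 3), (204, 2), (923, 9), (717, 7), (-99, 1), (107, 1), (-98, 1), (108, 1), (202, 2), (821, 8), (110, 1), (209, 2), (112, 1), (210, 2), (304, 3), (198, 2), (-73, 1)]),
  (176833, 267, [19, 41, 227], [(6922, 33), (6083, 29), (-1054, 5), (-1897, 9), (8600, 41), (6293, 30), (-1057, 5), (2309, 11), (3148, 15), (9019, 43), (-1479, 7), (-1269, 6), (-1260, 6), (2729, 13), (6082, 29), (4616, 22), (3358, 16), (3987, 19), (-1690, 8), (2520, 12), (3568, 17), (2934, 14), (-1901, 9), (7760, 37), (-1681, 8), (4193, 20), (-1892, 9), (2102, 10), (2093, 10), (-1063, 5), (7339, 35)])]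

def tab5 : List (ℤ × ℕ × ℕ × ℤ × ℤ × List ℕ × List (ℤ × ℤ)) := [
  (-47, 4, 2, 4, 1, [], [(0, 1)]), (-74, 10, 3, 13, 1, [2], [(4, 1)]), (-79, 5, 2, 3, 1, [], [(0, 1)]),
  (-86, 11, 17, 1191, 4, [2], [(4, 1), (7, 1)]), (-103, 6, 2, 2, 1, [], []),
  (-119, 6, 2, 1, 1, [7], [(3, 1), (5, 1)]), (-122, 14, 3, 11, 1, [2], [(2, 1)]), (-127, 7, 2, 0, 1, [], []),
  (-131, 7, 3, 14, 1, [], [(3, 1), (5, 1)]), (-143, 7, 3, 9, 2, [11], [(5, 1), (9, 1)]),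
  (-179, 8, 3, 7, 2, [], [(0, 1)]), (-197, 17, 29, 3339, 218, [2], [(21, 1), (23, 1)]),
  (-209, 18, 5, 54, 1, [2, 11], [(11, 1), (13, 1), (21, 1)]), (-227, 9, 3, 3, 2, [], [(2, 1)]),
  (-266, 20, 11, 255, 19, [2, 7, 19], [(14, 1), (-4, 2)]), (-319, 11, 5, 41, 4, [11], [(5, 1)]),
  (-347, 11, 3, 12, 1, [], [(3, 1)]), (-381, 24, 13, 412, 23, [2, 3], [(3, 1), (12, 1), (13, 1)]),
  (-394, 25, 19, 1005, 61, [2], [(8, 3), (10, 1)]),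
  (-474, 27, 19, 1115, 51, [2, 3], [(18, 1), (20, 1), (-8, 2), (12, 2)]),
  (-489, 28, 61, 4690, 1297, [2, 3], [(11, 1), (19, 1), (36, 1), (18, 2)]),
  (-611, 15, 3, 9, 1, [13], [(6, 1), (9, 3)]), (-619, 15, 5, 54, 1, [], [(4, 1)]),
  (-635, 16, 11, 388, 7, [5], [(2, 1), (5, 1)]),
  (-681, 33, 73, 17732, 1607, [2, 3], [(7, 1), (6, 2), (12, 1), (13, 1), (30, 1)]),
  (-691, 16, 5, 17, 4, [], [(1, 1)]), (-694, 33, 31, 5349, 5, [2], [(22, 1), (13, 2)]),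
  (-737, 34, 37, 2375, 294, [2, 11], [(15, 1), (22, 1), (41, 1), (-4, 2)]),
  (-779, 17, 5, 1, 4, [19], [(9, 1), (0, 3)]),
  (-917, 38, 53, 19911, 154, [2, 7], [(14, 1), (35, 1), (39, 1)]),
  (-1273, 45, 17, 1183, 4, [2, 19], [(11, 1), (19, 1), (57, 1), (-2, 2), (12, 2)]),
  (-1707, 26, 7, 35, 6, [3], [(7, 1), (7, 2), (3, 3)]),
  (-1786, 53, 17, 461, 26, [2, 19, 47], [(4, 1), (38, 1), (72, 1), (16, 2), (20, 2)]),
  (-1857, 54, 37, 7177, 98, [2, 3], [(17, 1), (54, 1), (57, 1), (10, 3), (27, 3)]),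
  (-1969, 56, 5, 34, 1, [2, 11], [(9, 1), (11, 1), (46, 1), (49, 1)]),
  (-2073, 58, 37, 7970, 53, [2, 3], [(6, 1), (31, 1), (43, 1), (56, 3), (87, 3), (99, 3)]),
  (-3178, 71, 11, 73, 7, [2, 7], [(21, 1), (26, 1), (45, 1), (67, 1), (76, 1)]),
  (-3683, 38, 13, 601, 3, [29], [(14, 1)]), (-3811, 39, 7, 113, 2, [37], [(18, 1), (-9, 2)]),
  (-3817, 78, 53, 34, 331, [2, 11], [(9, 5), (22, 1), (23, 1), (77, 2), (99, 2)]),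
  (-3859, 39, 19, 1253, 30, [17], [(25, 1), (44, 1), (50, 1)]),
  (-6259, 50, 5, 39, 1, [11], [(5, 1), (34, 1)]),
  (-7467, 55, 7, 1, 3, [3, 19], [(15, 1), (28, 1), (47, 1), (58, 1), (70, 1), (75, 1), (78, 1), (59, 2)]),
  (-9307, 61, 23, 1735, 38, [41], [(81, 2), (87, 2), (41, 3), (73, 5)]),
  (-10507, 65, 11, 387, 2, [7, 19, 79], [(9, 1), (-4, 1), (12, 1), (31, 1), (39, 1), (42, 1), (45, 1), (61, 1), (73, 1)]),
  (-17907, 85, 37, 8321, 4, [3, 47, 127], [(37, 1), (63, 1), (37, 6), (47, 7), (67, 7), (66, 9), (-19, 1), (-21, 1), (-29, 1)]),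
  (-31003, 112, 23, 1081, 26, [7, 43, 103], [(45, 1), (51, 1), (20, 3), (23, 3), (46, 3), (50, 3), (77, 3), (-3, 4), (-6, 5)])]


def chk0 (t : ℤ × ℕ × List ℕ × List (ℤ × ℤ)) : Bool := qchk t.1 t.2.1 [] t.2.2.1 t.2.2.2

def chk5 (t : ℤ × ℕ × ℕ × ℤ × ℤ × List ℕ × List (ℤ × ℤ)) : Bool :=
  match t with
  | (d, B, p, u, v, g, l) => prb p && decide ((qn d u v).natAbs = p ^ 5) && decide ((2 * u + tr d * v) % p ≠ 0) &&
    decide (d < 0) && nsq d.natAbs p && qchk d B [p] g l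

lemma tab0_ok : tab0.all chk0 = true := by decide +kernel
lemma tab5_ok : tab5.all chk5 = true := by decide +kernel

lemma T0_of {d : ℤ} (h : d ∈ tab0.map Prod.fst) : T0 d := by
  obtain ⟨t, ht, rfl⟩ := List.mem_map.mp h
  have h1 := List.all_eq_true.mp tab0_ok t ht
  intro F _ _ e m he c
  rw [chk0, ← he] at h1
  exact quad_triv m h1 c

lemma T5_of {d : ℤ} (h : d ∈ tab5.map Prod.fst) : T5 d := by
  obtain ⟨⟨d, B, p, u, v, g, l⟩, ht, rfl⟩ := List.mem_map.mp h
  have h1 := List.all_eq_true.mp tab5_ok _ ht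
  intro F _ _ e m he
  simp only at he
  subst he
  simp only [chk5, Bool.and_eq_true, decide_eq_true_eq] at h1
  obtain ⟨⟨⟨⟨⟨h1, h2⟩, h3⟩, h4⟩, h5⟩, h6⟩ := h1
  obtain ⟨P, x, hP, hP0, -, hx, hn, -, -, hc⟩ := quad_five m h6 h1 h2 h3
  refine ⟨P, hP0, by rw [← cl_pow hP0, hx, cl_span], im_ne m (prb_prime h1).ne_zero hn h4 h5, hc⟩

end Quin

namespace Quin
section
variable {F : Type*} [Field F] [NumberField F]

lemma exists_hom {d : Fin 1 → ℤ} (m : MQ 1 F d) {q : ℕ} (hq : q.Prime) (u : ℤ) (h1 : (q : ℤ) ∣ qn (d 0) u 1)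
    (h2 : ¬ ((q ^ 2 : ℕ) : ℤ) ∣ qn (d 0) u 1) : Nonempty (𝓞 F →+* ZMod q) := by
  obtain ⟨x, hx, -⟩ := q_ex m u 1
  have h3 := q_el m hx
  have h0 : Ideal.span {x} ≠ ⊥ := by
    intro h
    rw [h, Ideal.absNorm_bot] at h3
    apply h2
    rw [Int.natAbs_eq_zero.mp h3.symm]; exact dvd_zero _
  obtain ⟨Q, hQ, hQ0, hqQ, hd⟩ := exists_over h0 hq (by rw [h3]; exact Int.natCast_dvd.mp h1) (q_fin m)
  have h4 : Ideal.absNorm Q = q := by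
    rcases absNorm_prime hQ hq hqQ (q_fin m) with h | h
    · exact h
    · exfalso
      have h5 : Ideal.absNorm Q ∣ Ideal.absNorm (Ideal.span {x}) := Ideal.absNorm_dvd_absNorm_of_le (Ideal.le_of_dvd hd)
      rw [h, h3] at h5
      exact h2 (Int.natCast_dvd.mpr h5)
  rw [Ideal.absNorm_apply, Submodule.cardQuot_apply] at h4
  have : Finite (𝓞 F ⧸ Q) := Nat.finite_of_card_ne_zero (by rw [h4]; exact hq.ne_zero)
  let _ := Fintype.ofFinite (𝓞 F ⧸ Q)
  rw [Nat.card_eq_fintype_card] at h4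
  exact ⟨(ZMod.ringEquivOfPrime (𝓞 F ⧸ Q) hq h4).symm.toRingHom.comp (Ideal.Quotient.mk Q)⟩

lemma tors5 (hf : Module.finrank ℚ F = 2) (ζ : Units.torsion F) : ∃ w : Units.torsion F, ζ = w ^ 5 := by
  have h : (Nat.card (Units.torsion F)).Coprime 5 := by
    rw [Nat.coprime_comm, Nat.Prime.coprime_iff_not_dvd Nat.prime_five]
    intro h5
    have : Fact (Nat.Prime 5) := ⟨Nat.prime_five⟩
    obtain ⟨w, hw⟩ := exists_prime_orderOf_dvd_card' 5 h5
    have h6 : IsPrimitiveRoot (((w : (𝓞 F)ˣ) : 𝓞 F) : F) 5 := by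
      have h7 := IsPrimitiveRoot.orderOf w
      rw [hw] at h7
      have h8 := (h7.map_of_injective (f := (Units.torsion F).subtype) Subtype.val_injective)
      have h9 := IsPrimitiveRoot.coe_units_iff.mpr h8
      exact h9.map_of_injective (f := algebraMap (𝓞 F) F) RingOfIntegers.coe_injective
    have h7 := h6.totient_le_degree_minpoly
    have h8 : (minpoly ℤ (((w : (𝓞 F)ˣ) : 𝓞 F) : F)).natDegree ≤ 2 := by
      have := minpoly.isIntegrallyClosed_eq_field_fractions' ℚ (((w : (𝓞 F)ˣ) : 𝓞 F)).isIntegral_coe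
      have h9 := minpoly.natDegree_le (A := ℚ) (((w : (𝓞 F)ˣ) : 𝓞 F) : F)
      rw [this, (minpoly.monic (((w : (𝓞 F)ˣ) : 𝓞 F)).isIntegral_coe).natDegree_map, hf] at h9
      exact h9
    have : Nat.totient 5 = 4 := by decide
    omega
  obtain ⟨w, hw⟩ := (powCoprime h).surjective ζ
  exact ⟨w, hw.symm⟩

lemma units5 (hf : Module.finrank ℚ F = 2) (ε : (𝓞 F)ˣ) (hε : ∀ w : (𝓞 F)ˣ, ε ≠ w ^ 5) (v : (𝓞 F)ˣ) :
    ∃ (k : ℤ) (w : (𝓞 F)ˣ), v = ε ^ k * w ^ 5 := by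
  obtain ⟨η, hη⟩ : ∃ η : (𝓞 F)ˣ, ∀ u : (𝓞 F)ˣ, ∃ (j : ℤ) (w : (𝓞 F)ˣ), u = η ^ j * w ^ 5 := by
    have hr := rank_two hf
    rcases Nat.lt_or_ge 0 (Units.rank F) with h0 | h0
    · refine ⟨Units.fundSystem F ⟨0, h0⟩, fun u => ?_⟩
      obtain ⟨⟨ζ, e⟩, he, -⟩ := Units.exist_unique_eq_mul_prod F u
      obtain ⟨w, hw⟩ := tors5 hf ζ
      refine ⟨e ⟨0, h0⟩, w, ?_⟩
      have : ∀ i : Fin (Units.rank F), i = ⟨0, h0⟩ := fun i => Fin.ext (by have := i.2; simp; omega)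
      rw [he, Finset.prod_eq_single ⟨0, h0⟩ (fun i _ hi => absurd (this i) hi) (by simp), hw, mul_comm]
      simp
    · refine ⟨1, fun u => ?_⟩
      obtain ⟨⟨ζ, e⟩, he, -⟩ := Units.exist_unique_eq_mul_prod F u
      obtain ⟨w, hw⟩ := tors5 hf ζ
      refine ⟨0, w, ?_⟩
      rw [he, Finset.prod_eq_one (fun i _ => absurd i.2 (by omega)), hw]
      simp
  obtain ⟨j, w, hw⟩ := hη ε
  have hj : ¬ (5 : ℤ) ∣ j := by
    rintro ⟨i, rfl⟩
    apply hε (η ^ i * w)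
    rw [hw, mul_pow, mul_comm (5 : ℤ), zpow_mul]; rfl
  have hc : IsCoprime (5 : ℤ) j := (Int.prime_iff_natAbs_prime.mpr (by norm_num)).coprime_iff_not_dvd.mpr hj
  obtain ⟨a, b, hab⟩ := hc
  obtain ⟨i, w', hw'⟩ := hη v
  refine ⟨b * i, (η ^ (a * i)) * (w ^ (-(b * i))) * w', ?_⟩
  have h1 : η ^ i = (η ^ j) ^ (b * i) * (η ^ (a * i)) ^ (5 : ℤ) := by
    rw [← zpow_mul, ← zpow_mul, ← zpow_add]; congr 1; linear_combination -i * hab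
  have h2 : η ^ j = ε * (w ^ 5)⁻¹ := by rw [hw]; simp
  have h3 : ((w ^ 5)⁻¹) ^ (b * i) = (w ^ (-(b * i))) ^ 5 := by
    rw [inv_zpow, zpow_neg, inv_pow, ← zpow_natCast, ← zpow_natCast, ← zpow_mul, ← zpow_mul, mul_comm]
  rw [hw', h1, h2, mul_zpow, mul_pow, mul_pow, h3, mul_assoc, mul_assoc, mul_comm ((w ^ (-(b * i))) ^ 5), mul_right_comm]
  rfl

lemma hom_root {d : Fin 1 → ℤ} (m : MQ 1 F d) {q : ℕ} (f : 𝓞 F →+* ZMod q) {x : 𝓞 F} {N t : ℤ} (h1 : x * m.g 0 • x = N)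
    (h2 : x + m.g 0 • x = t) : f x * f x - t * f x + N = 0 := by
  have h3 : x * x - t * x + N = 0 := by rw [← h1, ← h2]; ring
  simpa using congrArg f h3

lemma ddc1 : ∀ r : ZMod 41, r * r - ((3210 : ℤ) : ZMod 41) * r + ((-16807 : ℤ) : ZMod 41) = 0 → r ^ 8 ≠ 1 := by decide +kernel

lemma ddc2 : ∀ r : ZMod 41, r * r - ((2042616067666 : ℤ) : ZMod 41) * r + ((1 : ℤ) : ZMod 41) = 0 → r ^ 8 = 1 := by decide +kernel

lemma ddc3 : ∀ r : ZMod 71, r * r - ((2042616067666 : ℤ) : ZMod 71) * r + ((1 : ℤ) : ZMod 71) = 0 → r ^ 14 ≠ 1 := by decide +kernel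

lemma ddc4 : ¬ ((0 : ZMod 41) * 0 - ((3210 : ℤ) : ZMod 41) * 0 + ((-16807 : ℤ) : ZMod 41) = 0) := by decide +kernel

lemma T5_40513 : T5 40513 := by
  intro F _ _ e m he
  have hf := q_fin m
  obtain ⟨P, x, hP, hP0, -, hx, hn, hx1, hx2, hc⟩ := quad_five m (B := 128) (p := 7) (u := 1597) (v := 16) (g1 := [11, 29, 127])
    (l := [(71,2),(197,2),(799,8),(306,3),(598,6),(116,1),(-82,1),(405,4),(-81,1),(191,2),(294,3),(293,3),(804,8),(309,3)])
    (by rw [he]; decide +kernel) (by decide +kernel) (by rw [he]; decide +kernel) (by rw [he]; decide +kernel)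
  refine ⟨P, hP0, by rw [← cl_pow hP0, hx, cl_span], ?_, hc⟩
  intro h1
  have e1 : qn (e 0) 1597 16 = -16807 := by rw [he]; decide +kernel
  have e2 : 2 * 1597 + tr (e 0) * 16 = 3210 := by rw [he]; decide +kernel
  rw [e1] at hx1
  rw [e2] at hx2
  obtain ⟨ε0, a1, a2⟩ := q_ex m (1021308033833 - 5074106124) 10148212248
  have e3 : qn (e 0) (1021308033833 - 5074106124) 10148212248 = 1 := by rw [he]; decide +kernel
  have e4 : 2 * (1021308033833 - 5074106124) + tr (e 0) * 10148212248 = 2042616067666 := by rw [he]; decide +kernel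
  rw [e3] at a1
  rw [e4] at a2
  set ε : (𝓞 F)ˣ := Units.mkOfMulEqOne ε0 _ (by rw [a1]; simp) with hεd
  have hεc : (ε : 𝓞 F) = ε0 := rfl
  have : Fact (Nat.Prime 41) := ⟨by norm_num⟩
  have : Fact (Nat.Prime 71) := ⟨by norm_num⟩
  obtain ⟨f⟩ := exists_hom m (q := 41) (by norm_num) (-35) (by rw [he]; decide +kernel) (by rw [he]; decide +kernel)
  obtain ⟨f'⟩ := exists_hom m (q := 71) (by norm_num) (-28) (by rw [he]; decide +kernel) (by rw [he]; decide +kernel)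
  have b1 := hom_root m f hx1 hx2
  have b2 := hom_root m f a1 a2
  have b3 := hom_root m f' a1 a2
  have hε : ∀ w : (𝓞 F)ˣ, ε ≠ w ^ 5 := by
    intro w hw
    apply ddc3 _ b3
    rw [← hεc, hw, Units.val_pow_eq_pow_val, map_pow, ← pow_mul]
    exact ZMod.pow_card_sub_one_eq_one ((w.isUnit.map f').ne_zero)
  rw [cl_eq_one_iff] at h1
  obtain ⟨y, hy⟩ := h1
  rw [Ideal.submodule_span_eq] at hy
  rw [hy, Ideal.span_singleton_pow, Ideal.span_singleton_eq_span_singleton] at hx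
  obtain ⟨v, hv⟩ := hx
  obtain ⟨k, w, rfl⟩ := units5 hf ε hε v
  apply ddc1 _ b1
  have hx0 : f x ≠ 0 := by
    intro h
    rw [h] at b1
    exact ddc4 b1
  have b4 : Units.map f.toMonoidHom ε ^ 8 = 1 := by
    apply Units.ext
    exact ddc2 _ b2
  have b5 : f ((ε ^ k : (𝓞 F)ˣ) : 𝓞 F) ^ 8 = 1 := by
    have : ((Units.map f.toMonoidHom (ε ^ k) ^ 8 : (ZMod 41)ˣ) : ZMod 41) = 1 := by
      rw [map_zpow, ← zpow_natCast, ← zpow_mul, mul_comm, zpow_mul, zpow_natCast, b4]; simp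
    exact this
  have b6 : f y ^ 40 = 1 := by
    apply ZMod.pow_card_sub_one_eq_one
    intro h
    apply hx0
    rw [← hv, map_mul, map_pow, h]; simp
  have b7 : f (w : 𝓞 F) ^ 40 = 1 := ZMod.pow_card_sub_one_eq_one ((w.isUnit.map f).ne_zero)
  rw [← hv, Units.val_mul, Units.val_pow_eq_pow_val, map_mul, map_mul, map_pow, map_pow, mul_pow, mul_pow, b5, ← pow_mul, ← pow_mul, b6, b7]
  simp

end
end Quin

namespace Quin

/-- the quadratic characters -/
def chi (S : Fin 3 → Bool) : (Fin 3 → ℤˣ) →* ℤˣ where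
  toFun ε := ∏ i, if S i then ε i else 1
  map_one' := by simp
  map_mul' ε δ := by
    rw [← Finset.prod_mul_distrib]
    refine Finset.prod_congr rfl fun i _ => ?_
    split <;> simp

/-- trivial character -/
def S0 : Fin 3 → Bool := fun _ => false

lemma chi_count (ε : Fin 3 → ℤˣ) : (Finset.univ.filter fun S : Fin 3 → Bool => S ≠ S0 ∧ chi S ε = 1).card = if ε = 1 then 7 else 3 := by
  revert ε; decide +kernel

lemma chi_ex (S : Fin 3 → Bool) (hS : S ≠ S0) : ∃ ε, chi S ε = -1 := by
  revert S; decide +kernel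

lemma chi_orth (S T : Fin 3 → Bool) (hS : S ≠ S0) (hT : T ≠ S0) :
    (∑ ε with chi T ε = 1, ((chi S ε : ℤˣ) : ℤ)) = if S = T then 4 else 0 := by
  revert S T; decide +kernel

lemma chi_card (S : Fin 3 → Bool) (hS : S ≠ S0) : (Finset.univ.filter fun ε => chi S ε = 1).card = 4 := by
  revert S; decide +kernel

lemma chi_sum (S : Fin 3 → Bool) (hS : S ≠ S0) : (Finset.univ.filter fun ε => chi S ε = -1).card = 4 := by
  revert S; decide +kernel

section
variable {C : Type*} [CommGroup C]

lemma odd_mem (hodd : ∀ c : C, ∃ n, Odd n ∧ c ^ n = 1) (R : Subgroup C) {c : C} {k : ℕ} (h : c ^ 2 ^ k ∈ R) : c ∈ R := by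
  obtain ⟨n, hn, hc⟩ := hodd c
  have h1 : (2 ^ k).Coprime (orderOf c) := by
    apply Nat.Coprime.pow_left
    rw [Nat.coprime_two_left]
    exact Odd.of_dvd_nat hn (orderOf_dvd_of_pow_eq_one hc)
  obtain ⟨j, hj⟩ := exists_pow_eq_self_of_coprime h1
  rw [← hj]
  exact R.pow_mem h j

/-- the homomorphism from `ZMod 5` attached to an element of order dividing five -/
noncomputable def phi (e : C) (he : e ^ 5 = 1) : Multiplicative (ZMod 5) →* C :=
  AddMonoidHom.toMultiplicativeLeft (ZMod.lift 5 ⟨(zmultiplesHom (Additive C)) (Additive.ofMul e), by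
    change (5 : ℤ) • Additive.ofMul e = 0
    have : Additive.ofMul (e ^ 5) = 0 := by rw [he]; rfl
    rw [ofMul_pow] at this
    exact_mod_cast this⟩)

lemma phi_spec (e : C) (he : e ^ 5 = 1) (j : ℤ) : phi e he (Multiplicative.ofAdd (j : ZMod 5)) = e ^ j := by
  change Additive.toMul (ZMod.lift 5 (⟨(zmultiplesHom (Additive C)) (Additive.ofMul e), _⟩ : { f : ℤ →+ Additive C // f (5 : ℕ) = 0 }) (j : ZMod 5)) = _
  rw [ZMod.lift_coe]
  rfl

lemma phi_range (e : C) (he : e ^ 5 = 1) {c : C} (hc : c ∈ Subgroup.zpowers e) : ∃ v, phi e he v = c := by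
  obtain ⟨j, rfl⟩ := hc
  exact ⟨_, phi_spec e he j⟩

lemma phi_mem (e : C) (he : e ^ 5 = 1) (v) : ∃ j : ℤ, phi e he v = e ^ j := by
  obtain ⟨j, hj⟩ := ZMod.intCast_surjective (Multiplicative.toAdd v)
  exact ⟨j, by rw [← phi_spec e he j, hj]; rfl⟩

lemma phi_inj (e : C) (he : e ^ 5 = 1) (h1 : e ≠ 1) {v} (hv : phi e he v = 1) : v = 1 := by
  obtain ⟨j, hj⟩ := ZMod.intCast_surjective (Multiplicative.toAdd v)
  have h2 : v = Multiplicative.ofAdd (j : ZMod 5) := by rw [hj]; rfl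
  rw [h2, phi_spec] at hv
  have : Fact (Nat.Prime 5) := ⟨Nat.prime_five⟩
  have h3 : orderOf e = 5 := orderOf_eq_prime he h1
  rw [← orderOf_dvd_iff_zpow_eq_one, h3] at hv
  rw [h2, (ZMod.intCast_zmod_eq_zero_iff_dvd j 5).mpr hv]; rfl

theorem grp (hodd : ∀ c : C, ∃ n, Odd n ∧ c ^ n = 1) (A : (Fin 3 → ℤˣ) → C →* C)
    (hA : ∀ ε δ c, A ε (A δ c) = A (ε * δ) c) (hA0 : ∀ c, A 1 c = c) (hA1 : ∀ c, ∏ ε, A ε c = 1)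
    (im : (Fin 3 → Bool) → C → Prop)
    (h1 : ∀ S, S ≠ S0 → ∀ c, im S (∏ ε with chi S ε = 1, A ε c))
    (h2 : ∀ S, S ≠ S0 → ∀ c, im S c → ∀ ε, chi S ε = 1 → A ε c = c)
    (J : (Fin 3 → Bool) → Prop) [DecidablePred J]
    (h5 : ∀ S, S ≠ S0 → J S → ∃ e, im S e ∧ e ^ 5 = 1 ∧ e ≠ 1 ∧ ∀ c, im S c → ∃ k : ℕ, c ^ 2 ^ k ∈ Subgroup.zpowers e)
    (h0 : ∀ S, S ≠ S0 → ¬ J S → ∀ c, im S c → ∃ k : ℕ, c ^ 2 ^ k = 1)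
    {n : ℕ} (hn : Fintype.card {S // S ≠ S0 ∧ J S} = n) : Nonempty (C ≃* (Fin n → Multiplicative (ZMod 5))) := by
  have ho1 : ∀ (c : C) (k : ℕ), c ^ 2 ^ k = 1 → c = 1 := fun c k h => by
    have := odd_mem hodd ⊥ (c := c) (k := k) (Subgroup.mem_bot.mpr h)
    exact Subgroup.mem_bot.mp this
  have hin : ∀ S, S ≠ S0 → ∀ c, im S c → ∀ ε, A ε c = c ^ ((chi S ε : ℤˣ) : ℤ) := by
    intro S hS c hc ε
    rcases Int.units_eq_one_or (chi S ε) with h | h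
    · rw [h, h2 S hS c hc ε h]; simp
    · have h3 : ∀ δ, A δ c = if chi S δ = 1 then c else A ε c := by
        intro δ
        split_ifs with hd
        · exact h2 S hS c hc δ hd
        · have hd' : chi S δ = -1 := (Int.units_eq_one_or _).resolve_left hd
          have h4 : A (ε * δ) c = c := h2 S hS c hc _ (by rw [map_mul, h, hd']; rfl)
          have h5 : ε * (ε * δ) = δ := by
            rw [← mul_assoc]
            have : ε * ε = 1 := by ext i; simp
            rw [this, one_mul]
          rw [← h5, ← hA, h4]
      have h6 := hA1 c
      rw [Finset.prod_congr rfl (fun δ _ => h3 δ), Finset.prod_ite, Finset.prod_const, Finset.prod_const, chi_card S hS] at h6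
      have h7 : (Finset.univ.filter fun ε => ¬ chi S ε = 1).card = 4 := by
        rw [← chi_sum S hS]; congr 1; ext δ
        simp only [Finset.mem_filter, Finset.mem_univ, true_and]
        constructor
        · intro h; exact (Int.units_eq_one_or _).resolve_left h
        · intro h; rw [h]; decide
      rw [h7, ← mul_pow] at h6
      have h8 := ho1 (c * A ε c) 2 h6
      rw [h]
      simp only [Units.val_neg, Units.val_one, zpow_neg, zpow_one]
      exact eq_inv_of_mul_eq_one_right h8
  set N : (Fin 3 → Bool) → C →* C := fun T => ∏ ε with chi T ε = 1, A ε with hN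
  have hNa : ∀ T c, N T c = ∏ ε with chi T ε = 1, A ε c := fun T c => by rw [hN]; simp
  have hNim : ∀ S T, S ≠ S0 → T ≠ S0 → ∀ c, im S c → N T c = if S = T then c ^ 4 else 1 := by
    intro S T hS hT c hc
    rw [hNa, Finset.prod_congr rfl (fun ε _ => hin S hS c hc ε)]
    have : ∀ s : Finset (Fin 3 → ℤˣ), ∏ ε ∈ s, c ^ ((chi S ε : ℤˣ) : ℤ) = c ^ (∑ ε ∈ s, ((chi S ε : ℤˣ) : ℤ)) := by
      intro s
      induction s using Finset.induction_on with
      | empty => simp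
      | insert a s ha ih => rw [Finset.prod_insert ha, Finset.sum_insert ha, ih, zpow_add]
    rw [this, chi_orth S T hS hT]
    split_ifs
    · exact zpow_natCast c 4
    · simp
  have hc4 : ∀ c, c ^ 4 = ∏ S with S ≠ S0, N S c := by
    intro c
    simp only [hNa, Finset.prod_filter]
    have : ∀ S : Fin 3 → Bool, (if S ≠ S0 then ∏ ε, (if chi S ε = 1 then A ε c else 1) else 1) =
        ∏ ε, (if S ≠ S0 ∧ chi S ε = 1 then A ε c else 1) := by
      intro S
      by_cases h : S = S0 <;> simp [h]
    rw [Finset.prod_congr rfl (fun S _ => this S), Finset.prod_comm]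
    have h3 : ∀ ε, ∏ S, (if S ≠ S0 ∧ chi S ε = 1 then A ε c else 1) = (A ε c) ^ 3 * (if ε = 1 then c ^ 4 else 1) := by
      intro ε
      rw [← Finset.prod_filter, Finset.prod_const, chi_count]
      split_ifs with h
      · rw [h, hA0]; group
      · simp
    rw [Finset.prod_congr rfl (fun ε _ => h3 ε), Finset.prod_mul_distrib, Finset.prod_pow, hA1]
    simp
  choose e he using fun S : {S // S ≠ S0 ∧ J S} => h5 S.1 S.2.1 S.2.2
  let Φ : ({S // S ≠ S0 ∧ J S} → Multiplicative (ZMod 5)) →* C :=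
    ∏ S, (phi (e S) (he S).2.1).comp (Pi.evalMonoidHom _ S)
  have hΦ : ∀ v, Φ v = ∏ S, phi (e S) (he S).2.1 (v S) := by
    intro v
    simp [Φ]
  have hinj : Function.Injective Φ := by
    rw [injective_iff_map_eq_one]
    intro v hv
    ext1 T
    apply phi_inj (e T) (he T).2.1 (he T).2.2.1
    have h3 := congrArg (N T) hv
    rw [hΦ, map_prod, map_one] at h3
    have h4 : ∀ S : {S // S ≠ S0 ∧ J S}, N T (phi (e S) (he S).2.1 (v S)) = if S = T then (phi (e T) (he T).2.1 (v T)) ^ 4 else 1 := by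
      intro S
      obtain ⟨j, hj⟩ := phi_mem (e S) (he S).2.1 (v S)
      rw [hj, map_zpow, hNim S T S.2.1 T.2.1 _ (he S).1]
      by_cases h : S = T
      · subst h
        rw [if_pos rfl, if_pos rfl, hj, ← zpow_natCast, ← zpow_natCast, ← zpow_mul, ← zpow_mul, mul_comm]
      · rw [if_neg (fun h' => h (Subtype.ext h')), if_neg h, one_zpow]
    rw [Finset.prod_congr rfl (fun S _ => h4 S), Finset.prod_ite_eq' ] at h3
    simp only [Finset.mem_univ, if_true] at h3
    exact ho1 _ 2 h3
  have hsurj : Function.Surjective Φ := by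
    rw [← MonoidHom.range_eq_top, eq_top_iff]
    intro c _
    have hsub : ∀ S, S ≠ S0 → N S c ∈ Φ.range := by
      intro S hS
      have hi : im S (N S c) := by rw [hNa]; exact h1 S hS c
      by_cases hJ : J S
      · obtain ⟨k, hk⟩ := (he ⟨S, hS, hJ⟩).2.2.2 _ hi
        apply odd_mem hodd Φ.range (k := k)
        obtain ⟨v, hv⟩ := phi_range _ (he ⟨S, hS, hJ⟩).2.1 hk
        refine ⟨Pi.mulSingle ⟨S, hS, hJ⟩ v, ?_⟩
        rw [hΦ, Finset.prod_eq_single ⟨S, hS, hJ⟩]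
        · rw [Pi.mulSingle_eq_same, hv]
        · intro T _ hT
          rw [Pi.mulSingle_eq_of_ne hT, map_one]
        · simp
      · obtain ⟨k, hk⟩ := h0 S hS hJ _ hi
        rw [ho1 _ k hk]
        exact Φ.range.one_mem
    apply odd_mem hodd Φ.range (k := 2)
    change c ^ 4 ∈ _
    rw [hc4]
    exact Subgroup.prod_mem _ fun S hS => hsub S (Finset.mem_filter.mp hS).2
  refine ⟨(MulEquiv.ofBijective Φ ⟨hinj, hsurj⟩).symm.trans ?_⟩
  exact (MulEquiv.arrowCongr (Fintype.equivFinOfCardEq hn) (MulEquiv.refl _))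

end
end Quin

namespace Quin
section
variable {K : Type*} [Field K] [NumberField K]

lemma cl_smul_congr (g : K ≃ₐ[ℚ] K) {I J : Ideal (𝓞 K)} (hI : I ≠ ⊥) (hJ : J ≠ ⊥) (h : cl I = cl J) : cl (g • I) = cl (g • J) := by
  rw [cl_eq_iff hI hJ] at h
  obtain ⟨x, y, hx, hy, h⟩ := h
  rw [cl_eq_iff (smul_ne_bot g hI) (smul_ne_bot g hJ)]
  refine ⟨g • x, g • y, (smul_ne_zero_iff_ne g).mpr hx, (smul_ne_zero_iff_ne g).mpr hy, ?_⟩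
  rw [← smul_span, ← smul_span, ← smul_mul', ← smul_mul', h]

/-- action on the class group -/
noncomputable def act0 (g : K ≃ₐ[ℚ] K) (c : ClassGroup (𝓞 K)) : ClassGroup (𝓞 K) := cl (g • (cl_surj c).choose)

lemma act0_cl (g : K ≃ₐ[ℚ] K) {I : Ideal (𝓞 K)} (hI : I ≠ ⊥) : act0 g (cl I) = cl (g • I) :=
  cl_smul_congr g (cl_surj (cl I)).choose_spec.1 hI (cl_surj (cl I)).choose_spec.2

/-- action on the class group -/
noncomputable def act (g : K ≃ₐ[ℚ] K) : ClassGroup (𝓞 K) →* ClassGroup (𝓞 K) := MonoidHom.mk' (act0 g) (by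
  intro a b
  obtain ⟨I, hI, rfl⟩ := cl_surj a
  obtain ⟨J, hJ, rfl⟩ := cl_surj b
  rw [← cl_mul hI hJ, act0_cl g hI, act0_cl g hJ, act0_cl g (mul_ne_zero hI hJ), smul_mul', cl_mul (smul_ne_bot g hI) (smul_ne_bot g hJ)])

lemma act_cl (g : K ≃ₐ[ℚ] K) {I : Ideal (𝓞 K)} (hI : I ≠ ⊥) : act g (cl I) = cl (g • I) := act0_cl g hI

lemma act_act (g h : K ≃ₐ[ℚ] K) (c : ClassGroup (𝓞 K)) : act g (act h c) = act (g * h) c := by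
  obtain ⟨I, hI, rfl⟩ := cl_surj c
  rw [act_cl h hI, act_cl g (smul_ne_bot h hI), act_cl _ hI, mul_smul]

lemma act_one (c : ClassGroup (𝓞 K)) : act (1 : K ≃ₐ[ℚ] K) c = c := by
  obtain ⟨I, hI, rfl⟩ := cl_surj c
  rw [act_cl _ hI, one_smul]

/-- map on ideal classes -/
lemma map_ne_bot {k : IntermediateField ℚ K} {I : Ideal (𝓞 k)} (hI : I ≠ ⊥) : I.map (algebraMap (𝓞 k) (𝓞 K)) ≠ ⊥ := by
  rwa [Ne, Ideal.map_eq_bot_iff_of_injective (FaithfulSMul.algebraMap_injective (𝓞 k) (𝓞 K))]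

lemma cl_map_congr {k : IntermediateField ℚ K} {I J : Ideal (𝓞 k)} (hI : I ≠ ⊥) (hJ : J ≠ ⊥) (h : cl I = cl J) :
    cl (I.map (algebraMap (𝓞 k) (𝓞 K))) = cl (J.map (algebraMap (𝓞 k) (𝓞 K))) := by
  rw [cl_eq_iff hI hJ] at h
  obtain ⟨x, y, hx, hy, h⟩ := h
  rw [cl_eq_iff (map_ne_bot hI) (map_ne_bot hJ)]
  have hinj := FaithfulSMul.algebraMap_injective (𝓞 k) (𝓞 K)
  refine ⟨algebraMap _ _ x, algebraMap _ _ y, (map_ne_zero_iff _ hinj).mpr hx, (map_ne_zero_iff _ hinj).mpr hy, ?_⟩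
  have := congrArg (Ideal.map (algebraMap (𝓞 k) (𝓞 K))) h
  rwa [Ideal.map_mul, Ideal.map_mul, Ideal.map_span, Ideal.map_span, Set.image_singleton, Set.image_singleton] at this

/-- extension of classes -/
noncomputable def ext (k : IntermediateField ℚ K) : ClassGroup (𝓞 k) →* ClassGroup (𝓞 K) :=
  MonoidHom.mk' (fun c => cl ((cl_surj c).choose.map (algebraMap (𝓞 k) (𝓞 K)))) (by
  have key : ∀ I : Ideal (𝓞 k), I ≠ ⊥ → cl ((cl_surj (cl I)).choose.map (algebraMap (𝓞 k) (𝓞 K))) = cl (I.map (algebraMap (𝓞 k) (𝓞 K))) :=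
    fun I hI => cl_map_congr (cl_surj (cl I)).choose_spec.1 hI (cl_surj (cl I)).choose_spec.2
  intro a b
  obtain ⟨I, hI, rfl⟩ := cl_surj a
  obtain ⟨J, hJ, rfl⟩ := cl_surj b
  rw [← cl_mul hI hJ, key I hI, key J hJ, key _ (mul_ne_zero hI hJ), Ideal.map_mul, cl_mul (map_ne_bot hI) (map_ne_bot hJ)])

lemma ext_cl (k : IntermediateField ℚ K) {I : Ideal (𝓞 k)} (hI : I ≠ ⊥) : ext k (cl I) = cl (I.map (algebraMap (𝓞 k) (𝓞 K))) :=
  cl_map_congr (cl_surj (cl I)).choose_spec.1 hI (cl_surj (cl I)).choose_spec.2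

lemma ext_inj (k : IntermediateField ℚ K) (h4 : Module.finrank k K = 4) (c : ClassGroup (𝓞 k)) (h5 : c ^ 5 = 1) (h : ext k c = 1) : c = 1 := by
  obtain ⟨I, hI, rfl⟩ := cl_surj c
  rw [ext_cl k hI, cl_eq_one_iff] at h
  obtain ⟨x, hx⟩ := h
  rw [Ideal.submodule_span_eq] at hx
  have h1 := congrArg (Ideal.relNorm (𝓞 k)) hx
  rw [Ideal.relNorm_algebraMap, Ideal.relNorm_singleton, finrank_ints, h4] at h1
  have h2 : cl I ^ 4 = 1 := by rw [← cl_pow hI, h1, cl_span]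
  calc cl I = cl I ^ 5 * (cl I ^ 4)⁻¹ := by group
    _ = 1 := by rw [h5, h2]; simp

lemma smul_map_fixed (H : Subgroup (K ≃ₐ[ℚ] K)) {g : K ≃ₐ[ℚ] K} (hg : g ∈ H) (I : Ideal (𝓞 (IntermediateField.fixedField H))) :
    g • (I.map (algebraMap (𝓞 (IntermediateField.fixedField H)) (𝓞 K))) = I.map (algebraMap (𝓞 (IntermediateField.fixedField H)) (𝓞 K)) := by
  rw [Ideal.map, Ideal.smul_closure]
  congr 1
  ext y
  constructor
  · rintro ⟨_, ⟨z, hz, rfl⟩, rfl⟩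
    refine ⟨z, hz, ?_⟩
    apply RingOfIntegers.ext
    exact (z.1.2 ⟨g, hg⟩).symm
  · rintro ⟨z, hz, rfl⟩
    refine ⟨_, ⟨z, hz, rfl⟩, ?_⟩
    apply RingOfIntegers.ext
    exact (z.1.2 ⟨g, hg⟩)

end

namespace MQ
variable {K : Type} [Field K] [NumberField K] {d : Fin 3 → ℤ} (m : MQ 3 K d)

/-- the subgroup fixing a quadratic subfield -/
noncomputable def H (S : Fin 3 → Bool) : Subgroup (K ≃ₐ[ℚ] K) := ((chi S).comp m.sgHom).ker

lemma mem_H {S : Fin 3 → Bool} {g : K ≃ₐ[ℚ] K} : g ∈ m.H S ↔ chi S (m.sgEquiv g) = 1 := Iff.rfl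

/-- product of the radicands -/
def DD (d : Fin 3 → ℤ) (S : Fin 3 → Bool) : ℤ := ∏ i, if S i then d i else 1

lemma prod_H {M : Type*} [CommMonoid M] (S : Fin 3 → Bool) [Fintype (m.H S)] (f : (K ≃ₐ[ℚ] K) → M) :
    ∏ g : m.H S, f g = ∏ ε with chi S ε = 1, f (m.sgEquiv.symm ε) := by
  refine Finset.prod_bij (fun g _ => m.sgEquiv g) ?_ ?_ ?_ ?_
  · intro g _
    simp only [Finset.mem_filter, Finset.mem_univ, true_and]
    exact m.mem_H.mp g.2
  · intro g _ h _ hgh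
    exact Subtype.ext (m.sgEquiv.injective hgh)
  · intro ε hε
    refine ⟨⟨m.sgEquiv.symm ε, m.mem_H.mpr ?_⟩, Finset.mem_univ _, by simp⟩
    simpa using hε
  · intro g _
    simp

lemma card_H {S : Fin 3 → Bool} (hS : S ≠ S0) : Nat.card (m.H S) = 4 := by
  classical
  let _ : Fintype (m.H S) := Fintype.ofFinite _
  have := m.prod_H S (fun _ => Multiplicative.ofAdd 1)
  rw [Finset.prod_const, Finset.prod_const, chi_card S hS, Finset.card_univ] at this
  rw [Nat.card_eq_fintype_card]
  have h2 := congrArg Multiplicative.toAdd this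
  simpa using h2

/-- the quadratic subfield -/
noncomputable abbrev kk (S : Fin 3 → Bool) : IntermediateField ℚ K := IntermediateField.fixedField (m.H S)

lemma finrank_kk {S : Fin 3 → Bool} (hS : S ≠ S0) : Module.finrank (m.kk S) K = 4 := by
  rw [IntermediateField.finrank_fixedField_eq_card, m.card_H hS]

/-- product of square roots -/
noncomputable def xx (S : Fin 3 → Bool) : K := ∏ i, if S i then m.x i else 1

lemma xx_apply (S : Fin 3 → Bool) (g : K ≃ₐ[ℚ] K) : g (m.xx S) = (((chi S (m.sgEquiv g) : ℤˣ) : ℤ) : K) * m.xx S := by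
  rw [xx, map_prod]
  change _ = (((∏ i, if S i then m.sg g i else 1 : ℤˣ) : ℤ) : K) * _
  rw [Units.coe_prod, Int.cast_prod, ← Finset.prod_mul_distrib]
  refine Finset.prod_congr rfl fun i _ => ?_
  split_ifs
  · exact m.sg_spec g i
  · simp

lemma xx_sq (S : Fin 3 → Bool) : m.xx S ^ 2 = DD d S := by
  rw [xx, DD, ← Finset.prod_pow, Int.cast_prod]
  refine Finset.prod_congr rfl fun i _ => ?_
  split_ifs
  · exact m.hx i
  · simp

lemma normalkk (S : Fin 3 → Bool) : Normal ℚ (m.kk S) := by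
  have := m.gal
  have : (m.H S).Normal := ⟨fun a ha b => by
    rw [m.aut_comm b a, mul_inv_cancel_right]; exact ha⟩
  exact (IsGalois.of_fixedField_normal_subgroup (m.H S)).to_normal

lemma mkk {S : Fin 3 → Bool} (hS : S ≠ S0) : Nonempty (MQ 1 (m.kk S) (fun _ => DD d S)) := by
  have := m.normalkk S
  obtain ⟨ε, hε⟩ := chi_ex S hS
  refine ⟨{ x := fun _ => ⟨m.xx S, ?_⟩, hd := ?_, hx := ?_, g := fun _ => (m.sgEquiv.symm ε).restrictNormal (m.kk S), hg := ?_, hg' := ?_, hF := ?_ }⟩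
  · rw [IntermediateField.mem_fixedField_iff]
    intro g hg
    rw [m.xx_apply, m.mem_H.mp hg]; simp
  · intro _
    rw [DD, Finset.prod_ne_zero_iff]
    intro i _
    split_ifs
    · exact m.hd i
    · exact one_ne_zero
  · intro _
    exact Subtype.ext (by simpa using m.xx_sq S)
  · intro _
    apply (algebraMap (m.kk S) K).injective
    rw [AlgEquiv.restrictNormal_commutes]
    change m.sgEquiv.symm ε (m.xx S) = - m.xx S
    rw [m.xx_apply, MulEquiv.apply_symm_apply, hε]; simp
  · intro i j hij
    exact absurd (Subsingleton.elim i j) hij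
  · have h1 := Module.finrank_mul_finrank ℚ (m.kk S) K
    rw [m.finrank_kk hS, m.hF] at h1
    omega

end MQ

/-- the list of radicands whose quadratic field has odd part of order five -/
def L5 : List ℤ := 40513 :: tab5.map Prod.fst

lemma T5_L5 {D : ℤ} (h : D ∈ L5) : T5 D := by
  rcases List.mem_cons.mp h with rfl | h
  · exact T5_40513
  · exact T5_of h

lemma prod_top {K : Type} [Field K] [NumberField K] {d : Fin 3 → ℤ} (m : MQ 3 K d) {I : Ideal (𝓞 K)} (hI : I ≠ ⊥) :
    ∏ g : K ≃ₐ[ℚ] K, cl (g • I) = 1 := by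
  classical
  have hs : Function.Surjective (algebraMap ℤ (𝓞 (IntermediateField.fixedField (⊤ : Subgroup (K ≃ₐ[ℚ] K))))) := by
    intro y
    obtain ⟨q, hq⟩ := m.rat_of_fixed ((y : IntermediateField.fixedField (⊤ : Subgroup (K ≃ₐ[ℚ] K))) : K) (fun i => y.1.2 ⟨m.g i, trivial⟩)
    have h1 : IsIntegral ℤ (algebraMap ℚ K q) := by
      have h2 : IsIntegral ℤ (y : IntermediateField.fixedField (⊤ : Subgroup (K ≃ₐ[ℚ] K))) := y.isIntegral_coe
      have h3 := h2.map (IsScalarTower.toAlgHom ℤ (IntermediateField.fixedField (⊤ : Subgroup (K ≃ₐ[ℚ] K))) K)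
      rw [eq_ratCast, ← hq]
      exact h3
    rw [isIntegral_algebraMap_iff (algebraMap ℚ K).injective] at h1
    obtain ⟨k, hk⟩ := IsIntegrallyClosed.isIntegral_iff.mp h1
    refine ⟨k, ?_⟩
    apply RingOfIntegers.ext
    apply Subtype.ext
    rw [hq, ← hk]
    simp
  have hp : IsPrincipalIdealRing (𝓞 (IntermediateField.fixedField (⊤ : Subgroup (K ≃ₐ[ℚ] K)))) := IsPrincipalIdealRing.of_surjective _ hs
  have h1 := map_relNorm_eq (⊤ : Subgroup (K ≃ₐ[ℚ] K)) I
  obtain ⟨x, hx⟩ := (IsPrincipalIdealRing.principal (Ideal.relNorm (𝓞 (IntermediateField.fixedField (⊤ : Subgroup (K ≃ₐ[ℚ] K)))) I)).principal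
  rw [Ideal.submodule_span_eq] at hx
  rw [hx, Ideal.map_span, Set.image_singleton] at h1
  have h2 := congrArg cl h1
  rw [cl_span, cl_prod _ (fun g : (⊤ : Subgroup (K ≃ₐ[ℚ] K)) => (g : K ≃ₐ[ℚ] K) • I) (fun g _ => smul_ne_bot (g : K ≃ₐ[ℚ] K) hI)] at h2
  rw [h2]
  exact (Fintype.prod_equiv Subgroup.topEquiv.toEquiv _ (fun g => cl (g • I)) (fun ε => rfl)).symm

theorem cls {K : Type} [Field K] [NumberField K] {d : Fin 3 → ℤ} (m : MQ 3 K d) (hodd : OddClass K) {n : ℕ}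
    (h0 : ∀ S, S ≠ S0 → MQ.DD d S ∈ L5 ∨ MQ.DD d S ∈ tab0.map Prod.fst)
    (hn : Fintype.card {S // S ≠ S0 ∧ MQ.DD d S ∈ L5} = n) : Nonempty (ClassGroup (𝓞 K) ≃* (Fin n → Multiplicative (ZMod 5))) := by
  classical
  have hG := m.gal
  refine grp ?_ (fun ε => act (m.sgEquiv.symm ε)) ?_ ?_ ?_ (fun S c => ∃ c' : ClassGroup (𝓞 (m.kk S)), c = ext (m.kk S) c') ?_ ?_
    (fun S => MQ.DD d S ∈ L5) ?_ ?_ hn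
  · intro c
    obtain ⟨I, hI, rfl⟩ := cl_surj c
    exact hodd I
  · intro ε δ c
    simp only [act_act, map_mul]
  · intro c
    simp only [map_one, act_one]
  · intro c
    obtain ⟨I, hI, rfl⟩ := cl_surj c
    refine Eq.trans ?_ (prod_top m hI)
    exact Fintype.prod_equiv m.sgEquiv.symm.toEquiv _ (fun g => cl (g • I)) (fun ε => act_cl _ hI)
  · intro S hS c
    obtain ⟨I, hI, rfl⟩ := cl_surj c
    let _ : Fintype (m.H S) := Fintype.ofFinite _
    have h1 : Ideal.relNorm (𝓞 (m.kk S)) I ≠ ⊥ := by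
      rwa [Ne, Ideal.relNorm_eq_bot_iff]
    refine ⟨cl (Ideal.relNorm (𝓞 (m.kk S)) I), ?_⟩
    rw [ext_cl _ h1, map_relNorm_eq, cl_prod _ (fun g : m.H S => (g : K ≃ₐ[ℚ] K) • I) (fun g _ => smul_ne_bot (g : K ≃ₐ[ℚ] K) hI), m.prod_H S (fun g => cl (g • I))]
    exact Finset.prod_congr rfl fun ε _ => act_cl _ hI
  · rintro S hS _ ⟨c, rfl⟩ ε hε
    obtain ⟨I, hI, rfl⟩ := cl_surj c
    rw [ext_cl _ hI, act_cl _ (map_ne_bot hI), smul_map_fixed]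
    rw [m.mem_H]; simpa using hε
  · intro S hS hJ
    obtain ⟨m'⟩ := m.mkk hS
    obtain ⟨P, hP0, h5, h1, hc⟩ := T5_L5 hJ _ _ m' rfl
    refine ⟨ext (m.kk S) (cl P), ⟨_, rfl⟩, by rw [← map_pow, h5, map_one], fun h => h1 (ext_inj _ (m.finrank_kk hS) _ h5 h), ?_⟩
    rintro _ ⟨c, rfl⟩
    obtain ⟨k, j, hj⟩ := hc c
    exact ⟨k, j, by rw [← map_pow, ← hj]; simp⟩
  · rintro S hS hJ _ ⟨c, rfl⟩
    obtain ⟨m'⟩ := m.mkk hS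
    obtain ⟨k, hk⟩ := T0_of ((h0 S hS).resolve_left hJ) _ _ m' rfl c
    exact ⟨k, by rw [← map_pow, hk, map_one]⟩

end Quin

namespace Quin

lemma chi_total (ε : Fin 3 → ℤˣ) : (∑ S, ((chi S ε : ℤˣ) : ℤ)) = if ε = 1 then 8 else 0 := by
  revert ε; decide +kernel

lemma exists_MQ {K : Type*} [Field K] [NumberField K] [IsGalois ℚ K] {d : Fin 3 → ℤ} (x : Fin 3 → K) (hd : ∀ i, d i ≠ 0)
    (hx : ∀ i, x i ^ 2 = d i) (hext : ∀ g : K ≃ₐ[ℚ] K, (∀ i, g (x i) = x i) → g = 1)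
    (hns : ∀ S, S ≠ S0 → ¬ IsSquare (MQ.DD d S)) : Nonempty (MQ 3 K d) := by
  classical
  have hx0 : ∀ i, x i ≠ 0 := by
    intro i h
    have h1 := hx i
    rw [h] at h1
    apply hd i
    have : ((d i : ℤ) : K) = 0 := by rw [← h1]; ring
    exact_mod_cast this
  have hpm : ∀ (g : K ≃ₐ[ℚ] K) (i : Fin 3), ∃ e : ℤˣ, g (x i) = ((e : ℤ) : K) * x i := by
    intro g i
    have h1 : (g (x i)) ^ 2 = (x i) ^ 2 := by rw [← map_pow, hx, map_intCast]
    rcases sq_eq_sq_iff_eq_or_eq_neg.mp h1 with h | h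
    · exact ⟨1, by simp [h]⟩
    · exact ⟨-1, by simp [h]⟩
  choose s hs using hpm
  have hu : ∀ g i e, g (x i) = (((e : ℤˣ) : ℤ) : K) * x i → s g i = e := by
    intro g i e h
    rw [hs] at h
    have := mul_right_cancel₀ (hx0 i) h
    ext
    exact_mod_cast this
  let f : (K ≃ₐ[ℚ] K) →* (Fin 3 → ℤˣ) := MonoidHom.mk' s (by
    intro g h
    ext1 i
    apply hu
    rw [AlgEquiv.mul_apply, hs h, map_mul, map_intCast, hs g]
    simp only [Pi.mul_apply, Units.val_mul, Int.cast_mul]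
    ring)
  have hf1 : ∀ g, f g = 1 ↔ g = 1 := by
    intro g
    constructor
    · intro h
      apply hext
      intro i
      rw [hs]
      have : s g i = 1 := congrFun h i
      rw [this]; simp
    · rintro rfl; exact map_one f
  have hsum : ∀ S, S ≠ S0 → ∑ g : K ≃ₐ[ℚ] K, ((chi S (f g) : ℤˣ) : ℤ) = 0 := by
    intro S hS
    have h1 : ((Units.coeHom ℤ).comp ((chi S).comp f)) ≠ 1 := by
      intro h
      have h2 : ∀ g, chi S (f g) = 1 := by
        intro g
        apply Units.ext
        exact DFunLike.congr_fun h g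
      have h3 : ∀ g : K ≃ₐ[ℚ] K, g (∏ i, if S i then x i else 1) = ∏ i, if S i then x i else 1 := by
        intro g
        have h4 : (((∏ i, if S i then s g i else 1 : ℤˣ) : ℤ) : K) = 1 := by
          have h5 : (∏ i, if S i then s g i else 1 : ℤˣ) = 1 := h2 g
          rw [h5]; simp
        rw [map_prod]
        refine Eq.trans ?_ (one_mul _)
        rw [← h4, Units.coe_prod, Int.cast_prod, ← Finset.prod_mul_distrib]
        refine Finset.prod_congr rfl fun i _ => ?_
        split_ifs
        · exact hs g i
        · simp
      obtain ⟨q, hq⟩ := (IsGalois.mem_range_algebraMap_iff_fixed (F := ℚ) _).mpr h3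
      apply hns S hS
      rw [← Rat.isSquare_intCast_iff]
      refine ⟨q, ?_⟩
      apply (algebraMap ℚ K).injective
      rw [map_mul, hq, map_intCast, MQ.DD, Int.cast_prod, ← Finset.prod_mul_distrib]
      refine Finset.prod_congr rfl fun i _ => ?_
      split_ifs
      · rw [← hx, sq]
      · simp
    exact sum_hom_units_eq_zero _ h1
  have hcard : (Fintype.card (K ≃ₐ[ℚ] K) : ℤ) = 8 := by
    have h1 : ∑ S, ∑ g : K ≃ₐ[ℚ] K, ((chi S (f g) : ℤˣ) : ℤ) = 8 := by
      rw [Finset.sum_comm]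
      simp only [chi_total, hf1]
      simp
    rw [Finset.sum_eq_single S0 (fun S _ hS => hsum S hS) (by simp)] at h1
    have h2 : ∀ ε, chi S0 ε = 1 := by decide +kernel
    simpa [h2] using h1
  have hcard' : Fintype.card (K ≃ₐ[ℚ] K) = 8 := by exact_mod_cast hcard
  have hbij : Function.Bijective f := by
    rw [Fintype.bijective_iff_injective_and_card]
    refine ⟨(injective_iff_map_eq_one f).mpr fun g => (hf1 g).mp, ?_⟩
    rw [hcard']; decide +kernel
  choose g hg using fun i : Fin 3 => hbij.2 (Pi.mulSingle i (-1))
  refine ⟨{ x := x, hd := hd, hx := hx, g := g, hg := ?_, hg' := ?_, hF := ?_ }⟩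
  · intro i
    have h1 : s (g i) i = -1 := by
      have := congrFun (hg i) i
      rwa [Pi.mulSingle_eq_same] at this
    rw [hs, h1]; simp
  · intro i j hij
    have h1 : s (g i) j = 1 := by
      have := congrFun (hg i) j
      rwa [Pi.mulSingle_eq_of_ne (Ne.symm hij)] at this
    rw [hs, h1]; simp
  · rw [← IsGalois.card_aut_eq_finrank, Nat.card_eq_fintype_card, hcard']; rfl

/-- the defining polynomial -/
noncomputable def pol (d : Fin 3 → ℤ) : Polynomial ℚ := ∏ i, (Polynomial.X ^ 2 - Polynomial.C (d i : ℚ))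

/-- the field generated by the square roots of the `d i` -/
noncomputable def KK (d : Fin 3 → ℤ) : IntermediateField ℚ ℂ := IntermediateField.adjoin ℚ ((pol d).rootSet ℂ)

lemma pol_ne (d : Fin 3 → ℤ) : pol d ≠ 0 := by
  rw [pol, Finset.prod_ne_zero_iff]
  intro i _
  exact Polynomial.X_pow_sub_C_ne_zero (by norm_num) _

lemma mem_root {d : Fin 3 → ℤ} {z : ℂ} : z ∈ (pol d).rootSet ℂ ↔ ∃ i, z ^ 2 = d i := by
  rw [Polynomial.mem_rootSet, pol, map_prod, Finset.prod_eq_zero_iff]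
  constructor
  · rintro ⟨-, i, -, h⟩
    refine ⟨i, ?_⟩
    simp only [map_sub, map_pow, Polynomial.aeval_X, Polynomial.aeval_C, map_intCast] at h
    exact sub_eq_zero.mp h
  · rintro ⟨i, h⟩
    refine ⟨pol_ne d, i, Finset.mem_univ _, ?_⟩
    simp [h]

/-- a complex square root -/
noncomputable def rt (a : ℤ) : ℂ := (IsAlgClosed.exists_pow_nat_eq (a : ℂ) (n := 2) (by norm_num)).choose

lemma rt_sq (a : ℤ) : rt a ^ 2 = a := (IsAlgClosed.exists_pow_nat_eq (a : ℂ) (n := 2) (by norm_num)).choose_spec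

lemma rt_mem (d : Fin 3 → ℤ) (i : Fin 3) : rt (d i) ∈ KK d :=
  IntermediateField.subset_adjoin _ _ (mem_root.mpr ⟨i, rt_sq _⟩)

lemma KK_split (d : Fin 3 → ℤ) : (pol d).IsSplittingField ℚ (KK d) :=
  IntermediateField.adjoin_rootSet_isSplittingField (IsAlgClosed.splits _)

lemma KK_fin (d : Fin 3 → ℤ) : FiniteDimensional ℚ (KK d) := by
  have := KK_split d
  exact Polynomial.IsSplittingField.finiteDimensional (KK d) (pol d)

lemma KK_nf (d : Fin 3 → ℤ) : NumberField (KK d) := by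
  have := KK_fin d
  exact ⟨⟩

lemma KK_gal (d : Fin 3 → ℤ) : IsGalois ℚ (KK d) := by
  have := KK_split d
  have : Normal ℚ (KK d) := Normal.of_isSplittingField (pol d)
  exact ⟨⟩

/-- the conditions on the radicands -/
def FC (n : ℕ) (d : Fin 3 → ℤ) : Prop := (∃ i, d i < 0) ∧ (∀ i, d i ≠ 0) ∧ (∀ S, S ≠ S0 → ¬ IsSquare (MQ.DD d S)) ∧
  (∀ S, S ≠ S0 → MQ.DD d S ∈ L5 ∨ MQ.DD d S ∈ tab0.map Prod.fst) ∧
  Fintype.card {S // S ≠ S0 ∧ MQ.DD d S ∈ L5} = n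

instance (n : ℕ) (d : Fin 3 → ℤ) : Decidable (FC n d) := by unfold FC; infer_instance

lemma KK_MQ {n : ℕ} {d : Fin 3 → ℤ} (h : FC n d) [NumberField (KK d)] : Nonempty (MQ 3 (KK d) d) := by
  have := KK_gal d
  refine exists_MQ (fun i => ⟨rt (d i), rt_mem d i⟩) h.2.1 ?_ ?_ h.2.2.1
  · intro i
    apply Subtype.ext
    simpa using rt_sq (d i)
  · intro g hg
    have h1 : (g : KK d →ₐ[ℚ] KK d) = AlgHom.id ℚ (KK d) := by
      refine IntermediateField.algHom_ext_of_eq_adjoin ℚ (S := KK d) (s := (pol d).rootSet ℂ) rfl ?_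
      intro z hz
      obtain ⟨i, hi⟩ := mem_root.mp hz
      have h2 : z ^ 2 = rt (d i) ^ 2 := by rw [hi, rt_sq]
      have h3 := hg i
      rcases sq_eq_sq_iff_eq_or_eq_neg.mp h2 with rfl | rfl
      · exact h3
      · have h4 : (⟨-rt (d i), IntermediateField.subset_adjoin _ _ hz⟩ : KK d) = -⟨rt (d i), rt_mem d i⟩ := rfl
        change g ⟨-rt (d i), IntermediateField.subset_adjoin _ _ hz⟩ = ⟨-rt (d i), IntermediateField.subset_adjoin _ _ hz⟩
        rw [h4, map_neg, h3]
    ext1 y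
    exact DFunLike.congr_fun h1 y

lemma zu : Nonempty (ℤˣ ≃* Multiplicative (ZMod 2)) := by
  have h1 : IsCyclic ℤˣ := ⟨-1, by
    intro x; rcases Int.units_eq_one_or x with rfl | rfl
    · exact ⟨0, by simp⟩
    · exact ⟨1, by simp⟩⟩
  exact ⟨mulEquivOfCyclicCardEq (by simp [Nat.card_eq_fintype_card])⟩

theorem field_ok {n : ℕ} {d : Fin 3 → ℤ} (h : FC n d)
    (ho : ∀ (K : Type) [Field K] [NumberField K], MQ 3 K d → OddClass K) :
    IsNQuadratic 3 (KK d) ∧ IsImaginary (KK d) ∧ Nonempty (ClassGroup (𝓞 (KK d)) ≃* (Fin n → Multiplicative (ZMod 5))) := by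
  have := KK_nf d
  obtain ⟨m⟩ := KK_MQ h
  obtain ⟨e⟩ := zu
  refine ⟨⟨KK_fin d, KK_gal d, ⟨m.sgEquiv.trans (MulEquiv.arrowCongr (Equiv.refl _) e)⟩⟩, ?_, cls m (ho _ m) h.2.2.2.1 h.2.2.2.2⟩
  obtain ⟨i, hi⟩ := h.1
  refine ⟨⟨rt (d i), rt_mem d i⟩, fun him => ?_⟩
  have h1 := congrArg Complex.re (rt_sq (d i))
  simp only at him
  rw [sq, Complex.mul_re, him] at h1
  simp only [mul_zero, sub_zero, Complex.intCast_re] at h1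
  have h2 : ((d i : ℤ) : ℝ) < 0 := by exact_mod_cast hi
  nlinarith [mul_self_nonneg (rt (d i)).re]

/-- distinctness test -/
def dist (d d' : Fin 3 → ℤ) : Prop := ∃ i, ∀ S : Finset (Fin 3), ¬ IsSquare (d i * ∏ j ∈ S, d' j)

instance (d d' : Fin 3 → ℤ) : Decidable (dist d d') := by unfold dist; infer_instance

lemma KK_ne {n : ℕ} {d d' : Fin 3 → ℤ} (h : FC n d) (h' : FC n d') (hd : dist d d') : KK d ≠ KK d' := by
  intro hK
  obtain ⟨i, hi⟩ := hd
  have := KK_nf d'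
  obtain ⟨m⟩ := KK_MQ h'
  obtain ⟨S, -, hS⟩ := m.sq_rat (d i) ⟨rt (d i), hK ▸ rt_mem d i⟩ (Subtype.ext (by simpa using rt_sq (d i))) (h.2.1 i)
  exact hi S hS

theorem fields {n N : ℕ} (l : List (Fin 3 → ℤ)) (hN : N = l.length) (hl : ∀ d ∈ l, FC n d) (hp : l.Pairwise dist)
    (ho : ∀ d ∈ l, ∀ (K : Type) [Field K] [NumberField K], MQ 3 K d → OddClass K) :
    ∃ S : Finset (IntermediateField ℚ ℂ), N ≤ S.card ∧
      ∀ K ∈ S, IsNQuadratic 3 K ∧ IsImaginary K ∧ Nonempty (ClassGroup (𝓞 K) ≃* (Fin n → Multiplicative (ZMod 5))) := by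
  classical
  refine ⟨(l.map KK).toFinset, ?_, ?_⟩
  · rw [List.toFinset_card_of_nodup, List.length_map, hN]
    rw [List.Nodup, List.pairwise_map]
    exact hp.imp_of_mem fun ha hb hab => KK_ne (hl _ ha) (hl _ hb) hab
  · intro K hK
    rw [List.mem_toFinset, List.mem_map] at hK
    obtain ⟨d, hd, rfl⟩ := hK
    exact field_ok (hl d hd) (ho d hd)

end Quin

set_option maxRecDepth 100000
namespace Quin

/-- odd class number for every model of the field -/
def HO (d : Fin 3 → ℤ) : Prop := ∀ (K : Type) [Field K] [NumberField K], MQ 3 K d → OddClass K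

lemma ho_a37 : HO ![-1, 2, 37] := fun _ _ _ m => v4a (X3 := 12) (Y3 := 2) (X := 26) (Y := 17) (Z := 4) (W := 3) m
  (by decide +kernel) (by norm_num) (by norm_num)

lemma ho_a197 : HO ![-1, 2, 197] := fun _ _ _ m => v4a (X3 := 28) (Y3 := 2) (X := 117330) (Y := 80549) (Z := 8116) (W := 5911) m
  (by decide +kernel) (by norm_num) (by norm_num)

lemma ho_b43 : HO ![-2, -1, -43] := fun _ _ _ m => v4b (X3 := 22) (Y3 := 102) (A0 := 158) (A1 := -47) (A2 := 64) (A3 := 111)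
  (B0 := -10) (B1 := -17) (B2 := 24) (B3 := -7) m
  (by decide +kernel) (by norm_num) (by decide +kernel) (by norm_num) (by norm_num) (by norm_num) (by norm_num) (by norm_num)

lemma ho_b347 : HO ![-2, -1, -347] := fun _ _ _ m => v4b (X3 := 14950852326) (Y3 := 196931727878) (A0 := 25501060) (A1 := -7474549)
  (A2 := 10551962) (A3 := 18026511) (B0 := -567460) (B1 := -968007) (B2 := 1368554) (B3 := -400547) m
  (by decide +kernel) (by norm_num) (by decide +kernel) (by norm_num) (by norm_num) (by norm_num) (by norm_num) (by norm_num)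

/-- the fields with class group of rank 1 -/
def l1 : List (Fin 3 → ℤ) := [![-3, -1, -163], ![-19, -1, -11], ![-11, -1, -67], ![-67, -1, -19], ![-2, -7, -19], ![-1, -11, 13],
  ![-7, 61, -2], ![-2, 29, -11], ![-47, 5, -2], ![-3, 17, -7], ![-3, 41, -19], ![-3, 2, -43],
  ![-47, 5, -3], ![-7, 13, -11], ![-7, 17, -11], ![-47, 5, -7], ![-1, 2, 37], ![-2, -1, -43]]

lemma ho_l1 : ∀ d ∈ l1, HO d := by
  unfold l1
  refine List.forall_mem_cons.mpr ⟨fun _ _ _ m => chk2 m (by decide +kernel : Chk2 (-3) (-163) 1 1 8005 627 9652 71146 (-1)), ?_⟩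
  refine List.forall_mem_cons.mpr ⟨fun _ _ _ m => chk2 m (by decide +kernel : Chk2 (-19) (-11) 13 3 3 1 92 70 (-1)), ?_⟩
  refine List.forall_mem_cons.mpr ⟨fun _ _ _ m => chk2 m (by decide +kernel : Chk2 (-11) (-67) 3 1 221 27 2748 6782 (-1)), ?_⟩
  refine List.forall_mem_cons.mpr ⟨fun _ _ _ m => chk2 m (by decide +kernel : Chk2 (-67) (-19) 221 27 13 3 138962108 74000694 (-1)), ?_⟩
  refine List.forall_mem_cons.mpr ⟨fun _ _ _ m => chk1a m (by decide +kernel : Chk1a (-2) (-7) (-19) 4 2 5 3 2 6), ?_⟩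
  refine List.forall_mem_cons.mpr ⟨fun _ _ _ m => chk3 m (by decide +kernel : Chk3 (-11) 13 3 1 (-1) 1 1 (-1) 3 1), ?_⟩
  refine List.forall_mem_cons.mpr ⟨fun _ _ _ m => chk1b m (by decide +kernel : Chk1b (-7) 61 (-2) 39 5 206 430 4 2), ?_⟩
  refine List.forall_mem_cons.mpr ⟨fun _ _ _ m => chk1b m (by decide +kernel : Chk1b (-2) 29 (-11) 5 1 54 62 6 14), ?_⟩
  refine List.forall_mem_cons.mpr ⟨fun _ _ _ m => chk1b m (by decide +kernel : Chk1b (-47) 5 (-2) 1 1 26 6 1464 302), ?_⟩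
  refine List.forall_mem_cons.mpr ⟨fun _ _ _ m => chk1b m (by decide +kernel : Chk1b (-3) 17 (-7) 8 2 1 1 1 1), ?_⟩
  refine List.forall_mem_cons.mpr ⟨fun _ _ _ m => chk1b m (by decide +kernel : Chk1b (-3) 41 (-19) 64 10 5728 4858 4 10), ?_⟩
  refine List.forall_mem_cons.mpr ⟨fun _ _ _ m => chk1b m (by decide +kernel : Chk1b (-3) 2 (-43) 2 2 16 2 28 106), ?_⟩
  refine List.forall_mem_cons.mpr ⟨fun _ _ _ m => chk1b m (by decide +kernel : Chk1b (-47) 5 (-3) 1 1 308 58 8 2), ?_⟩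
  refine List.forall_mem_cons.mpr ⟨fun _ _ _ m => chk1b m (by decide +kernel : Chk1b (-7) 13 (-11) 3 1 404 166 1 1), ?_⟩
  refine List.forall_mem_cons.mpr ⟨fun _ _ _ m => chk1b m (by decide +kernel : Chk1b (-7) 17 (-11) 8 2 83 39 1 1), ?_⟩
  refine List.forall_mem_cons.mpr ⟨fun _ _ _ m => chk1b m (by decide +kernel : Chk1b (-47) 5 (-7) 1 1 73 9 824 318), ?_⟩
  refine List.forall_mem_cons.mpr ⟨ho_a37, ?_⟩
  refine List.forall_mem_cons.mpr ⟨ho_b43, ?_⟩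
  exact fun _ h => absurd h List.not_mem_nil

lemma fc_l1 : ∀ d ∈ l1, FC 1 d := by decide +kernel

lemma dist_l1 : l1.Pairwise dist := by decide +kernel

/-- the fields with class group of rank 2 -/
def l2 : List (Fin 3 → ℤ) := [![-3, -1, -127], ![-227, -1, -3], ![-3, -1, -619], ![-3, -1, -691], ![-131, -1, -7], ![-11, -1, -179],
  ![-347, -1, -11], ![-2, -79, -3], ![-2, -7, -227], ![-2, -47, -19], ![-3, -131, -19], ![-7, -19, -79],
  ![-7, -103, -43], ![-1, -47, 13], ![-1, -127, 5], ![-11, 569, -3], ![-3, 5, -127], ![-227, 17, -3],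
  ![-227, 41, -3], ![-347, 2, -3], ![-47, 13, -7], ![-7, 5, -127], ![-227, 17, -11], ![-347, 2, -11],
  ![-1, 2, 197], ![-2, -1, -347]]

lemma ho_l2 : ∀ d ∈ l2, HO d := by
  unfold l2
  refine List.forall_mem_cons.mpr ⟨fun _ _ _ m => chk2 m (by decide +kernel : Chk2 (-3) (-127) 1 1 2175 193 4 26 1), ?_⟩
  refine List.forall_mem_cons.mpr ⟨fun _ _ _ m => chk2 m (by decide +kernel : Chk2 (-227) (-3) 15 1 1 1 2676212 307658 (-1)), ?_⟩
  refine List.forall_mem_cons.mpr ⟨fun _ _ _ m => chk2 m (by decide +kernel : Chk2 (-3) (-619) 1 1 719175577 28906107 87771412 1260775562 (-1)), ?_⟩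
  refine List.forall_mem_cons.mpr ⟨fun _ _ _ m => chk2 m (by decide +kernel : Chk2 (-3) (-691) 1 1 5580152383 212279001 338879188 5143080170 (-1)), ?_⟩
  refine List.forall_mem_cons.mpr ⟨fun _ _ _ m => chk2 m (by decide +kernel : Chk2 (-131) (-7) 103 9 3 1 13 3 1), ?_⟩
  refine List.forall_mem_cons.mpr ⟨fun _ _ _ m => chk2 m (by decide +kernel : Chk2 (-11) (-179) 3 1 2047 153 723778177985724 2919682708729150 (-1)), ?_⟩
  refine List.forall_mem_cons.mpr ⟨fun _ _ _ m => chk2 m (by decide +kernel : Chk2 (-347) (-11) 801 43 3 1 942413392143389436 167792696809495246 (-1)), ?_⟩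
  refine List.forall_mem_cons.mpr ⟨fun _ _ _ m => chk1a m (by decide +kernel : Chk1a (-2) (-79) (-3) 88 14 1 5 2 2), ?_⟩
  refine List.forall_mem_cons.mpr ⟨fun _ _ _ m => chk1a m (by decide +kernel : Chk1a (-2) (-7) (-227) 4 2 951 167 12208194 130061678), ?_⟩
  refine List.forall_mem_cons.mpr ⟨fun _ _ _ m => chk1a m (by decide +kernel : Chk1a (-2) (-47) (-19) 1464 302 7 11 2 6), ?_⟩
  refine List.forall_mem_cons.mpr ⟨fun _ _ _ m => chk1a m (by decide +kernel : Chk1a (-3) (-131) (-19) 5564 842 12639071060 33187459078 4 10), ?_⟩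
  refine List.forall_mem_cons.mpr ⟨fun _ _ _ m => chk1a m (by decide +kernel : Chk1a (-7) (-19) (-79) 5 3 12571 6165 125752 422454), ?_⟩
  refine List.forall_mem_cons.mpr ⟨fun _ _ _ m => chk1a m (by decide +kernel : Chk1a (-7) (-103) (-43) 72962176 19020774 13287412 20564814 23 57), ?_⟩
  refine List.forall_mem_cons.mpr ⟨fun _ _ _ m => chk3 m (by decide +kernel : Chk3 (-47) 13 7 1 1 71 135 1 3 1), ?_⟩
  refine List.forall_mem_cons.mpr ⟨fun _ _ _ m => chk3 m (by decide +kernel : Chk3 (-127) 5 2175 193 1 1 5 1 1 1), ?_⟩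
  refine List.forall_mem_cons.mpr ⟨fun _ _ _ m => chk1b m (by decide +kernel : Chk1b (-11) 569 (-3) 5789727664 242718010 10550740328 43810892210 4 2), ?_⟩
  refine List.forall_mem_cons.mpr ⟨fun _ _ _ m => chk1b m (by decide +kernel : Chk1b (-3) 5 (-127) 1 1 65452 7498 4 26), ?_⟩
  refine List.forall_mem_cons.mpr ⟨fun _ _ _ m => chk1b m (by decide +kernel : Chk1b (-227) 17 (-3) 8 2 2395523480 378487322 2676212 307658), ?_⟩
  refine List.forall_mem_cons.mpr ⟨fun _ _ _ m => chk1b m (by decide +kernel : Chk1b (-227) 41 (-3) 64 10 400895695232383781216 98367076741269358730 2676212 307658), ?_⟩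
  refine List.forall_mem_cons.mpr ⟨fun _ _ _ m => chk1b m (by decide +kernel : Chk1b (-347) 2 (-3) 2 2 39104 1714 22670372 2107922), ?_⟩
  refine List.forall_mem_cons.mpr ⟨fun _ _ _ m => chk1b m (by decide +kernel : Chk1b (-47) 13 (-7) 3 1 5 1 824 318), ?_⟩
  refine List.forall_mem_cons.mpr ⟨fun _ _ _ m => chk1b m (by decide +kernel : Chk1b (-7) 5 (-127) 1 1 80 6 456483904 1944367302), ?_⟩
  refine List.forall_mem_cons.mpr ⟨fun _ _ _ m => chk1b m (by decide +kernel : Chk1b (-227) 17 (-11) 8 2 17837738445293849151634912 1471820952299977211915454 1878577904964 413535334774), ?_⟩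
  refine List.forall_mem_cons.mpr ⟨fun _ _ _ m => chk1b m (by decide +kernel : Chk1b (-347) 2 (-11) 2 2 733838701032 16797882134 942413392143389436 167792696809495246), ?_⟩
  refine List.forall_mem_cons.mpr ⟨ho_a197, ?_⟩
  refine List.forall_mem_cons.mpr ⟨ho_b347, ?_⟩
  exact fun _ h => absurd h List.not_mem_nil

lemma fc_l2 : ∀ d ∈ l2, FC 2 d := by decide +kernel

lemma dist_l2 : l2.Pairwise dist := by decide +kernel

/-- the fields with class group of rank 3 -/
def l3 : List (Fin 3 → ℤ) := [![-3, -47, -127], ![-103, 37, -2], ![-11, 13, -47], ![-227, 41, -19], ![-347, 2, -43], ![-127, 5, -47]]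

lemma ho_l3 : ∀ d ∈ l3, HO d := by
  unfold l3
  refine List.forall_mem_cons.mpr ⟨fun _ _ _ m => chk1a m (by decide +kernel : Chk1a (-3) (-47) (-127) 8 2 1142107735064 694790931502 4 26), ?_⟩
  refine List.forall_mem_cons.mpr ⟨fun _ _ _ m => chk1b m (by decide +kernel : Chk1b (-103) 37 (-2) 12 2 64874 27494 244 34), ?_⟩
  refine List.forall_mem_cons.mpr ⟨fun _ _ _ m => chk1b m (by decide +kernel : Chk1b (-11) 13 (-47) 3 1 6545894037877356 1037995272307054 15 31), ?_⟩
  refine List.forall_mem_cons.mpr ⟨fun _ _ _ m => chk1b m (by decide +kernel : Chk1b (-227) 41 (-19) 64 10 34598437804949339087083393449698924979793527975664528 3373328916750407534157825611547920669053323471533286 288014184812 83325465654), ?_⟩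
  refine List.forall_mem_cons.mpr ⟨fun _ _ _ m => chk1b m (by decide +kernel : Chk1b (-347) 2 (-43) 2 2 201324144742053980 2330836956758082 3710761905890284911996538581652 1306268878252375337793232289262), ?_⟩
  refine List.forall_mem_cons.mpr ⟨fun _ _ _ m => chk1b m (by decide +kernel : Chk1b (-127) 5 (-47) 1 1 1428378859 41340681 1142107735064 694790931502), ?_⟩
  exact fun _ h => absurd h List.not_mem_nil

lemma fc_l3 : ∀ d ∈ l3, FC 3 d := by decide +kernel

lemma dist_l3 : l3.Pairwise dist := by decide +kernel

/-- the fields with class group of rank 4 -/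
def l4 : List (Fin 3 → ℤ) := [![-127, 29, -11]]

lemma ho_l4 : ∀ d ∈ l4, HO d := by
  unfold l4
  refine List.forall_mem_cons.mpr ⟨fun _ _ _ m => chk1b m (by decide +kernel : Chk1b (-127) 29 (-11) 5 1 265396 38238 17 5), ?_⟩
  exact fun _ h => absurd h List.not_mem_nil

lemma fc_l4 : ∀ d ∈ l4, FC 4 d := by decide +kernel

lemma dist_l4 : l4.Pairwise dist := by decide +kernel

end Quin

theorem stmt3 :
    (∃ S : Finset (IntermediateField ℚ ℂ), 18 ≤ S.card ∧
      ∀ K ∈ S, IsNQuadratic 3 K ∧ IsImaginary K ∧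
        Nonempty (ClassGroup (𝓞 K) ≃* (Fin 1 → Multiplicative (ZMod 5)))) ∧
    (∃ S : Finset (IntermediateField ℚ ℂ), 26 ≤ S.card ∧
      ∀ K ∈ S, IsNQuadratic 3 K ∧ IsImaginary K ∧
        Nonempty (ClassGroup (𝓞 K) ≃* (Fin 2 → Multiplicative (ZMod 5)))) ∧
    (∃ S : Finset (IntermediateField ℚ ℂ), 6 ≤ S.card ∧
      ∀ K ∈ S, IsNQuadratic 3 K ∧ IsImaginary K ∧
        Nonempty (ClassGroup (𝓞 K) ≃* (Fin 3 → Multiplicative (ZMod 5)))) ∧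
    (∃ S : Finset (IntermediateField ℚ ℂ), 1 ≤ S.card ∧
      ∀ K ∈ S, IsNQuadratic 3 K ∧ IsImaginary K ∧
        Nonempty (ClassGroup (𝓞 K) ≃* (Fin 4 → Multiplicative (ZMod 5)))) := by
  exact ⟨Quin.fields Quin.l1 rfl Quin.fc_l1 Quin.dist_l1 Quin.ho_l1,
    Quin.fields Quin.l2 rfl Quin.fc_l2 Quin.dist_l2 Quin.ho_l2,
    Quin.fields Quin.l3 rfl Quin.fc_l3 Quin.dist_l3 Quin.ho_l3,
    Quin.fields Quin.l4 rfl Quin.fc_l4 Quin.dist_l4 Quin.ho_l4⟩
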